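/- Let c_n denote the number of congruence subgroups of SL_2(ℤ) of index at most n. Then the liminf as n → ∞ of (log c_n) / ((log n)^2 / log log n) is at least (3 − 2√2)/4. -/

import Mathlib

open Filter

/-- `H` is a congruence subgroup of `SL_d(ℤ)`: it contains the kernel of the
reduction homomorphism `SL_d(ℤ) → SL_d(ℤ/mℤ)` for some integer `m ≥ 1`. -/
def IsCongruenceSubgroup {d : ℕ} (H : Subgroup (Matrix.SpecialLinearGroup (Fin d) ℤ)) : Prop :=
  ∃ m : ℕ, 1 ≤ m ∧
    (Matrix.SpecialLinearGroup.map (n := Fin d) (Int.castRingHom (ZMod m))).ker ≤ H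

/-- The number of congruence subgroups of `SL_d(ℤ)` of index at most `n`. -/
noncomputable def congCount (d n : ℕ) : ℕ :=
  Nat.card {H : Subgroup (Matrix.SpecialLinearGroup (Fin d) ℤ) //
    IsCongruenceSubgroup H ∧ H.index ≤ n}


namespace CG
open Matrix Matrix.SpecialLinearGroup ModularGroup CongruenceSubgroup
open scoped MatrixGroups

/-- lower unipotent -/
def lowU (x : ℤ) : SL(2, ℤ) := S * T ^ (-x) * S⁻¹

lemma coe_lowU (x : ℤ) : ((lowU x : SL(2, ℤ)) : Matrix (Fin 2) (Fin 2) ℤ) = !![1, 0; x, 1] := by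
  rw [lowU, S_inv]
  simp only [coe_mul, coe_T_zpow, coe_neg, coe_S]
  ext i j; fin_cases i <;> fin_cases j <;> simp [Matrix.mul_apply, Fin.sum_univ_two]

lemma mem_Gamma_iff {N : ℕ} {γ : SL(2, ℤ)} : γ ∈ Gamma N ↔
    ((N : ℤ) ∣ γ 0 0 - 1 ∧ (N : ℤ) ∣ γ 0 1 ∧ (N : ℤ) ∣ γ 1 0 ∧ (N : ℤ) ∣ γ 1 1 - 1) := by
  rw [Gamma_mem]
  simp only [← ZMod.intCast_zmod_eq_zero_iff_dvd, Int.cast_sub, Int.cast_one, sub_eq_zero,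
    ← ZMod.intCast_zmod_eq_zero_iff_dvd]

lemma Gamma_anti {a b : ℕ} (h : a ∣ b) : Gamma b ≤ Gamma a := by
  intro γ hγ
  rw [mem_Gamma_iff] at *
  have : (a : ℤ) ∣ b := by exact_mod_cast h
  exact ⟨this.trans hγ.1, this.trans hγ.2.1, this.trans hγ.2.2.1, this.trans hγ.2.2.2⟩

lemma det_eq (γ : SL(2, ℤ)) : γ 0 0 * γ 1 1 - γ 0 1 * γ 1 0 = 1 := by
  have := γ.det_coe
  rwa [Matrix.det_fin_two] at this

lemma T_mul_apply (x : ℤ) (γ : SL(2, ℤ)) :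
    (T ^ x * γ) 0 0 = γ 0 0 + x * γ 1 0 ∧ (T ^ x * γ) 0 1 = γ 0 1 + x * γ 1 1 ∧
    (T ^ x * γ) 1 0 = γ 1 0 ∧ (T ^ x * γ) 1 1 = γ 1 1 := by
  simp [coe_mul, coe_T_zpow, Matrix.mul_apply, Fin.sum_univ_two]

lemma lowU_mul_apply (x : ℤ) (γ : SL(2, ℤ)) :
    (lowU x * γ) 0 0 = γ 0 0 ∧ (lowU x * γ) 0 1 = γ 0 1 ∧
    (lowU x * γ) 1 0 = x * γ 0 0 + γ 1 0 ∧ (lowU x * γ) 1 1 = x * γ 0 1 + γ 1 1 := by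
  simp [coe_mul, coe_lowU, Matrix.mul_apply, Fin.sum_univ_two]

lemma wohlA {N : ℕ} {H : Subgroup SL(2, ℤ)} (hN : Gamma N ≤ H) {γ : SL(2, ℤ)}
    (h1 : (N : ℤ) ∣ γ 0 0 - 1) (hb : T ^ (γ 0 1) ∈ H) (hc : lowU (γ 1 0) ∈ H)  : γ ∈ H := by
  have hc' : lowU (-γ 1 0) * lowU (γ 1 0) = 1 := by
    ext i j
    rw [coe_mul, coe_lowU, coe_lowU]
    fin_cases i <;> fin_cases j <;> simp [Matrix.mul_apply, Fin.sum_univ_two]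
  have hc2 : lowU (-γ 1 0) ∈ H := by
    rw [eq_inv_of_mul_eq_one_left hc']; exact H.inv_mem hc
  have hb2 : T ^ (-γ 0 1) ∈ H := by rw [_root_.zpow_neg]; exact H.inv_mem hb
  have key : T ^ (-γ 0 1) * (lowU (-γ 1 0) * γ) ∈ Gamma N := by
    rw [mem_Gamma_iff]
    obtain ⟨a1, a2, a3, a4⟩ := T_mul_apply (-γ 0 1) (lowU (-γ 1 0) * γ)
    obtain ⟨b1, b2, b3, b4⟩ := lowU_mul_apply (-γ 1 0) γ
    rw [a1, a2, a3, a4, b1, b2, b3, b4]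
    obtain ⟨u, hu⟩ := h1
    have hd := det_eq γ
    have ha : γ 0 0 = 1 + N * u := by linarith
    rw [ha] at hd
    set b := γ 0 1
    set c := γ 1 0
    set e := γ 1 1
    rw [ha]
    have he : e - b * c = 1 - N * u * e := by linear_combination hd
    refine ⟨⟨u + b * c * u, by ring⟩, ⟨b * u * e, ?_⟩, ⟨- c * u, by ring⟩, ⟨- u * e, ?_⟩⟩
    · linear_combination (-b) * he
    · linear_combination he
  have := hN key
  rw [Subgroup.mul_mem_cancel_left H hb2, Subgroup.mul_mem_cancel_left H hc2] at this
  exact this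

lemma conj_zpow_mem {H : Subgroup SL(2, ℤ)} {d : ℕ} (hc : ∀ g : SL(2, ℤ), g * T ^ d * g⁻¹ ∈ H)
    (g : SL(2, ℤ)) {x : ℤ} (hx : (d : ℤ) ∣ x) : g * T ^ x * g⁻¹ ∈ H := by
  obtain ⟨y, rfl⟩ := hx
  rw [_root_.zpow_mul, zpow_natCast, ← conj_zpow]
  exact H.zpow_mem (hc g) y

lemma T_mem_of {H : Subgroup SL(2, ℤ)} {d : ℕ} (hc : ∀ g : SL(2, ℤ), g * T ^ d * g⁻¹ ∈ H)
    {x : ℤ} (hx : (d : ℤ) ∣ x) : T ^ x ∈ H := by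
  simpa using conj_zpow_mem hc 1 hx

lemma lowU_mem_of {H : Subgroup SL(2, ℤ)} {d : ℕ} (hc : ∀ g : SL(2, ℤ), g * T ^ d * g⁻¹ ∈ H)
    {x : ℤ} (hx : (d : ℤ) ∣ x) : lowU x ∈ H := conj_zpow_mem hc S (by simpa using hx)

lemma wohl {d p : ℕ} (hp : p.Prime) {H : Subgroup SL(2, ℤ)} (hN : Gamma (d * p) ≤ H)
    (hc : ∀ g : SL(2, ℤ), g * T ^ d * g⁻¹ ∈ H) : Gamma d ≤ H := by
  intro γ hγ
  have hpZ : Prime (p : ℤ) := Nat.prime_iff_prime_int.mp hp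
  by_cases hpd : p ∣ d
  · -- additive case
    have hγ' := mem_Gamma_iff.1 hγ
    obtain ⟨⟨u, hu⟩, ⟨b, hb⟩, ⟨c, hc'⟩, ⟨e, he⟩⟩ := hγ'
    set C : SL(2, ℤ) := lowU 1 * T ^ ((d : ℤ) * u) * (lowU 1)⁻¹ with hC
    have hCH : C ∈ H := conj_zpow_mem hc _ (Dvd.intro _ rfl)
    have hCm : (C : Matrix (Fin 2) (Fin 2) ℤ) = !![1 - d * u, d * u; - (d * u), 1 + d * u] := by
      rw [hC]
      simp only [coe_mul, coe_inv, coe_lowU, coe_T_zpow, adjugate_fin_two]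
      ext i j
      fin_cases i <;> fin_cases j <;> simp [Matrix.mul_apply, Fin.sum_univ_two] <;> ring
    rw [← Subgroup.mul_mem_cancel_left H hCH]
    have e00 : (C * γ) 0 0 = (1 - d * u) * γ 0 0 + d * u * γ 1 0 := by
      simp [coe_mul, hCm, Matrix.mul_apply, Fin.sum_univ_two]
    have e01 : (C * γ) 0 1 = (1 - d * u) * γ 0 1 + d * u * γ 1 1 := by
      simp [coe_mul, hCm, Matrix.mul_apply, Fin.sum_univ_two]
    have e10 : (C * γ) 1 0 = - (d * u) * γ 0 0 + (1 + d * u) * γ 1 0 := by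
      simp [coe_mul, hCm, Matrix.mul_apply, Fin.sum_univ_two]
    obtain ⟨f, hf⟩ := hpd
    have hf' : (d : ℤ) = p * f := by exact_mod_cast hf
    refine wohlA hN ?_ (T_mem_of hc ?_) (lowU_mem_of hc ?_)
    · rw [e00, hc']
      have : γ 0 0 = 1 + d * u := by linarith
      rw [this]
      refine ⟨f * (- u * u + u * c), ?_⟩
      push_cast
      have : (1 - (d:ℤ) * u) * (1 + d * u) + d * u * (d * c) - 1 = d * d * (- u * u + u * c) := by ring
      rw [this]
      nth_rw 2 [hf']
      ring
    · rw [e01, hb]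
      exact ⟨(1 - d * u) * b + u * γ 1 1, by ring⟩
    · rw [e10, hc']
      exact ⟨- u * γ 0 0 + (1 + d * u) * c, by ring⟩
  · have hcop : IsCoprime (d : ℤ) (p : ℤ) := by
      rw [Nat.isCoprime_iff_coprime]
      exact ((Nat.Prime.coprime_iff_not_dvd hp).2 hpd).symm
    -- case c unit
    have main : ∀ γ : SL(2, ℤ), γ ∈ Gamma d → ¬ (p : ℤ) ∣ γ 1 0 → γ ∈ H := by
      intro γ hγ hcu
      obtain ⟨⟨u, hu⟩, ⟨b, hb⟩, ⟨c, hc'⟩, ⟨e, he⟩⟩ := mem_Gamma_iff.1 hγ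
      have hco : IsCoprime ((p : ℤ)) (d * γ 1 0) :=
        IsCoprime.mul_right hcop.symm ((Prime.coprime_iff_not_dvd hpZ).2 hcu)
      obtain ⟨r, s, hrs⟩ := hco
      set x := s * (1 - γ 0 0) with hx
      have hTH : T ^ ((d : ℤ) * x) ∈ H := T_mem_of hc (Dvd.intro _ rfl)
      rw [← Subgroup.mul_mem_cancel_left H hTH]
      obtain ⟨a1, a2, a3, a4⟩ := T_mul_apply (d * x) γ
      refine wohlA hN ?_ (T_mem_of hc ?_) (lowU_mem_of hc ?_)
      · rw [a1]
        push_cast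
        refine hcop.mul_dvd ?_ ?_
        · exact ⟨u + x * γ 1 0, by linear_combination hu⟩
        · refine ⟨r * (γ 0 0 - 1), ?_⟩
          rw [hx]
          linear_combination (1 - γ 0 0) * hrs
      · rw [a2, hb]; exact ⟨b + x * γ 1 1, by ring⟩
      · rw [a3, hc']; exact ⟨c, by ring⟩
    by_cases hcu : (p : ℤ) ∣ γ 1 0
    · have hLH : lowU (d : ℤ) ∈ H := lowU_mem_of hc (dvd_refl _)
      rw [← Subgroup.mul_mem_cancel_left H hLH]
      apply main
      · refine (Gamma d).mul_mem ?_ hγ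
        rw [mem_Gamma_iff, coe_lowU]
        simp
      · rw [(lowU_mul_apply _ γ).2.2.1]
        intro h
        have h2 : (p : ℤ) ∣ d * γ 0 0 := (dvd_add_left hcu).1 h
        rcases hpZ.dvd_or_dvd h2 with h3 | h3
        · exact hpd (by exact_mod_cast h3)
        · have hd := det_eq γ
          have : (p : ℤ) ∣ 1 := by
            rw [← hd]
            exact dvd_sub (Dvd.dvd.mul_right h3 _) (Dvd.dvd.mul_left hcu _)
          exact hpZ.not_dvd_one this
    · exact main γ hγ hcu


lemma Gamma_coprime {a b : ℕ} (h : Nat.Coprime a b) {γ : SL(2, ℤ)} (ha : γ ∈ Gamma a)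
    (hb : γ ∈ Gamma b) : γ ∈ Gamma (a * b) := by
  have hc : IsCoprime (a : ℤ) b := Nat.isCoprime_iff_coprime.2 h
  rw [mem_Gamma_iff] at *
  push_cast
  exact ⟨hc.mul_dvd ha.1 hb.1, hc.mul_dvd ha.2.1 hb.2.1, hc.mul_dvd ha.2.2.1 hb.2.2.1,
    hc.mul_dvd ha.2.2.2 hb.2.2.2⟩

lemma lift2 {a b : ℕ} (h : Nat.Coprime a b) (g : SL(2, ℤ)) :
    ∃ g' : SL(2, ℤ), g' ∈ Gamma a ∧ g⁻¹ * g' ∈ Gamma b := by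
  have : (Gamma a).Normal := Gamma_normal a
  have hbn : (Gamma b).Normal := Gamma_normal b
  suffices (Gamma a ⊔ Gamma b : Subgroup SL(2, ℤ)) = ⊤ by
    have hg : g ∈ (Gamma a ⊔ Gamma b : Subgroup SL(2, ℤ)) := by rw [this]; trivial
    rw [Subgroup.mem_sup_of_normal_left] at hg
    obtain ⟨y, hy, z, hz, rfl⟩ := hg
    refine ⟨y, hy, ?_⟩
    have : (y * z)⁻¹ * y = z⁻¹ := by group
    rw [this]; exact (Gamma b).inv_mem hz
  set K : Subgroup SL(2, ℤ) := Gamma a ⊔ Gamma b with hK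
  have hKn : K.Normal := by rw [hK]; infer_instance
  have hT : T ∈ K := by
    have hc : IsCoprime (a : ℤ) b := Nat.isCoprime_iff_coprime.2 h
    obtain ⟨r, s, hrs⟩ := hc
    have : T = T ^ (r * a) * T ^ (s * b) := by
      rw [← _root_.zpow_add, hrs, zpow_one]
    rw [this]
    refine Subgroup.mul_mem_sup ?_ ?_
    · rw [mem_Gamma_iff, coe_T_zpow]; simp
    · rw [mem_Gamma_iff, coe_T_zpow]; simp
  rw [← top_le_iff, ← SpecialLinearGroup.SL2Z_generators, Subgroup.closure_le]
  have hS : S ∈ K := by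
    have h1 : lowU 1 ∈ K := hKn.conj_mem _ (K.zpow_mem hT _) S
    have : S = T⁻¹ * lowU 1 * T⁻¹ := by
      ext i j
      rw [coe_mul, coe_mul, coe_lowU, coe_T_inv, coe_S]
      fin_cases i <;> fin_cases j <;> simp [Matrix.mul_apply, Fin.sum_univ_two]
    rw [this]
    exact K.mul_mem (K.mul_mem (K.inv_mem hT) h1) (K.inv_mem hT)
  intro x hx
  rcases hx with rfl | hx
  · exact hS
  · rw [Set.mem_singleton_iff] at hx; subst hx; exact hT

lemma liftMany (s : Finset ℕ) (f : ℕ → ℕ) (hf : (s : Set ℕ).Pairwise (Function.onFun Nat.Coprime f))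
    (g : ℕ → SL(2, ℤ)) : ∃ γ : SL(2, ℤ), ∀ p ∈ s, (g p)⁻¹ * γ ∈ Gamma (f p) := by
  induction s using Finset.induction_on with
  | empty => exact ⟨1, by simp⟩
  | insert q s hq ih =>
    obtain ⟨γ, hγ⟩ := ih (hf.mono (by simp))
    have hco : Nat.Coprime (∏ p ∈ s, f p) (f q) := by
      apply Nat.Coprime.prod_left
      intro p hp
      exact hf (by simp [hp]) (by simp) (by rintro rfl; exact hq hp)
    obtain ⟨h, h1, h2⟩ := lift2 hco (γ⁻¹ * g q)
    refine ⟨γ * h, ?_⟩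
    intro p hp
    rcases Finset.mem_insert.1 hp with rfl | hp
    · have : (g p)⁻¹ * (γ * h) = (γ⁻¹ * g p)⁻¹ * h := by group
      rw [this]; exact h2
    · rw [← mul_assoc]
      exact (Gamma (f p)).mul_mem (hγ p hp) (Gamma_anti (Finset.dvd_prod_of_mem f hp) h1)

theorem level_le_index (H : Subgroup SL(2, ℤ)) (hH : ∃ m : ℕ, 1 ≤ m ∧ Gamma m ≤ H) :
    ∃ m : ℕ, 1 ≤ m ∧ m ≤ H.index ∧ Gamma m ≤ H := by
  classical
  set m := Nat.find hH with hm
  obtain ⟨hm1, hmH⟩ := Nat.find_spec hH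
  have hmin : ∀ d, d < m → ¬ (1 ≤ d ∧ Gamma d ≤ H) := fun d hd => Nat.find_min hH hd
  rw [← hm] at hm1 hmH
  refine ⟨m, hm1, ?_, hmH⟩
  have h1 : ∀ p : ℕ, ∃ g : SL(2, ℤ), p ∈ m.primeFactors → g * T ^ (m / p) * g⁻¹ ∉ H := by
    intro p
    by_cases hp : p ∈ m.primeFactors
    · by_contra! hcon
      have hpp := Nat.prime_of_mem_primeFactors hp
      have hpd := Nat.dvd_of_mem_primeFactors hp
      refine hmin (m / p) (Nat.div_lt_self hm1 hpp.one_lt) ⟨Nat.div_pos (Nat.le_of_dvd hm1 hpd) hpp.pos, ?_⟩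
      refine wohl hpp (d := m / p) ?_ (fun g => (hcon g).2)
      rw [Nat.div_mul_cancel hpd]; exact hmH
    · exact ⟨1, fun h => absurd h hp⟩
  choose gp hgp using h1
  obtain ⟨g, hg⟩ := liftMany m.primeFactors (fun p => p ^ m.factorization p) (by
    intro p hp q hq hpq
    exact Nat.Coprime.pow _ _ ((Nat.coprime_primes (Nat.prime_of_mem_primeFactors hp)
      (Nat.prime_of_mem_primeFactors hq)).2 hpq)) gp
  have h2 : ∀ p ∈ m.primeFactors, g * T ^ (m / p) * g⁻¹ ∉ H := by
    intro p hp hcon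
    have hpp := Nat.prime_of_mem_primeFactors hp
    have hpd := Nat.dvd_of_mem_primeFactors hp
    apply hgp p hp
    set γ := (gp p)⁻¹ * g with hγ
    have hγm : γ ∈ Gamma (p ^ m.factorization p) := hg p hp
    set t : SL(2, ℤ) := T ^ (m / p) with ht
    have hco : Nat.Coprime (p ^ m.factorization p) (m / p ^ m.factorization p) :=
      Nat.coprime_ordCompl hpp (by omega) |>.pow_left _
    have htm : t ∈ Gamma (m / p ^ m.factorization p) := by
      have : (m / p ^ m.factorization p) ∣ m / p := by
        apply Nat.div_dvd_div_left _ _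
        · exact Nat.ordProj_dvd m p
        · exact dvd_pow_self _ (Finsupp.mem_support_iff.1 (by simpa using hp))
      rw [ht, ← zpow_natCast, mem_Gamma_iff, coe_T_zpow]
      simp only [of_apply, cons_val', cons_val_zero, cons_val_one]
      refine ⟨by simp, ?_, by simp, by simp⟩
      exact_mod_cast this
    have n1 := Gamma_normal (p ^ m.factorization p)
    have n2 := Gamma_normal (m / p ^ m.factorization p)
    have n3 := Gamma_normal m
    have hcomm : γ * t * γ⁻¹ * t⁻¹ ∈ Gamma m := by
      rw [← Nat.ordProj_mul_ordCompl_eq_self m p]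
      apply Gamma_coprime hco
      · have : γ * t * γ⁻¹ * t⁻¹ = γ * (t * γ⁻¹ * t⁻¹) := by group
        rw [this]
        exact Subgroup.mul_mem _ hγm (n1.conj_mem _ (Subgroup.inv_mem _ hγm) t)
      · exact Subgroup.mul_mem _ (n2.conj_mem _ htm γ) (Subgroup.inv_mem _ htm)
    have h3 : gp p * (γ * t * γ⁻¹ * t⁻¹) * (gp p)⁻¹ ∈ H := hmH (n3.conj_mem _ hcomm _)
    have h4 : gp p * t * (gp p)⁻¹ = (gp p * (γ * t * γ⁻¹ * t⁻¹) * (gp p)⁻¹)⁻¹ * (g * t * g⁻¹) := by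
      rw [hγ]; group
    rw [h4]
    exact H.mul_mem (H.inv_mem h3) hcon
  have h3 : ∀ k : ℤ, g * T ^ k * g⁻¹ ∈ H → (m : ℤ) ∣ k := by
    intro k hk
    have hmm : g * T ^ (m : ℤ) * g⁻¹ ∈ H := by
      apply hmH
      apply (Gamma_normal m).conj_mem
      rw [mem_Gamma_iff, coe_T_zpow]; simp
    have hw : g * T ^ ((Int.gcd k m : ℕ) : ℤ) * g⁻¹ ∈ H := by
      rw [Int.gcd_eq_gcd_ab, _root_.zpow_add, _root_.zpow_mul, _root_.zpow_mul]
      have : g * ((T ^ k) ^ (k.gcdA ↑m) * (T ^ (m:ℤ)) ^ (k.gcdB ↑m)) * g⁻¹ =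
        (g * T ^ k * g⁻¹) ^ (k.gcdA ↑m) * (g * T ^ (m:ℤ) * g⁻¹) ^ (k.gcdB ↑m) := by
        rw [conj_zpow, conj_zpow]; group
      rw [this]
      exact H.mul_mem (H.zpow_mem hk _) (H.zpow_mem hmm _)
    set w := Int.gcd k m with hwdef
    have hwm : w ∣ m := by
      have := Int.gcd_dvd_right k m
      exact_mod_cast this
    have hwk : (w : ℤ) ∣ k := Int.gcd_dvd_left k m
    by_cases hwe : w = m
    · rwa [hwe] at hwk
    · exfalso
      obtain ⟨c, hc⟩ := hwm
      have hc1 : c ≠ 1 := by rintro rfl; exact hwe (by simpa using hc.symm)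
      obtain ⟨p, hp, hpc⟩ := Nat.exists_prime_and_dvd hc1
      have hpm : p ∈ m.primeFactors := Nat.mem_primeFactors.2 ⟨hp, hc ▸ Dvd.dvd.mul_left hpc _, by omega⟩
      apply h2 p hpm
      obtain ⟨e, he⟩ := hpc
      have : m / p = w * e := by
        rw [hc, he]
        apply Nat.div_eq_of_eq_mul_left hp.pos; ring
      rw [this, pow_mul, ← conj_pow]
      exact H.pow_mem (by simpa using hw) _
  have : NeZero m := ⟨by omega⟩
  have : H.FiniteIndex := Subgroup.finiteIndex_of_le hmH
  have hinj : Function.Injective (fun i : Fin m => ((g * T ^ (-(i : ℤ)) * g⁻¹ : SL(2, ℤ)) : SL(2, ℤ) ⧸ H)) := by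
    intro i j hij
    rw [QuotientGroup.eq] at hij
    have : (g * T ^ (-(i : ℤ)) * g⁻¹)⁻¹ * (g * T ^ (-(j : ℤ)) * g⁻¹) = g * T ^ ((i : ℤ) - j) * g⁻¹ := by
      rw [sub_eq_add_neg, _root_.zpow_add]; group
    rw [this] at hij
    have h4 := h3 _ hij
    have hi := i.2
    have hj := j.2
    have := Int.eq_zero_of_abs_lt_dvd h4 (by rw [abs_lt]; constructor <;> omega)
    ext; omega
  have := Nat.card_le_card_of_injective _ hinj
  simpa [Subgroup.index] using this

end CG


namespace CG

lemma dickson_num {g o1 o2 o3 a1 a2 a3 : ℕ} (h : g + 2 = o1 + o2 + o3)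
   (h1 : o1 * a1 = g) (h2 : o2 * a2 = g) (h3 : o3 * a3 = g) (k1 : 2 ≤ a1) (k2 : 2 ≤ a2) (k3 : 2 ≤ a3)
   (l1 : o1 ≤ o2) (l2 : o2 ≤ o3) : o1 ≤ 12 := by
  have e3 : a3 = 2 := by
    by_contra hne
    have : 3 ≤ a3 := by omega
    have : o3 * 3 ≤ g := h3 ▸ Nat.mul_le_mul_left _ this
    omega
  subst e3
  have e2 : a2 ≤ 3 := by
    by_contra hne
    have : 4 ≤ a2 := by omega
    have : o2 * 4 ≤ g := h2 ▸ Nat.mul_le_mul_left _ this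
    omega
  interval_cases a2
  · omega
  · have e1 : a1 ≤ 5 := by
      by_contra hne
      have : 6 ≤ a1 := by omega
      have : o1 * 6 ≤ g := h1 ▸ Nat.mul_le_mul_left _ this
      omega
    interval_cases a1 <;> omega


open MulAction in
lemma dickson_abs {G Ω : Type*} [Group G] [Finite G] [MulAction G Ω] (Z : Subgroup G) [hN : Z.Normal]
    (hZ : ∀ g ∈ Z, ∀ x : Ω, g • x = x) (hne : Z ≠ ⊤)
    (h2 : ∀ g ∉ Z, (fixedBy Ω g).ncard = 2) : ∃ x : Ω, (stabilizer G x).index ≤ 12 := by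
  classical
  have := Fintype.ofFinite G
  have hZs : ∀ x : Ω, Z ≤ stabilizer G x := fun x g hg => hZ g hg x
  let X : SubMulAction G Ω :=
    { carrier := {x | ∃ g ∉ Z, g • x = x}
      smul_mem' := by
        rintro c x ⟨g, hg, hx⟩
        refine ⟨c * g * c⁻¹, fun hc => hg ?_, by simp [mul_smul, hx]⟩
        have := hN.conj_mem _ hc c⁻¹
        simpa [mul_assoc] using this }
  have hXfin : Finite X := by
    have : (X : Set Ω) = ⋃ g ∈ {g : G | g ∉ Z}, fixedBy Ω g := by
      ext x; simp [X, mem_fixedBy, SubMulAction.mem_carrier.symm]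
    have hf : (X : Set Ω).Finite := by
      rw [this]
      refine Set.Finite.biUnion (Set.toFinite _) ?_
      intro g hg
      exact Set.finite_of_ncard_ne_zero (by rw [h2 g hg]; norm_num)
    exact hf
  have := Fintype.ofFinite X
  let O := Quotient (orbitRel G X)
  have hB := sum_card_fixedBy_eq_card_orbits_mul_card_group G X
  -- orbit sizes
  have hXc : Fintype.card X = ∑ ω : O, Fintype.card (orbit G ω.out) := by
    rw [← Fintype.card_sigma]
    refine (Fintype.card_congr (selfEquivSigmaOrbits G X)).trans ?_
    rfl
  have hfx : ∀ g : G, Fintype.card (fixedBy X g) = if g ∈ Z then Fintype.card X else 2 := by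
    intro g
    split_ifs with hg
    · rw [Fintype.card_eq_nat_card, ← Nat.card_eq_fintype_card]
      have : fixedBy X g = Set.univ := by
        ext x; simp [mem_fixedBy, Subtype.ext_iff, hZ g hg]
      rw [this]; exact Nat.card_congr (Equiv.Set.univ _)
    · rw [← h2 g hg, ← Nat.card_eq_fintype_card, ← Nat.card_coe_set_eq]
      refine Nat.card_congr ⟨fun x => ⟨x.1.1, ?_⟩, fun x => ⟨⟨x.1, ⟨g, hg, x.2⟩⟩, ?_⟩, ?_, ?_⟩
      · have := x.2
        rw [mem_fixedBy, Subtype.ext_iff] at this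
        exact this
      · rw [mem_fixedBy, Subtype.ext_iff]; exact x.2
      · intro x; rfl
      · intro x; rfl
  simp_rw [hfx] at hB
  have hz : (Finset.univ.filter (fun g : G => g ∈ Z)).card = Nat.card Z := by
    rw [Nat.card_eq_fintype_card, Fintype.card_subtype]
  have hz' : Nat.card Z + (Finset.univ.filter (fun g : G => g ∉ Z)).card = Nat.card G := by
    rw [← hz, Finset.card_filter_add_card_filter_not, Finset.card_univ, Nat.card_eq_fintype_card]
  rw [Finset.sum_ite] at hB
  simp only [Finset.sum_const, smul_eq_mul] at hB
  rw [hz] at hB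
  set z := Nat.card Z with hzdef
  have hzpos : 0 < z := Nat.card_pos
  set g := Z.index with hgdef
  have hgz : z * g = Nat.card G := Subgroup.card_mul_index Z
  rw [← Nat.card_eq_fintype_card (α := G), ← hgz] at hB
  have hg2 : 2 ≤ g := by
    have h1 : g ≠ 1 := fun h => hne (Subgroup.index_eq_one.mp h)
    have h0 : g ≠ 0 := by
      intro h; rw [h] at hgz; have := Nat.card_pos (α := G); omega
    omega
  let o : O → ℕ := fun ω => Fintype.card (orbit G ω.out)
  have ho : ∀ ω, ∃ a, 2 ≤ a ∧ o ω * a = g ∧ (stabilizer G (ω.out : Ω)).index = o ω := by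
    intro ω
    obtain ⟨k, hk, hkx⟩ := ω.out.2
    have hst : (stabilizer G (ω.out : Ω)).index = o ω := by
      have h1 : stabilizer G (ω.out : Ω) = stabilizer G ω.out := by
        ext k; simp [mem_stabilizer_iff, Subtype.ext_iff]
      rw [h1, index_stabilizer, ← Nat.card_coe_set_eq, Nat.card_eq_fintype_card]
    refine ⟨Z.relIndex (stabilizer G (ω.out : Ω)), ?_, ?_, hst⟩
    · have h1 : Z.relIndex (stabilizer G (ω.out : Ω)) ≠ 1 := by
        intro h
        rw [Subgroup.relIndex_eq_one] at h
        exact hk (h hkx)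
      have h0 : Z.relIndex (stabilizer G (ω.out : Ω)) ≠ 0 := Subgroup.index_ne_zero_of_finite
      omega
    · rw [← hst, mul_comm]; exact Subgroup.relIndex_mul_index (hZs _)
  choose a ha2 ha hao using ho
  have hXo : Fintype.card X = ∑ ω, o ω := hXc
  suffices h : ∃ ω, o ω ≤ 12 by
    obtain ⟨ω, h⟩ := h; exact ⟨_, (hao ω).trans_le h⟩
  -- main equation
  have hmain : (∑ ω, o ω) + 2 * g = Fintype.card O * g + 2 := by
    have : z * ((∑ ω, o ω) + 2 * g) = z * (Fintype.card O * g + 2) := by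
      rw [← hXo]
      have e : (Finset.univ.filter (fun g : G => g ∉ Z)).card = z * g - z := by omega
      have e2 : z ≤ z * g := by nlinarith
      rw [e] at hB
      zify [e2] at hB ⊢
      linear_combination hB
    exact Nat.eq_of_mul_eq_mul_left hzpos this
  have hhalf : 2 * (∑ ω, o ω) ≤ Fintype.card O * g := by
    rw [Finset.mul_sum, ← smul_eq_mul, ← Finset.card_univ, ← Finset.sum_const]
    refine Finset.sum_le_sum fun ω _ => ?_
    have := ha2 ω; have := ha ω
    nlinarith
  have hcard : Fintype.card O ≤ 3 := by
    by_contra hc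
    have : 4 ≤ Fintype.card O := by omega
    nlinarith
  clear_value o
  obtain ⟨r, hr⟩ : ∃ r, Fintype.card O = r := ⟨_, rfl⟩
  let e := Fintype.equivFinOfCardEq hr
  rw [← e.symm.sum_comp] at hmain
  rw [hr] at hmain hcard
  clear_value e
  clear hB
  interval_cases r
  · simp at hmain; omega
  · simp at hmain
    have := ha (e.symm 0); have := ha2 (e.symm 0)
    nlinarith
  · rw [Fin.sum_univ_two] at hmain
    exact ⟨e.symm 0, by omega⟩
  · rw [Fin.sum_univ_three] at hmain
    have key := @dickson_num g
    set x := e.symm 0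
    set y := e.symm 1
    set w := e.symm 2
    have hm : g + 2 = o x + o y + o w := by omega
    rcases le_total (o x) (o y) with h1 | h1 <;> rcases le_total (o y) (o w) with h2 | h2 <;>
      rcases le_total (o x) (o w) with h3 | h3
    · exact ⟨x, key hm (ha x) (ha y) (ha w) (ha2 x) (ha2 y) (ha2 w) h1 h2⟩
    · exact ⟨x, key hm (ha x) (ha y) (ha w) (ha2 x) (ha2 y) (ha2 w) h1 h2⟩
    · exact ⟨x, key (by omega) (ha x) (ha w) (ha y) (ha2 x) (ha2 w) (ha2 y) h3 h2⟩
    · exact ⟨w, key (by omega) (ha w) (ha x) (ha y) (ha2 w) (ha2 x) (ha2 y) h3 h1⟩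
    · exact ⟨y, key (by omega) (ha y) (ha x) (ha w) (ha2 y) (ha2 x) (ha2 w) h1 h3⟩
    · exact ⟨y, key (by omega) (ha y) (ha w) (ha x) (ha2 y) (ha2 w) (ha2 x) h2 h3⟩
    · exact ⟨w, key (by omega) (ha w) (ha y) (ha x) (ha2 w) (ha2 y) (ha2 x) h2 h1⟩
    · exact ⟨w, key (by omega) (ha w) (ha y) (ha x) (ha2 w) (ha2 y) (ha2 x) h2 h1⟩

end CG


namespace CG
open Matrix Matrix.SpecialLinearGroup
open scoped MatrixGroups OnePoint

section
variable {K : Type*} [Field K] 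

lemma detK {R : Type*} [CommRing R] (γ : SL(2, R)) : γ 0 0 * γ 1 1 - γ 0 1 * γ 1 0 = 1 := by
  have := γ.det_coe
  rwa [Matrix.det_fin_two] at this

lemma SL_ext {R : Type*} [CommRing R] {a b : SL(2, R)} (h1 : a 0 0 = b 0 0) (h2 : a 0 1 = b 0 1) (h3 : a 1 0 = b 1 0)
    (h4 : a 1 1 = b 1 1) : a = b := by
  ext i j; fin_cases i <;> fin_cases j <;> assumption

lemma mulK {R : Type*} [CommRing R] (g h : SL(2, R)) (i j : Fin 2) : (g * h) i j = g i 0 * h 0 j + g i 1 * h 1 j := by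
  simp [Matrix.mul_apply, Fin.sum_univ_two]

lemma unip_order {p : ℕ} [Fact p.Prime] [CharP K p] (hp2 : p ≠ 2) (h : SL(2, K))
    (ho : ¬ p ∣ orderOf h) (e : K) (he : e = 1 ∨ e = -1) (ht : h 0 0 + h 1 1 = 2 * e) :
    (h : Matrix (Fin 2) (Fin 2) K) = e • (1 : Matrix (Fin 2) (Fin 2) K) := by
  have hp := Fact.out (p := p.Prime)
  have hee : e * e = 1 := by rcases he with rfl | rfl <;> norm_num
  set M : Matrix (Fin 2) (Fin 2) K := (h : Matrix (Fin 2) (Fin 2) K)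
  set N : Matrix (Fin 2) (Fin 2) K := e • M - 1 with hN
  have hdet := detK h
  have hd : h 1 1 = 2 * e - h 0 0 := by linear_combination ht
  have hNN : N ^ 2 = 0 := by
    have e1 : N = !![e * h 0 0 - 1, e * h 0 1; e * h 1 0, e * h 1 1 - 1] := by
      ext i j; fin_cases i <;> fin_cases j <;> simp [hN, M]
    rw [e1, sq, hd]
    rw [hd] at hdet
    ext i j; fin_cases i <;> fin_cases j <;> simp [Matrix.mul_apply, Fin.sum_univ_two]
    · linear_combination -e*e*hdet + (1 - 2 + 2 * e * h 0 0) * hee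
    · linear_combination (2 * e * h 0 1) * hee
    · linear_combination (2 * e * h 1 0) * hee
    · linear_combination -e*e*hdet + (3 - 2 * e * h 0 0 + 4 * (e*e-1) + 0) * hee
  have hM : e • M = 1 + N := by rw [hN]; abel
  have : CharP (Matrix (Fin 2) (Fin 2) K) p := inferInstance
  have hpow : (e • M) ^ p = 1 := by
    rw [hM, add_pow_char_of_commute _ (Commute.one_left N), one_pow]
    have : N ^ p = 0 := pow_eq_zero_of_le hp.two_le hNN
    rw [this, add_zero]
  have h2p : h ^ (p * 2) = 1 := by
    apply Subtype.ext
    rw [coe_pow, coe_one, pow_mul]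
    have : (e • M) ^ p = e ^ p • M ^ p := smul_pow _ _ _
    rw [hpow] at this
    have h3 : (e ^ p • M ^ p) ^ 2 = 1 := by rw [← this, one_pow]
    rw [smul_pow, ← pow_mul, mul_comm p 2, pow_mul, sq e, hee, one_pow, one_smul] at h3
    exact h3
  have hdvd : orderOf h ∣ 2 := by
    have := orderOf_dvd_of_pow_eq_one h2p
    exact Nat.Coprime.dvd_of_dvd_mul_left ((Nat.Prime.coprime_iff_not_dvd hp).2 ho).symm this
  have hsq : h ^ 2 = 1 := orderOf_dvd_iff_pow_eq_one.mp hdvd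
  have hsqM : M ^ 2 = 1 := by
    have := congrArg (fun x : SL(2, K) => (x : Matrix (Fin 2) (Fin 2) K)) hsq
    simpa using this
  have h2N : (2 : K) • N = 0 := by
    have h1 : (e • M) ^ 2 = 1 := by rw [smul_pow, sq e, hee, one_smul, hsqM]
    rw [hM, (Commute.one_left N).add_sq, hNN] at h1
    rw [two_smul]
    simpa [two_mul] using h1
  have h20 : (2 : K) ≠ 0 := by
    intro h
    have : ((2 : ℕ) : K) = 0 := by exact_mod_cast h
    rw [CharP.cast_eq_zero_iff K p] at this
    exact hp2 ((Nat.prime_dvd_prime_iff_eq hp Nat.prime_two).1 this)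
  have hN0 : N = 0 := (smul_eq_zero_iff_right h20).1 h2N
  rw [hN0, add_zero] at hM
  calc M = (e * e) • M := by rw [hee, one_smul]
    _ = e • 1 := by rw [mul_smul, hM]

variable [DecidableEq K]

noncomputable instance : MulAction SL(2, K) (OnePoint K) := MulAction.compHom _ (toGL (n := Fin 2) (R := K))

lemma fix_infty (g : SL(2, K)) : g • (∞ : OnePoint K) = ∞ ↔ g 1 0 = 0 := by
  change (toGL g) • (∞ : OnePoint K) = ∞ ↔ _
  rw [OnePoint.smul_infty_eq_self_iff]; rfl

lemma fix_coe (g : SL(2, K)) (k : K) : g • (k : OnePoint K) = k ↔ g 0 0 * k + g 0 1 = k * (g 1 0 * k + g 1 1) := by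
  change (toGL g) • (k : OnePoint K) = k ↔ _
  rw [OnePoint.smul_some_eq_ite]
  change (if g 1 0 * k + g 1 1 = 0 then ∞ else (((g 0 0 * k + g 0 1) / (g 1 0 * k + g 1 1) : K) : OnePoint K)) = k ↔ _
  have := detK g
  split_ifs with h
  · refine ⟨fun hg ↦ (OnePoint.infty_ne_coe _ hg).elim, fun hg ↦ ?_⟩
    exfalso
    have h1 : g 0 0 * k + g 0 1 = 0 := by rw [hg, h, mul_zero]
    have : (1 : K) = 0 := by rw [← this]; linear_combination (g 0 0) * h - g 1 0 * h1
    exact one_ne_zero this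
  · rw [OnePoint.coe_eq_coe, div_eq_iff h]

lemma fixed_two [IsAlgClosed K] (g : SL(2, K)) (ht : (g 0 0 + g 1 1) ^ 2 ≠ 4) :
    (MulAction.fixedBy (OnePoint K) g).ncard = 2 := by
  have hd := detK g
  rw [Set.ncard_eq_two]
  by_cases hc : g 1 0 = 0
  · have had : g 1 1 - g 0 0 ≠ 0 := by
      intro h
      apply ht
      rw [hc] at hd
      linear_combination 4 * hd + (g 1 1 - g 0 0) * h
    refine ⟨∞, ((g 0 1 / (g 1 1 - g 0 0) : K) : OnePoint K), OnePoint.infty_ne_coe _, ?_⟩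
    ext x
    rw [MulAction.mem_fixedBy]
    induction x using OnePoint.rec with
    | infty => simp [fix_infty, hc]
    | coe k =>
      rw [fix_coe, hc]
      simp only [Set.mem_insert_iff, OnePoint.coe_ne_infty, false_or, Set.mem_singleton_iff, OnePoint.coe_eq_coe, eq_div_iff had]
      constructor <;> intro h <;> linear_combination -h
  · obtain ⟨s, hs⟩ := IsAlgClosed.exists_eq_mul_self ((g 0 0 + g 1 1) ^ 2 - 4)
    have hs0 : s ≠ 0 := by
      rintro rfl; apply ht; linear_combination hs
    -- roots
    obtain ⟨r, hr⟩ : ∃ r : K, g 1 0 * r ^ 2 + (g 1 1 - g 0 0) * r - g 0 1 = 0 := by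
      open Polynomial in
      obtain ⟨r, hr⟩ := IsAlgClosed.exists_root (C (g 1 0) * X ^ 2 + C (g 1 1 - g 0 0) * X + C (- g 0 1)) (by
        rw [Polynomial.degree_quadratic hc]; norm_num)
      refine ⟨r, ?_⟩
      simp only [IsRoot.def, eval_add, eval_mul, eval_C, eval_pow, eval_X] at hr
      linear_combination hr
    set r' : K := (g 0 0 - g 1 1) / g 1 0 - r with hr'
    have hr'' : g 1 0 * (r + r') = g 0 0 - g 1 1 := by rw [hr']; field_simp; ring
    have hne : r ≠ r' := by
      intro h
      apply ht
      rw [← h] at hr''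
      have : g 0 0 - g 1 1 = 2 * (g 1 0 * r) := by linear_combination -hr''
      linear_combination 4 * hd + (g 0 0 - g 1 1 + 2 * g 1 0 * r) * this - 4 * g 1 0 * r * this - 4 * g 1 0 * hr
    refine ⟨r, r', by simpa using hne, ?_⟩
    ext x
    rw [MulAction.mem_fixedBy]
    induction x using OnePoint.rec with
    | infty => simp [fix_infty, hc]
    | coe k =>
      rw [fix_coe]
      simp only [Set.mem_insert_iff, Set.mem_singleton_iff, OnePoint.coe_eq_coe]
      rw [← sub_eq_zero, ← sub_eq_zero (a := k), ← sub_eq_zero (a := k) (b := r'), ← mul_eq_zero, ← mul_right_inj' hc (b := (k - r) * (k - r')), mul_zero]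
      have : g 1 0 * ((k - r) * (k - r')) = - (g 0 0 * k + g 0 1 - k * (g 1 0 * k + g 1 1)) := by
        linear_combination -(k - r) * hr'' - hr
      rw [this, neg_eq_zero]

lemma dickson [IsAlgClosed K] {p : ℕ} [Fact p.Prime] [CharP K p] (hp2 : p ≠ 2) (H : Subgroup SL(2, K))
    [Finite H] (hH : ¬ p ∣ Nat.card H) : ∃ C : Subgroup H, IsCyclic C ∧ C.index ≤ 12 := by
  have hp := Fact.out (p := p.Prime)
  have hord : ∀ h ∈ H, ¬ p ∣ orderOf h := by
    intro h hh hd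
    apply hH
    have : orderOf (⟨h, hh⟩ : H) = orderOf h := Subgroup.orderOf_mk _ _
    exact hd.trans (this ▸ orderOf_dvd_natCard _)
  have h20 : (2 : K) ≠ 0 := by
    intro h
    have : ((2 : ℕ) : K) = 0 := by exact_mod_cast h
    rw [CharP.cast_eq_zero_iff K p] at this
    exact hp2 ((Nat.prime_dvd_prime_iff_eq hp Nat.prime_two).1 this)
  let Z : Subgroup H := (Subgroup.zpowers (-1 : SL(2, K))).subgroupOf H
  have hZm : ∀ h : H, h ∈ Z → (h : SL(2, K)) = 1 ∨ (h : SL(2, K)) = -1 := by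
    intro h hh
    rw [Subgroup.mem_subgroupOf, Subgroup.mem_zpowers_iff] at hh
    obtain ⟨k, hk⟩ := hh
    rcases Int.even_or_odd k with he | ho
    · left; rw [← hk, he.neg_one_zpow]
    · right; rw [← hk, ho.neg_one_zpow]
  have hZm' : ∀ h : H, ((h : SL(2, K)) = 1 ∨ (h : SL(2, K)) = -1) → h ∈ Z := by
    intro h hh
    rw [Subgroup.mem_subgroupOf, Subgroup.mem_zpowers_iff]
    rcases hh with hh | hh
    · exact ⟨0, by rw [hh]; simp⟩
    · exact ⟨1, by rw [hh]; simp⟩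
  by_cases hZ : Z = ⊤
  · refine ⟨⊤, ?_, by simp⟩
    rw [← hZ]
    exact isCyclic_of_injective ((H.subtype.comp Z.subtype).codRestrict (Subgroup.zpowers (-1 : SL(2, K)))
      (fun x => x.2)) (by
        intro a b hab
        apply Subtype.ext; apply Subtype.ext
        have h := Subtype.ext_iff.1 hab
        exact h)
  have hZN : Z.Normal := by
    constructor
    intro n hn g
    apply hZm'
    rcases hZm n hn with h | h
    · left; simp [h]
    · right; simp [h]
  have htr : ∀ h : H, h ∉ Z → ((h : SL(2, K)) 0 0 + (h : SL(2, K)) 1 1) ^ 2 ≠ 4 := by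
    intro h hh ht
    apply hh; apply hZm'
    have h4 : ((h : SL(2, K)) 0 0 + (h : SL(2, K)) 1 1 - 2) * ((h : SL(2, K)) 0 0 + (h : SL(2, K)) 1 1 + 2) = 0 := by
      linear_combination ht
    rcases mul_eq_zero.1 h4 with h4 | h4
    · left
      have := unip_order hp2 h.1 (hord _ h.2) 1 (Or.inl rfl) (by linear_combination h4)
      apply Subtype.ext; simpa using this
    · right
      have := unip_order hp2 h.1 (hord _ h.2) (-1) (Or.inr rfl) (by linear_combination h4)
      apply Subtype.ext; simpa using this
  have hone : ∀ h : H, (h : SL(2, K)) 0 0 + (h : SL(2, K)) 1 1 = 2 → h = 1 := by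
    intro h ht
    have := unip_order hp2 h.1 (hord _ h.2) 1 (Or.inl rfl) (by linear_combination ht)
    apply Subtype.ext; apply Subtype.ext; simpa using this
  obtain ⟨x, hx⟩ := dickson_abs (Ω := OnePoint K) Z (by
      intro g hg x
      change (g : SL(2, K)) • x = x
      rcases hZm g hg with h | h
      · rw [h, one_smul]
      · rw [h]
        induction x using OnePoint.rec with
        | infty => rw [fix_infty]; simp
        | coe k => rw [fix_coe]; simp) hZ (fun g hg => by
      have := fixed_two g.1 (htr g hg)
      exact this)
  refine ⟨_, ?_, hx⟩
  have hmem : ∀ g : MulAction.stabilizer H x, (g : H).1 • x = x := fun g => g.2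
  induction x using OnePoint.rec with
  | infty =>
    simp only [fix_infty] at hmem
    refine isCyclic_of_injective_ringHom (R := K) ⟨⟨fun g => (g : H).1 1 1, ?_⟩, ?_⟩ ?_
    · simp
    · intro a b
      simp [Matrix.mul_apply, Fin.sum_univ_two, hmem]
    · refine (injective_iff_map_eq_one _).2 ?_
      intro g hg
      have hg : (g : H).1 1 1 = 1 := hg
      have hd := detK (g : H).1
      rw [hmem g, hg] at hd
      apply Subtype.ext
      exact hone _ (by rw [hg]; linear_combination hd)
  | coe k => 
    simp only [fix_coe] at hmem
    refine isCyclic_of_injective_ringHom (R := K) ⟨⟨fun g => (g : H).1 1 0 * k + (g : H).1 1 1, ?_⟩, ?_⟩ ?_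
    · simp
    · intro a b
      have h1 := hmem b
      simp [Matrix.mul_apply, Fin.sum_univ_two]
      linear_combination ((a : H) : SL(2, K)) 1 0 * h1
    · refine (injective_iff_map_eq_one _).2 ?_
      intro g hg
      have hg : (g : H).1 1 0 * k + (g : H).1 1 1 = 1 := hg
      have hd := detK (g : H).1
      have h1 := hmem g
      apply Subtype.ext
      refine hone _ ?_
      linear_combination ((g : H).1 0 0 + 1) * (- hg) + hd + hg + (g : H).1 1 0 * h1 + ((g : H).1 1 0 * k + 1) * hg
end
end CG


set_option linter.unusedSimpArgs false
namespace CG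
open Matrix Matrix.SpecialLinearGroup
open scoped MatrixGroups

/-- generated by at most r elements -/
def GenBy {G : Type*} [Group G] (H : Subgroup G) (r : ℕ) : Prop :=
  ∃ s : Finset G, s.card ≤ r ∧ Subgroup.closure (s : Set G) = H

lemma gen_index {G : Type*} [Group G] [Finite G] (H : Subgroup G) (k : ℕ) :
    ∀ (r : ℕ) (A : Subgroup G), A ≤ H → GenBy A r → A.relIndex H < 2 ^ (k + 1) → GenBy H (r + k) := by
  classical
  induction k with
  | zero =>
    intro r A hA hg hi
    have : A.relIndex H = 1 := by
      have : A.relIndex H ≠ 0 := Subgroup.index_ne_zero_of_finite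
      omega
    rw [Subgroup.relIndex_eq_one] at this
    rwa [le_antisymm hA this] at hg
  | succ k ih =>
    intro r A hA hg hi
    by_cases hH : H ≤ A
    · obtain ⟨s, hs, h⟩ := hg
      exact ⟨s, by omega, by rw [h, le_antisymm hA hH]⟩
    · obtain ⟨h, hh, hhA⟩ := SetLike.not_le_iff_exists.1 hH
      obtain ⟨s, hs, hsA⟩ := hg
      have hle : A ≤ Subgroup.closure ((insert h s : Finset G) : Set G) := by
        rw [← hsA]; exact Subgroup.closure_mono (by simp)
      have hleH : Subgroup.closure ((insert h s : Finset G) : Set G) ≤ H := by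
        rw [Subgroup.closure_le, Finset.coe_insert, Set.insert_subset_iff]
        exact ⟨hh, fun x hx => hA (hsA ▸ Subgroup.subset_closure hx)⟩
      have := ih (r + 1) (Subgroup.closure ((insert h s : Finset G) : Set G)) hleH
        ⟨insert h s, (Finset.card_insert_le _ _).trans (by omega), rfl⟩ ?_
      · rwa [show r + (k + 1) = r + 1 + k by ring]
      · have h1 := Subgroup.relIndex_mul_relIndex A _ H hle hleH
        have h2 : 2 ≤ A.relIndex (Subgroup.closure ((insert h s : Finset G) : Set G)) := by
          have h0 : A.relIndex (Subgroup.closure ((insert h s : Finset G) : Set G)) ≠ 0 := Subgroup.index_ne_zero_of_finite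
          have h1 : A.relIndex (Subgroup.closure ((insert h s : Finset G) : Set G)) ≠ 1 := by
            rw [Ne, Subgroup.relIndex_eq_one]
            intro hc
            exact hhA (hc (Subgroup.subset_closure (by simp)))
          omega
        rw [pow_succ] at hi
        nlinarith

/-- upper unipotent -/
def Up {R : Type*} [CommRing R] (x : R) : SL(2, R) := ⟨!![1, x; 0, 1], by simp [Matrix.det_fin_two]⟩
/-- lower unipotent -/
def Lo {R : Type*} [CommRing R] (x : R) : SL(2, R) := ⟨!![1, 0; x, 1], by simp [Matrix.det_fin_two]⟩

section
variable {R : Type*} [CommRing R] (x : R)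
lemma Up00 : (Up x) 0 0 = 1 := by simp [Up]
lemma Up01 : (Up x) 0 1 = x := by simp [Up]
lemma Up10 : (Up x) 1 0 = 0 := by simp [Up]
lemma Up11 : (Up x) 1 1 = 1 := by simp [Up]
lemma Lo00 : (Lo x) 0 0 = 1 := by simp [Lo]
lemma Lo01 : (Lo x) 0 1 = 0 := by simp [Lo]
lemma Lo10 : (Lo x) 1 0 = x := by simp [Lo]
lemma Lo11 : (Lo x) 1 1 = 1 := by simp [Lo]
end

lemma Up_add {R : Type*} [CommRing R] (x y : R) : Up (x + y) = Up x * Up y := by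
  apply SL_ext <;> simp [mulK, Up00, Up01, Up10, Up11, add_comm]
lemma Up_pow {R : Type*} [CommRing R] (x : R) (n : ℕ) : Up (n * x) = Up x ^ n := by
  induction n with
  | zero => rw [pow_zero]; apply SL_ext <;> simp [Up]
  | succ n ih => rw [pow_succ, ← ih, ← Up_add]; congr 1; push_cast; ring

section
variable {p : ℕ} [Fact p.Prime]

lemma Up_mem {H : Subgroup SL(2, ZMod p)} {t : ZMod p} (ht : t ≠ 0) (h : Up t ∈ H) (y : ZMod p) : Up y ∈ H := by
  have := Up_pow t (ZMod.val (y / t))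
  rw [ZMod.natCast_zmod_val, div_mul_cancel₀ _ ht] at this
  rw [this]; exact H.pow_mem h _

lemma closure_top {H : Subgroup SL(2, ZMod p)} (hU : ∀ y, Up y ∈ H) {h : SL(2, ZMod p)} (hh : h ∈ H)
    (hc : h 1 0 ≠ 0) : H = ⊤ := by
  have hd := detK h
  set c := h 1 0 with hcdef
  have hL : ∀ y, Lo y ∈ H := by
    intro y
    set w := Up (- h 0 0 / c) * h * Up (- h 1 1 / c) with hw
    have hwm : w ∈ H := H.mul_mem (H.mul_mem (hU _) hh) (hU _)
    have w00 : w 0 0 = 0 := by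
      simp only [hw, mulK, Up00, Up01, Up10, Up11, ← hcdef]; field_simp; ring
    have w10 : w 1 0 = c := by
      simp only [hw, mulK, Up00, Up01, Up10, Up11, ← hcdef]; ring
    have w11 : w 1 1 = 0 := by
      simp only [hw, mulK, Up00, Up01, Up10, Up11, ← hcdef]; field_simp; ring
    have hdw := detK w
    rw [w00, w10] at hdw
    have : Lo y = w * Up (- y / c ^ 2) * w⁻¹ := by
      rw [eq_mul_inv_iff_mul_eq]
      apply SL_ext <;> simp only [mulK, Lo00, Lo01, Lo10, Lo11, Up00, Up01, Up10, Up11, w00, w10, w11]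
      · ring
      · ring
      · ring
      · field_simp
        linear_combination (-y) * hdw
    rw [this]; exact H.mul_mem (H.mul_mem hwm (hU _)) (H.inv_mem hwm)
  rw [eq_top_iff]
  intro A _
  refine SL2.transvection_induction (fun A => A ∈ H) ?_ (fun A B hA hB => H.mul_mem hA hB) A
  intro i j hij x
  fin_cases i <;> fin_cases j
  · simp at hij
  · convert hU x using 1
    apply SL_ext <;> simp [Up, SpecialLinearGroup.transvection, Matrix.transvection, Matrix.single]
  · convert hL x using 1
    apply SL_ext <;> simp [Lo, SpecialLinearGroup.transvection, Matrix.transvection, Matrix.single]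
  · simp at hij

lemma rank_unip (H : Subgroup SL(2, ZMod p)) {t : ZMod p} (ht : t ≠ 0) (h : Up t ∈ H) : GenBy H 2 := by
  classical
  by_cases hc : ∀ g ∈ H, g 1 0 = 0
  · let D0 : H →* ZMod p := 
      { toFun := fun g => (g : SL(2, ZMod p)) 1 1
        map_one' := by simp
        map_mul' := by
          intro a b
          have := hc a a.2
          simp [Matrix.mul_apply, Fin.sum_univ_two, this] }
    let D := D0.toHomUnits
    obtain ⟨⟨_, h0, rfl⟩, hgen⟩ := IsCyclic.exists_generator (α := D.range)
    refine ⟨{Up t, h0.1}, (Finset.card_insert_le _ _).trans (by simp), le_antisymm ?_ ?_⟩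
    · rw [Subgroup.closure_le]
      simp [Set.insert_subset_iff, h]
    · intro g hg
      set A := Subgroup.closure ((({Up t, h0.1} : Finset SL(2, ZMod p))) : Set SL(2, ZMod p))
      have hU : ∀ y, Up y ∈ A := Up_mem ht (Subgroup.subset_closure (by simp))
      have hh0 : h0.1 ∈ A := Subgroup.subset_closure (by simp)
      obtain ⟨k, hk⟩ := Subgroup.mem_zpowers_iff.1 (hgen ⟨D ⟨g, hg⟩, ⟨_, rfl⟩⟩)
      have hk' : D h0 ^ k = D ⟨g, hg⟩ := by
        have := congrArg Subtype.val hk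
        simpa using this
      have hD : D (⟨g, hg⟩ * (h0 ^ k)⁻¹) = 1 := by rw [map_mul, map_inv, map_zpow, hk']; simp
      have h11 : (g * (h0.1 ^ k)⁻¹) 1 1 = 1 := by
        have := congrArg Units.val hD
        exact this
      have hgm : (g * (h0.1 ^ k)⁻¹) ∈ H := H.mul_mem hg (H.inv_mem (H.zpow_mem h0.2 _))
      have h10 := hc _ hgm
      have hd := detK (g * (h0.1 ^ k)⁻¹)
      have : g * (h0.1 ^ k)⁻¹ = Up ((g * (h0.1 ^ k)⁻¹) 0 1) := by
        rw [h11, h10] at hd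
        apply SL_ext
        · simpa [Up] using hd
        · simp [Up]
        · simpa [Up] using h10
        · simpa [Up] using h11
      have hm : g * (h0.1 ^ k)⁻¹ ∈ A := by rw [this]; exact hU _
      have := A.mul_mem hm (A.zpow_mem hh0 k)
      simpa using this
  · push Not at hc
    obtain ⟨g, hg, hgc⟩ := hc
    have h1 : H = ⊤ := closure_top (Up_mem ht h) hg hgc
    refine ⟨{Up t, g}, (Finset.card_insert_le _ _).trans (by simp), ?_⟩
    rw [h1]
    exact closure_top (Up_mem ht (Subgroup.subset_closure (by simp))) (Subgroup.subset_closure (by simp)) hgc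

lemma GenBy.map {G G' : Type*} [Group G] [Group G'] {H : Subgroup G} {r : ℕ} (h : GenBy H r) (f : G →* G') :
    GenBy (H.map f) r := by
  classical
  obtain ⟨s, hs, rfl⟩ := h
  refine ⟨s.image f, Finset.card_image_le.trans hs, ?_⟩
  rw [MonoidHom.map_closure, Finset.coe_image]

lemma GenBy.mono {G : Type*} [Group G] {H : Subgroup G} {r r' : ℕ} (h : GenBy H r) (hr : r ≤ r') : GenBy H r' := by
  obtain ⟨s, hs, h⟩ := h
  exact ⟨s, hs.trans hr, h⟩

lemma rank_p_dvd (H : Subgroup SL(2, ZMod p)) (hp : p ∣ Nat.card H) : GenBy H 2 := by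
  obtain ⟨u, hu⟩ := exists_prime_orderOf_dvd_card' p hp
  have hup : (u : SL(2, ZMod p)) ^ p = 1 := by
    have : u ^ p = 1 := orderOf_dvd_iff_pow_eq_one.1 (dvd_of_eq hu)
    simpa using congrArg Subtype.val this
  have hu1 : (u : SL(2, ZMod p)) ≠ 1 := by
    intro h
    have : u = 1 := Subtype.ext h
    rw [this, orderOf_one] at hu
    exact (Fact.out (p := p.Prime)).one_lt.ne hu
  have hdet : ((u : SL(2, ZMod p)) : Matrix (Fin 2) (Fin 2) (ZMod p)).det = 1 := u.1.2
  have hz : (((u : SL(2, ZMod p)) : Matrix (Fin 2) (Fin 2) (ZMod p)) - 1).det = 0 := by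
    have h1 : (((u : SL(2, ZMod p)) : Matrix (Fin 2) (Fin 2) (ZMod p)) - 1) ^ p = 0 := by
      rw [sub_pow_char_of_commute _ (Commute.one_right _), one_pow, ← coe_pow, hup]; simp
    have h2 := congrArg Matrix.det h1
    rw [Matrix.det_pow, Matrix.det_zero] at h2
    exact pow_eq_zero_iff (Fact.out (p := p.Prime)).ne_zero |>.1 h2
  obtain ⟨v, hv0, hv⟩ := Matrix.exists_mulVec_eq_zero_iff.2 hz
  obtain ⟨g, hg0, hg1⟩ : ∃ g : SL(2, ZMod p), g 0 0 = v 0 ∧ g 1 0 = v 1 := by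
    by_cases hx : v 0 = 0
    · have hy : v 1 ≠ 0 := by
        intro hy; apply hv0; ext i; fin_cases i <;> simp [hx, hy]
      exact ⟨⟨!![0, - 1 / v 1; v 1, 0], by rw [Matrix.det_fin_two]; simp; field_simp⟩, by simp [hx], by simp⟩
    · exact ⟨⟨!![v 0, 0; v 1, 1 / v 0], by rw [Matrix.det_fin_two]; simp; field_simp⟩, by simp, by simp⟩
  have e0 : u.1 0 0 * v 0 + u.1 0 1 * v 1 = v 0 := by
    have := congrFun hv 0
    simp [Matrix.mulVec, dotProduct, Fin.sum_univ_two, Matrix.sub_apply] at this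
    linear_combination this
  have e1 : u.1 1 0 * v 0 + u.1 1 1 * v 1 = v 1 := by
    have := congrFun hv 1
    simp [Matrix.mulVec, dotProduct, Fin.sum_univ_two, Matrix.sub_apply] at this
    linear_combination this
  set w := g⁻¹ * u.1 * g with hw
  have hgw : g * w = u.1 * g := by rw [hw]; group
  have hdg := detK g
  have hdw := detK w
  have k0 : g 0 0 * w 0 0 + g 0 1 * w 1 0 = g 0 0 := by
    rw [← mulK, hgw, mulK, hg0, hg1, e0]
  have k1 : g 1 0 * w 0 0 + g 1 1 * w 1 0 = g 1 0 := by
    rw [← mulK, hgw, mulK, hg0, hg1, e1]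
  have w10 : w 1 0 = 0 := by linear_combination (-w 1 0) * hdg - g 1 0 * k0 + g 0 0 * k1
  have w00 : w 0 0 = 1 := by linear_combination (-w 0 0 + 1) * hdg + g 1 1 * k0 - g 0 1 * k1
  have w11 : w 1 1 = 1 := by rw [w10, w00] at hdw; linear_combination hdw
  have hwU : w = Up (w 0 1) := by apply SL_ext <;> simp [Up, w00, w10, w11]
  have ht : w 0 1 ≠ 0 := by
    intro h
    apply hu1
    have : w = 1 := by apply SL_ext <;> simp [w00, w10, w11, h]
    rw [this, mul_one] at hgw
    have := mul_right_cancel (hgw.symm.trans (one_mul g).symm)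
    exact this
  have key := rank_unip (H.map (MulAut.conj g⁻¹).toMonoidHom) ht (by
    rw [← hwU]
    exact ⟨u.1, u.2, by simp [hw]⟩)
  have := key.map (MulAut.conj g).toMonoidHom
  rw [Subgroup.map_map] at this
  convert this
  have : (MulAut.conj g).toMonoidHom.comp (MulAut.conj g⁻¹).toMonoidHom = MonoidHom.id _ := by
    ext x : 1
    simp [mul_assoc]
  rw [this, Subgroup.map_id]

lemma rank_not_dvd (hp2 : p ≠ 2) (H : Subgroup SL(2, ZMod p)) (hp : ¬ p ∣ Nat.card H) : GenBy H 4 := by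
  classical
  let K := AlgebraicClosure (ZMod p)
  let f : SL(2, ZMod p) →* SL(2, K) := SpecialLinearGroup.map (algebraMap (ZMod p) K)
  have hf : Function.Injective f := by
    intro a b hab
    apply SL_ext
    all_goals
      apply (algebraMap (ZMod p) K).injective
      first 
      | exact congrArg (fun g : SL(2, K) => g 0 0) hab
      | exact congrArg (fun g : SL(2, K) => g 0 1) hab
      | exact congrArg (fun g : SL(2, K) => g 1 0) hab
      | exact congrArg (fun g : SL(2, K) => g 1 1) hab
  have : CharP K p := inferInstance
  let e := H.equivMapOfInjective f hf
  have : Finite (H.map f) := Finite.of_equiv _ e.toEquiv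
  obtain ⟨C, hC, hi⟩ := dickson hp2 (H.map f) (by rwa [← Nat.card_congr e.toEquiv])
  let C' : Subgroup H := C.comap e.toMonoidHom
  have hC' : IsCyclic C' := by
    refine isCyclic_of_injective ((e.toMonoidHom.comp C'.subtype).codRestrict C (fun x => x.2)) ?_
    intro a b hab
    have h := Subtype.ext_iff.1 hab
    exact Subtype.ext (e.injective h)
  have hi' : C'.index ≤ 12 := by
    rwa [Subgroup.index_comap_of_surjective _ e.surjective]
  obtain ⟨c, hc⟩ := IsCyclic.exists_generator (α := C')
  have hg : GenBy C' 1 := by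
    refine ⟨{c.1}, by simp, ?_⟩
    rw [Finset.coe_singleton, ← Subgroup.zpowers_eq_closure]
    apply le_antisymm
    · rw [Subgroup.zpowers_le]; exact c.2
    · intro x hx
      obtain ⟨k, hk⟩ := Subgroup.mem_zpowers_iff.1 (hc ⟨x, hx⟩)
      exact ⟨k, congrArg Subtype.val hk⟩
  have := (gen_index ⊤ 3 1 C' le_top hg (by rw [Subgroup.relIndex_top_right]; omega)).map H.subtype
  simpa [← MonoidHom.range_eq_map] using this

lemma rank_SLp (H : Subgroup SL(2, ZMod p)) : GenBy H 4 := by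
  by_cases hp : p ∣ Nat.card H
  · exact (rank_p_dvd H hp).mono (by norm_num)
  by_cases hp2 : p = 2
  · subst hp2
    have hc : Nat.card SL(2, ZMod 2) ≤ 16 := by
      refine (Nat.card_le_card_of_injective (Subtype.val) Subtype.val_injective).trans ?_
      simp [Matrix, Nat.card_eq_fintype_card]
    have hH : Nat.card H ≤ 16 := (Nat.card_le_card_of_injective _ Subtype.val_injective).trans hc
    exact gen_index H 4 0 ⊥ bot_le ⟨∅, by simp⟩ (by rw [Subgroup.relIndex_bot_left]; omega)
  · exact rank_not_dvd hp2 H hp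
end
end CG


set_option linter.unusedSimpArgs false
namespace CG
open Matrix Matrix.SpecialLinearGroup CongruenceSubgroup
open scoped MatrixGroups

section RR
variable {G : Type*} [Group G]

/-- every subgroup of K is generated by r elements modulo N -/
def RR (N K : Subgroup G) (r : ℕ) : Prop :=
  ∀ H ≤ K, ∃ s : Finset G, (s : Set G) ⊆ H ∧ s.card ≤ r ∧ H ≤ N ⊔ Subgroup.closure (s : Set G)

lemma RR.trans {N K M : Subgroup G} [N.Normal] [K.Normal] {r r' : ℕ} (h1 : RR N K r) (h2 : RR K M r') :
    RR N M (r + r') := by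
  classical
  intro H hH
  obtain ⟨s2, hs2, hc2, hg2⟩ := h2 H hH
  obtain ⟨s1, hs1, hc1, hg1⟩ := h1 (H ⊓ K) inf_le_right
  refine ⟨s1 ∪ s2, ?_, (Finset.card_union_le _ _).trans (by omega), ?_⟩
  · rw [Finset.coe_union]
    exact Set.union_subset (fun x hx => (hs1 hx).1) hs2
  · intro h hh
    obtain ⟨k, hk, c, hc, rfl⟩ := Subgroup.mem_sup_of_normal_left.1 (hg2 hh)
    have hcH : c ∈ H := (Subgroup.closure_le H).2 hs2 hc
    have hkH : k ∈ H := by simpa using H.mul_mem hh (H.inv_mem hcH)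
    have e1 : N ⊔ Subgroup.closure (s1 : Set G) ≤ N ⊔ Subgroup.closure ((s1 ∪ s2 : Finset G) : Set G) :=
      sup_le_sup_left (Subgroup.closure_mono (by simp)) _
    have e2 : Subgroup.closure (s2 : Set G) ≤ N ⊔ Subgroup.closure ((s1 ∪ s2 : Finset G) : Set G) :=
      le_sup_of_le_right (Subgroup.closure_mono (by simp))
    exact Subgroup.mul_mem _ (e1 (hg1 ⟨hkH, hk⟩)) (e2 hc)

lemma RR.mono {N K : Subgroup G} {r r' : ℕ} (h : RR N K r) (hr : r ≤ r') : RR N K r' := by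
  intro H hH
  obtain ⟨s, a, b, c⟩ := h H hH
  exact ⟨s, a, b.trans hr, c⟩

lemma RR_of_hom {G' : Type*} [Group G'] (f : G →* G') {N K : Subgroup G} [N.Normal] {r : ℕ} (hker : K ⊓ f.ker ≤ N)
    (hf : ∀ H : Subgroup G', GenBy H r) : RR N K r := by
  classical
  intro H hH
  obtain ⟨s, hs, hcl⟩ := hf (H.map f)
  have : ∀ x ∈ s, ∃ y ∈ H, f y = x := by
    intro x hx
    have : x ∈ H.map f := hcl ▸ Subgroup.subset_closure hx
    exact this
  choose! l hl hfl using this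
  refine ⟨s.image l, ?_, Finset.card_image_le.trans hs, ?_⟩
  · intro x hx
    simp only [Finset.coe_image, Set.mem_image] at hx
    obtain ⟨y, hy, rfl⟩ := hx
    exact hl y hy
  · intro h hh
    have h1 : f h ∈ (Subgroup.closure ((s.image l : Finset G) : Set G)).map f := by
      rw [MonoidHom.map_closure, Finset.coe_image, ← Set.image_comp]
      have : (f ∘ l) '' (s : Set G') = s := by
        ext x; constructor
        · rintro ⟨y, hy, rfl⟩; rw [Function.comp, hfl y hy]; exact hy
        · intro hx; exact ⟨x, hx, hfl x hx⟩
      rw [this, hcl]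
      exact ⟨h, hh, rfl⟩
    obtain ⟨c, hc, hce⟩ := h1
    have hcH : c ∈ H := by
      refine (Subgroup.closure_le H).2 ?_ hc
      intro x hx
      simp only [Finset.coe_image, Set.mem_image] at hx
      obtain ⟨y, hy, rfl⟩ := hx
      exact hl y hy
    refine Subgroup.mem_sup_of_normal_left.2 ⟨h * c⁻¹, hker ⟨?_, ?_⟩, c, hc, by simp⟩
    · exact hH (H.mul_mem hh (H.inv_mem hcH))
    · change f _ = 1
      rw [map_mul, map_inv, hce]; simp
end RR

instance (N : ℕ) : (Gamma N).Normal := by unfold Gamma; infer_instance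

lemma RR_a {p m : ℕ} [Fact p.Prime] (h : Nat.Coprime p m) : RR (Gamma (p * m)) (Gamma m) 4 := by
  refine RR_of_hom (SpecialLinearGroup.map (Int.castRingHom (ZMod p))) ?_ rank_SLp
  rintro x ⟨h1, h2⟩
  exact Gamma_coprime h h2 h1

/-- the residue matrix (h-1)/q mod p -/
def AA (q p : ℕ) (h : SL(2, ℤ)) : Matrix (Fin 2) (Fin 2) (ZMod p) :=
  (((h : Matrix (Fin 2) (Fin 2) ℤ) - 1).map (fun x => x / (q : ℤ))).map (Int.castRingHom (ZMod p))

lemma mem_Gamma_iff' {q : ℕ} {h : SL(2, ℤ)} : h ∈ Gamma q ↔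
    ∃ X : Matrix (Fin 2) (Fin 2) ℤ, (h : Matrix (Fin 2) (Fin 2) ℤ) = 1 + (q : ℤ) • X := by
  rw [mem_Gamma_iff]
  constructor
  · rintro ⟨⟨a, ha⟩, ⟨b, hb⟩, ⟨c, hc⟩, ⟨d, hd⟩⟩
    refine ⟨!![a, b; c, d], ?_⟩
    ext i j; fin_cases i <;> fin_cases j <;> simp [← ha, ← hb, ← hc, ← hd]
  · rintro ⟨X, hX⟩
    rw [hX]
    refine ⟨⟨X 0 0, by simp [-zsmul_eq_mul, -natCast_zsmul, -nsmul_eq_mul]⟩, ⟨X 0 1, by simp [-zsmul_eq_mul, -natCast_zsmul, -nsmul_eq_mul]⟩, ⟨X 1 0, by simp [-zsmul_eq_mul, -natCast_zsmul, -nsmul_eq_mul]⟩, ⟨X 1 1, by simp [-zsmul_eq_mul, -natCast_zsmul, -nsmul_eq_mul]⟩⟩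

lemma AA_eq {q p : ℕ} (hq : 0 < q) {h : SL(2, ℤ)} {X : Matrix (Fin 2) (Fin 2) ℤ}
    (hX : (h : Matrix (Fin 2) (Fin 2) ℤ) = 1 + (q : ℤ) • X) : AA q p h = X.map (Int.castRingHom (ZMod p)) := by
  have hq' : (q : ℤ) ≠ 0 := by exact_mod_cast hq.ne'
  rw [AA, hX]
  congr 1
  ext i j
  simp [-zsmul_eq_mul, -natCast_zsmul, -nsmul_eq_mul]
  exact Int.mul_ediv_cancel_left _ hq'

lemma AA_mul {q p : ℕ} (hq : 0 < q) (hpq : p ∣ q) {g h : SL(2, ℤ)} (hg : g ∈ Gamma q) (hh : h ∈ Gamma q) :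
    AA q p (g * h) = AA q p g + AA q p h := by
  obtain ⟨X, hX⟩ := mem_Gamma_iff'.1 hg
  obtain ⟨Y, hY⟩ := mem_Gamma_iff'.1 hh
  have : ((g * h : SL(2, ℤ)) : Matrix (Fin 2) (Fin 2) ℤ) = 1 + (q : ℤ) • (X + Y + (q : ℤ) • (X * Y)) := by
    rw [coe_mul, hX, hY]
    simp only [mul_add, add_mul, mul_one, one_mul, smul_add, Matrix.smul_mul, Matrix.mul_smul]
    abel
  rw [AA_eq hq hX, AA_eq hq hY, AA_eq hq this]
  have hq0 : ((q : ℤ) : ZMod p) = 0 := by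
    rw [Int.cast_natCast, ZMod.natCast_eq_zero_iff]; exact hpq
  ext i j
  simp only [Matrix.map_apply, Matrix.add_apply, Matrix.smul_apply, smul_eq_mul, map_add, map_mul, eq_intCast, hq0, zero_mul, add_zero]

lemma AA_pow {q p : ℕ} (hq : 0 < q) (hpq : p ∣ q) {g : SL(2, ℤ)} (hg : g ∈ Gamma q) (n : ℕ) :
    AA q p (g ^ n) = n • AA q p g := by
  induction n with
  | zero => rw [pow_zero, AA_eq hq (X := 0) (by simp)]; simp
  | succ n ih => rw [pow_succ, AA_mul hq hpq (Subgroup.pow_mem _ hg n) hg, ih, succ_nsmul]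

lemma AA_ker {q p : ℕ} (hq : 0 < q) {h : SL(2, ℤ)} (hh : h ∈ Gamma q) (h0 : AA q p h = 0) :
    h ∈ Gamma (q * p) := by
  obtain ⟨X, hX⟩ := mem_Gamma_iff'.1 hh
  rw [AA_eq hq hX] at h0
  have : ∀ i j, ∃ y, X i j = p * y := by
    intro i j
    have := congrFun (congrFun h0 i) j
    simp only [Matrix.map_apply, eq_intCast, Matrix.zero_apply] at this
    exact (ZMod.intCast_zmod_eq_zero_iff_dvd _ _).1 this
  choose Y hY using this
  refine mem_Gamma_iff'.2 ⟨Matrix.of Y, ?_⟩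
  rw [hX]
  ext i j
  simp [hY, mul_assoc, -zsmul_eq_mul, -natCast_zsmul, -nsmul_eq_mul]

lemma one_add_pow_mat (q : ℤ) (X : Matrix (Fin 2) (Fin 2) ℤ) (n : ℕ) :
    ∃ Y : Matrix (Fin 2) (Fin 2) ℤ, (1 + q • X) ^ n = 1 + ((n : ℤ) * q) • X + (q * q) • Y := by
  induction n with
  | zero => exact ⟨0, by simp⟩
  | succ n ih =>
    obtain ⟨Y, hY⟩ := ih
    refine ⟨Y + (n : ℤ) • (X * X) + q • (Y * X), ?_⟩
    rw [pow_succ, hY]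
    simp only [mul_add, add_mul, mul_one, one_mul, smul_add, Matrix.smul_mul, Matrix.mul_smul, smul_smul, Nat.cast_succ, add_smul]
    rw [show q * ((n : ℤ) * q) = q * q * n by ring, show q * (q * q) = q * q * q by ring]
    abel

lemma AA_powp {q p : ℕ} (hq : 0 < q) (hp : 0 < p) (hpq : p ^ 2 ∣ q) {g : SL(2, ℤ)} (hg : g ∈ Gamma q) :
    g ^ p ∈ Gamma (q * p) ∧ AA (q * p) p (g ^ p) = AA q p g := by
  obtain ⟨X, hX⟩ := mem_Gamma_iff'.1 hg
  obtain ⟨Y, hY⟩ := one_add_pow_mat q X p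
  obtain ⟨k, hk⟩ := hpq
  have : ((g ^ p : SL(2, ℤ)) : Matrix (Fin 2) (Fin 2) ℤ) = 1 + ((q * p : ℕ) : ℤ) • (X + (p * k : ℤ) • Y) := by
    rw [coe_pow, hX, hY, smul_add, smul_smul]
    rw [show ((q * p : ℕ) : ℤ) = (p : ℤ) * q by push_cast; ring]
    rw [show (p : ℤ) * q * (p * k) = (q : ℤ) * q by
      have : (q : ℤ) = p ^ 2 * k := by exact_mod_cast hk
      rw [this]; ring]
    abel
  refine ⟨mem_Gamma_iff'.2 ⟨_, this⟩, ?_⟩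
  rw [AA_eq hq hX, AA_eq (by positivity) this]
  ext i j
  simp [-zsmul_eq_mul, -natCast_zsmul, -nsmul_eq_mul]

section
variable {p : ℕ} [Fact p.Prime]

lemma gen_step {q : ℕ} (hq : 0 < q) (hpq : p ∣ q) (H : Subgroup SL(2, ℤ)) (b : Set SL(2, ℤ))
    (hb : b ⊆ (H ⊓ Gamma q : Subgroup SL(2, ℤ)))
    (hsp : AA q p '' ((H ⊓ Gamma q : Subgroup SL(2, ℤ)) : Set SL(2, ℤ)) ⊆ Submodule.span (ZMod p) (AA q p '' b)) :
    ∀ h ∈ H ⊓ Gamma q, ∃ c ∈ Subgroup.closure b, h * c⁻¹ ∈ H ⊓ Gamma (q * p) := by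
  have hcl : Subgroup.closure b ≤ H ⊓ Gamma q := (Subgroup.closure_le _).2 hb
  have key : ∀ x ∈ Submodule.span (ZMod p) (AA q p '' b), ∃ c ∈ Subgroup.closure b, AA q p c = x := by
    intro x hx
    induction hx using Submodule.span_induction with
    | mem x h => obtain ⟨y, hy, rfl⟩ := h; exact ⟨y, Subgroup.subset_closure hy, rfl⟩
    | zero => exact ⟨1, Subgroup.one_mem _, by simpa using AA_pow hq hpq (Subgroup.one_mem _) 0⟩
    | add x y _ _ hx hy =>
      obtain ⟨c, hc, rfl⟩ := hx
      obtain ⟨d, hd, rfl⟩ := hy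
      exact ⟨c * d, Subgroup.mul_mem _ hc hd, AA_mul hq hpq (hcl hc).2 (hcl hd).2⟩
    | smul a x _ hx =>
      obtain ⟨c, hc, rfl⟩ := hx
      refine ⟨c ^ a.val, Subgroup.pow_mem _ hc _, ?_⟩
      rw [AA_pow hq hpq (hcl hc).2, ← Nat.cast_smul_eq_nsmul (ZMod p), ZMod.natCast_zmod_val]
  intro h hh
  obtain ⟨c, hc, hce⟩ := key _ (hsp ⟨h, hh, rfl⟩)
  refine ⟨c, hc, H.mul_mem hh.1 (H.inv_mem (hcl hc).1), ?_⟩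
  have hm : h * c⁻¹ ∈ Gamma q := Subgroup.mul_mem _ hh.2 (Subgroup.inv_mem _ (hcl hc).2)
  apply AA_ker hq hm
  have := AA_mul hq hpq hm (hcl hc).2
  rw [inv_mul_cancel_right, hce] at this
  simpa using this

lemma indep_card {v : SL(2, ℤ) → Matrix (Fin 2) (Fin 2) (ZMod p)} {b : Set SL(2, ℤ)}
    (hb : LinearIndepOn (ZMod p) v b) : b.Finite ∧ b.ncard ≤ 4 := by
  have h := hb.encard_le_toENat_rank
  have : Cardinal.toENat (Module.rank (ZMod p) (Matrix (Fin 2) (Fin 2) (ZMod p))) = 4 := by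
    rw [← Module.finrank_eq_rank, Module.finrank_matrix]; simp
  rw [this] at h
  have hf : b.Finite := Set.finite_of_encard_le_coe (k := 4) h
  refine ⟨hf, ?_⟩
  rw [← hf.cast_ncard_eq] at h
  exact_mod_cast h

lemma gen_S (H : Subgroup SL(2, ℤ)) (j : ℕ) : ∀ (q : ℕ), 0 < q → p ^ 2 ∣ q → ∀ t : Set SL(2, ℤ),
    t ⊆ (H ⊓ Gamma q : Subgroup SL(2, ℤ)) → LinearIndepOn (ZMod p) (AA q p) t →
    ∃ s : Set SL(2, ℤ), s.Finite ∧ s ⊆ (H ⊓ Gamma q : Subgroup SL(2, ℤ)) ∧ t.ncard + s.ncard ≤ 4 ∧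
      H ⊓ Gamma q ≤ Gamma (q * p ^ j) ⊔ Subgroup.closure (t ∪ s) := by
  have hp := Fact.out (p := p.Prime)
  induction j with
  | zero =>
    intro q hq hpq t ht hti
    refine ⟨∅, by simp, by simp, by simpa using (indep_card hti).2, ?_⟩
    simp only [pow_zero, mul_one]
    exact le_sup_of_le_left inf_le_right
  | succ j ih =>
    intro q hq hpq t ht hti
    obtain ⟨b, hbH, htb, hsp, hbi⟩ := exists_linearIndepOn_extension hti ht
    obtain ⟨hbf, hb4⟩ := indep_card hbi
    have hgs := gen_step hq ((dvd_pow_self p two_ne_zero).trans hpq) H b hbH hsp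
    have hpow : ∀ x ∈ b, x ^ p ∈ Gamma (q * p) ∧ AA (q * p) p (x ^ p) = AA q p x :=
      fun x hx => AA_powp hq hp.pos hpq (hbH hx).2
    have hbi' : LinearIndepOn (ZMod p) (AA (q * p) p ∘ (fun x => x ^ p)) b :=
      (linearIndepOn_congr (fun x hx => (hpow x hx).2.symm)).1 hbi
    have hinj : Set.InjOn (fun x : SL(2, ℤ) => x ^ p) b := by
      intro x hx y hy hxy
      apply hbi'.injOn hx hy
      simp only [Function.comp]
      exact congrArg _ hxy
    obtain ⟨s, hsf, hsH, hs4, hgen⟩ := ih (q * p) (Nat.mul_pos hq hp.pos) (hpq.trans (dvd_mul_right _ _))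
      ((fun x => x ^ p) '' b) (by
        rintro _ ⟨x, hx, rfl⟩
        exact ⟨H.pow_mem (hbH hx).1 _, (hpow x hx).1⟩) (hbi'.image_of_comp _ _)
    rw [hinj.ncard_image] at hs4
    have hGle : Gamma (q * p) ≤ Gamma q := Gamma_anti (dvd_mul_right _ _)
    refine ⟨(b \ t) ∪ s, (hbf.sdiff).union hsf, ?_, ?_, ?_⟩
    · exact Set.union_subset (Set.sdiff_subset.trans hbH) (fun x hx => ⟨(hsH hx).1, hGle (hsH hx).2⟩)
    · have h1 := Set.ncard_union_le (b \ t) s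
      have h2 := Set.ncard_sdiff_add_ncard_of_subset htb hbf
      omega
    · have hts : t ∪ (b \ t ∪ s) = b ∪ s := by
        rw [← Set.union_assoc, Set.union_sdiff_cancel htb]
      rw [hts]
      intro h hh
      obtain ⟨c, hc, hch⟩ := hgs h hh
      have h1 := hgen hch
      rw [mul_assoc, ← pow_succ'] at h1
      have h2 : Gamma (q * p ^ (j + 1)) ⊔ Subgroup.closure ((fun x => x ^ p) '' b ∪ s) ≤
          Gamma (q * p ^ (j + 1)) ⊔ Subgroup.closure (b ∪ s) := by
        refine sup_le_sup_left ?_ _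
        rw [Subgroup.closure_le]
        refine Set.union_subset ?_ (fun x hx => Subgroup.subset_closure (Or.inr hx))
        rintro _ ⟨x, hx, rfl⟩
        have hx' : x ∈ Subgroup.closure (b ∪ s) := Subgroup.subset_closure (Or.inl hx)
        exact Subgroup.pow_mem _ hx' p
      have h3 : c ∈ Gamma (q * p ^ (j + 1)) ⊔ Subgroup.closure (b ∪ s) :=
        Subgroup.mem_sup_right (Subgroup.closure_mono Set.subset_union_left hc)
      have := Subgroup.mul_mem _ (h2 h1) h3
      simpa using this

lemma RR_b {q : ℕ} (hq : 0 < q) (hpq : p ∣ q) : RR (Gamma (q * p)) (Gamma q) 4 := by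
  intro H hH
  obtain ⟨b, hbH, -, hsp, hbi⟩ := exists_linearIndepOn_extension (K := ZMod p) (v := AA q p)
    (linearIndepOn_empty _ _) (Set.empty_subset ((H ⊓ Gamma q : Subgroup SL(2, ℤ)) : Set SL(2, ℤ)))
  obtain ⟨hbf, hb4⟩ := indep_card hbi
  refine ⟨hbf.toFinset, ?_, by rwa [← Set.ncard_eq_toFinset_card b hbf], ?_⟩
  · rw [hbf.coe_toFinset]; exact fun x hx => (hbH hx).1
  · rw [hbf.coe_toFinset]
    intro h hh
    obtain ⟨c, hc, hch⟩ := gen_step hq hpq H b hbH hsp h ⟨hh, hH hh⟩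
    exact Subgroup.mem_sup_of_normal_left.2 ⟨_, hch.2, c, hc, by simp⟩

lemma RR_c {q : ℕ} (hq : 0 < q) (hpq : p ^ 2 ∣ q) (j : ℕ) : RR (Gamma (q * p ^ j)) (Gamma q) 4 := by
  intro H hH
  obtain ⟨s, hsf, hsH, hs4, hgen⟩ := gen_S H j q hq hpq ∅ (by simp) (linearIndepOn_empty _ _)
  refine ⟨hsf.toFinset, ?_, ?_, ?_⟩
  · rw [hsf.coe_toFinset]; exact fun x hx => (hsH hx).1
  · rw [← Set.ncard_eq_toFinset_card s hsf]; simpa using hs4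
  · rw [hsf.coe_toFinset]
    intro h hh
    simpa using hgen ⟨hh, hH hh⟩

lemma RR_pk {m : ℕ} (hm : 0 < m) (h : Nat.Coprime p m) (k : ℕ) (hk : 0 < k) : RR (Gamma (p ^ k * m)) (Gamma m) 12 := by
  have hp := Fact.out (p := p.Prime)
  have ha := RR_a h
  have hb := (RR_b (p := p) (q := p * m) (Nat.mul_pos hp.pos hm) (dvd_mul_right _ _)).trans ha
  rcases k with _ | _ | k
  · omega
  · simpa using ha.mono (by norm_num)
  · have e : p * m * p = p ^ 2 * m := by ring
    rw [e] at hb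
    have hc := (RR_c (p := p) (q := p ^ 2 * m) (Nat.mul_pos (pow_pos hp.pos _) hm) (dvd_mul_right _ _) k).trans hb
    rw [show p ^ (k + 1 + 1) * m = p ^ 2 * m * p ^ k by ring]
    exact hc
end

lemma RR_main (m : ℕ) (hm : 0 < m) : RR (Gamma m) ⊤ (12 * m.primeFactors.card) := by
  induction m using Nat.strong_induction_on with
  | _ m ih =>
  by_cases h1 : m = 1
  · subst h1
    intro H _
    refine ⟨∅, by simp, by simp, ?_⟩
    rw [Gamma_one_top]; simp
  · have hp := Nat.minFac_prime h1
    set p := m.minFac with hpdef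
    have : Fact p.Prime := ⟨hp⟩
    obtain ⟨k, m', hpm', hmk⟩ := Nat.exists_eq_pow_mul_and_not_dvd hm.ne' p hp.ne_one
    have hk : 0 < k := by
      rcases Nat.eq_zero_or_pos k with rfl | h
      · exfalso; apply hpm'
        rw [hmk] at hpdef
        have := Nat.minFac_dvd m
        rw [pow_zero, one_mul] at hmk
        rw [← hmk]; exact this
      · exact h
    have hm' : 0 < m' := by
      rcases Nat.eq_zero_or_pos m' with rfl | h
      · exact absurd (dvd_zero _) hpm'
      · exact h
    have hlt : m' < m := by
      rw [hmk]
      have := Nat.one_lt_pow hk.ne' hp.one_lt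
      nlinarith
    have hcop : Nat.Coprime p m' := (Nat.Prime.coprime_iff_not_dvd hp).2 hpm'
    have hcard : m.primeFactors.card = m'.primeFactors.card + 1 := by
      conv_lhs => rw [hmk]
      rw [(Nat.Coprime.pow_left k hcop).primeFactors_mul, Nat.primeFactors_prime_pow hk.ne' hp, Finset.card_union_of_disjoint]
      · simp [add_comm]
      · simp [hpm']
    have := (RR_pk hm' hcop k hk).trans (ih m' hlt hm')
    rw [← hmk] at this
    rw [hcard]
    exact this.mono (by ring_nf; rfl)
end CG


open Filter
namespace CG
open Matrix Matrix.SpecialLinearGroup CongruenceSubgroup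
open scoped MatrixGroups

lemma factorial_le_prod (s : Finset ℕ) (hs : ∀ x ∈ s, 1 ≤ x) : s.card.factorial ≤ ∏ x ∈ s, x := by
  classical
  induction s using Finset.induction_on_max with
  | empty => simp
  | insert a s ha ih =>
    have hna : a ∉ s := fun h => lt_irrefl _ (ha a h)
    rw [Finset.card_insert_of_notMem hna, Finset.prod_insert hna, Nat.factorial_succ]
    have h1 : s ⊆ Finset.Ico 1 a := by
      intro x hx
      exact Finset.mem_Ico.2 ⟨hs x (Finset.mem_insert_of_mem hx), ha x hx⟩
    have h2 := Finset.card_le_card h1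
    have h3 : 1 ≤ a := hs a (Finset.mem_insert_self _ _)
    rw [Nat.card_Ico] at h2
    exact Nat.mul_le_mul (by omega) (ih fun x hx => hs x (Finset.mem_insert_of_mem hx))

lemma omega_factorial (m : ℕ) (hm : 0 < m) : m.primeFactors.card.factorial ≤ m :=
  (factorial_le_prod _ fun _ hx => (Nat.prime_of_mem_primeFactors hx).one_lt.le).trans
    (Nat.le_of_dvd hm (Nat.prod_primeFactors_dvd m))

lemma count_level (m : ℕ) (hm : 0 < m) :
    {H : Subgroup SL(2, ℤ) | Gamma m ≤ H}.Finite ∧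
    {H : Subgroup SL(2, ℤ) | Gamma m ≤ H}.ncard ≤ (m ^ 4) ^ (12 * m.primeFactors.card) := by
  classical
  have : NeZero m := ⟨hm.ne'⟩
  set r := 12 * m.primeFactors.card with hr
  let f : SL(2, ℤ) →* SL(2, ZMod m) := SpecialLinearGroup.map (Int.castRingHom (ZMod m))
  let F : (Fin r → SL(2, ZMod m)) → Subgroup SL(2, ℤ) := fun t => (Subgroup.closure (Set.range t)).comap f
  have hsub : {H : Subgroup SL(2, ℤ) | Gamma m ≤ H} ⊆ Set.range F := by
    intro H hH
    obtain ⟨s, hsH, hsc, hgen⟩ := RR_main m hm H le_top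
    refine ⟨fun i => if h : i.1 < s.card then f (s.equivFin.symm ⟨i.1, h⟩) else 1, ?_⟩
    have h1 : Subgroup.closure (Set.range (fun i : Fin r => if h : i.1 < s.card then f (s.equivFin.symm ⟨i.1, h⟩) else 1))
        = (Subgroup.closure (s : Set SL(2, ℤ))).map f := by
      rw [MonoidHom.map_closure]
      apply le_antisymm
      · rw [Subgroup.closure_le]
        rintro _ ⟨i, rfl⟩
        simp only
        split_ifs with h
        · exact Subgroup.subset_closure ⟨_, (s.equivFin.symm ⟨i.1, h⟩).2, rfl⟩
        · exact Subgroup.one_mem _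
      · refine Subgroup.closure_mono ?_
        rintro _ ⟨x, hx, rfl⟩
        refine ⟨⟨(s.equivFin ⟨x, hx⟩).1, lt_of_lt_of_le (s.equivFin ⟨x, hx⟩).2 hsc⟩, ?_⟩
        simp
    change Subgroup.comap f (Subgroup.closure _) = H
    rw [h1, Subgroup.comap_map_eq]
    apply le_antisymm
    · exact sup_le ((Subgroup.closure_le _).2 hsH) hH
    · rw [sup_comm]; exact hgen
  have hfin : (Set.range F).Finite := Set.finite_range F
  refine ⟨hfin.subset hsub, (Set.ncard_le_ncard hsub hfin).trans ?_⟩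
  rw [← Set.image_univ]
  refine (Set.ncard_image_le (Set.toFinite _)).trans ?_
  rw [Set.ncard_univ, Nat.card_fun, Nat.card_fin]
  gcongr
  refine (Nat.card_le_card_of_injective (Subtype.val) Subtype.val_injective).trans ?_
  simp only [Matrix, Nat.card_fun, Nat.card_zmod, Nat.card_fin]
  rw [← pow_mul]

lemma cong_subset (n : ℕ) : {H : Subgroup SL(2, ℤ) | _root_.IsCongruenceSubgroup H ∧ H.index ≤ n} ⊆
    ⋃ m ∈ Finset.Icc 1 n, {H : Subgroup SL(2, ℤ) | Gamma m ≤ H} := by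
  rintro H ⟨hH, hi⟩
  obtain ⟨m, h1, h2, h3⟩ := level_le_index H hH
  simp only [Set.mem_iUnion, Finset.mem_Icc]
  exact ⟨m, ⟨h1, h2.trans hi⟩, h3⟩

lemma cong_finite (n : ℕ) : {H : Subgroup SL(2, ℤ) | _root_.IsCongruenceSubgroup H ∧ H.index ≤ n}.Finite := by
  refine Set.Finite.subset ?_ (cong_subset n)
  exact Set.Finite.biUnion (Finset.finite_toSet _) fun m hm => (count_level m (by simp at hm; omega)).1

lemma congCount_eq (n : ℕ) : congCount 2 n =
    {H : Subgroup SL(2, ℤ) | _root_.IsCongruenceSubgroup H ∧ H.index ≤ n}.ncard := rfl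

lemma congCount_le (n W : ℕ) (hW : ∀ m ∈ Finset.Icc 1 n, m.primeFactors.card ≤ W) :
    congCount 2 n ≤ n ^ (48 * W + 1) := by
  rw [congCount_eq]
  have hf : (⋃ m ∈ Finset.Icc 1 n, {H : Subgroup SL(2, ℤ) | Gamma m ≤ H}).Finite :=
    Set.Finite.biUnion (Finset.finite_toSet _) fun m hm => (count_level m (by simp at hm; omega)).1
  refine (Set.ncard_le_ncard (cong_subset n) hf).trans ?_
  refine (Finset.set_ncard_biUnion_le _ _).trans ?_
  have : ∀ m ∈ Finset.Icc 1 n, {H : Subgroup SL(2, ℤ) | Gamma m ≤ H}.ncard ≤ n ^ (48 * W) := by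
    intro m hm
    have h1 := hW m hm
    rw [Finset.mem_Icc] at hm
    refine (count_level m (by omega)).2.trans ?_
    rw [← pow_mul]
    calc m ^ (4 * (12 * m.primeFactors.card)) ≤ n ^ (4 * (12 * m.primeFactors.card)) := Nat.pow_le_pow_left hm.2 _
      _ ≤ n ^ (48 * W) := Nat.pow_le_pow_right (by omega) (by omega)
  refine (Finset.sum_le_card_nsmul _ _ _ this).trans ?_
  rw [Nat.card_Icc, smul_eq_mul, pow_succ]
  simp [mul_comm]

open Real in
lemma omega_bound : ∀ᶠ n : ℕ in atTop, ∀ m ∈ Finset.Icc 1 n,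
    (m.primeFactors.card : ℝ) ≤ 4 * (log n / log (log n)) := by
  have hL : Tendsto (fun n : ℕ => log (n : ℝ)) atTop atTop := tendsto_log_atTop.comp tendsto_natCast_atTop_atTop
  have hev : ∀ᶠ L : ℝ in atTop, 0 < L ∧ 0 < log L ∧ log L / 2 + 1 ≤ log (4 * (L / log L)) := by
    have h1 : ∀ᶠ L : ℝ in atTop, log (log L) ≤ log L / 4 := by
      have := (isLittleO_log_id_atTop.comp_tendsto tendsto_log_atTop).def (show (0 : ℝ) < 1 / 4 by norm_num)
      filter_upwards [this, tendsto_log_atTop.eventually_ge_atTop 1] with L h h1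
      simp only [Function.comp, id, Real.norm_eq_abs] at h
      rw [abs_of_nonneg (log_nonneg h1), abs_of_nonneg (by linarith)] at h
      linarith
    filter_upwards [h1, eventually_gt_atTop 0, tendsto_log_atTop.eventually_gt_atTop 4] with L h1 h0 h4
    refine ⟨h0, by linarith, ?_⟩
    rw [log_mul (by norm_num) (by have : log L ≠ 0 := by linarith
                                  positivity), log_div h0.ne' (by linarith)]
    have : 0 ≤ log 4 := log_nonneg (by norm_num)
    linarith
  filter_upwards [hL.eventually hev, eventually_gt_atTop 0] with n ⟨h0, h1, h2⟩ hn m hm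
  by_contra hc
  push Not at hc
  set k := m.primeFactors.card with hk
  rw [Finset.mem_Icc] at hm
  have hfac : (k.factorial : ℝ) ≤ n := by
    exact_mod_cast (omega_factorial m (by omega)).trans hm.2
  have hpos : 0 < 4 * (log n / log (log n)) := by positivity
  have hk0 : (0 : ℝ) < k := hpos.trans hc
  have h3 := pow_div_factorial_le_exp (k : ℝ) hk0.le k
  have h4 : (k : ℝ) ^ k ≤ exp k * n := by
    rw [div_le_iff₀ (by positivity)] at h3
    exact h3.trans (by gcongr)
  have h5 : k * log k ≤ k + log n := by
    have := log_le_log (by positivity) h4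
    rwa [log_pow, log_mul (exp_pos _).ne' (by positivity), log_exp] at this
  have h6 : log (log n) / 2 + 1 ≤ log k := h2.trans (log_le_log hpos hc.le)
  have h7 : (k : ℝ) * (log (log n) / 2) ≤ log n := by nlinarith
  have h8 : 4 * log n < k * log (log n) := by
    rw [← mul_div_assoc, div_lt_iff₀ h1] at hc
    exact hc
  linarith

open Real in
theorem upper_bound : ∀ᶠ n : ℕ in atTop,
    log (congCount 2 n) / ((log n) ^ 2 / log (log n)) ≤ 193 := by
  have hL : Tendsto (fun n : ℕ => log (n : ℝ)) atTop atTop := tendsto_log_atTop.comp tendsto_natCast_atTop_atTop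
  filter_upwards [omega_bound, hL.eventually_gt_atTop 0, (tendsto_log_atTop.comp hL).eventually_gt_atTop 0,
    eventually_gt_atTop 1] with n hω h1 h2 h3
  simp only [Function.comp] at h2
  have hb := congCount_le n ⌊4 * (log n / log (log n))⌋₊ (fun m hm => Nat.le_floor (hω m hm))
  set W := ⌊4 * (log n / log (log n))⌋₊ with hW
  have hWle : (W : ℝ) ≤ 4 * (log n / log (log n)) := Nat.floor_le (by positivity)
  rw [div_le_iff₀ (by positivity)]
  have hlog : log (congCount 2 n) ≤ (48 * W + 1) * log n := by
    rcases Nat.eq_zero_or_pos (congCount 2 n) with h | h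
    · rw [h]; simp; positivity
    · have : (congCount 2 n : ℝ) ≤ (n : ℝ) ^ (48 * W + 1) := by exact_mod_cast hb
      have := log_le_log (by exact_mod_cast h) this
      rw [log_pow] at this
      exact_mod_cast this
  have hll : log (log n) ≤ log n := by
    have := log_le_sub_one_of_pos h1
    linarith
  have h1le : 1 ≤ log n / log (log n) := by rwa [one_le_div h2]
  calc _ ≤ _ := hlog
    _ ≤ (48 * (4 * (log n / log (log n))) + log n / log (log n)) * log n := by gcongr
    _ = _ := by ring
end CG


open Filter
namespace CG
open Matrix Matrix.SpecialLinearGroup CongruenceSubgroup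
open scoped MatrixGroups

lemma exists_chi (p q : ℕ) [Fact p.Prime] [Fact q.Prime] (h : q ∣ p - 1) :
    ∃ χ : (ZMod p)ˣ →* Multiplicative (ZMod q), Function.Surjective χ := by
  have hc : Nat.card (ZMod p)ˣ = p - 1 := by
    rw [Nat.card_eq_fintype_card, ZMod.card_units_eq_totient, Nat.totient_prime Fact.out]
  let e := zmodCyclicMulEquiv (G := (ZMod p)ˣ) inferInstance
  have h' : q ∣ Nat.card (ZMod p)ˣ := hc ▸ h
  let f := (ZMod.castHom h' (ZMod q)).toAddMonoidHom.toMultiplicative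
  refine ⟨f.comp e.symm.toMonoidHom, ?_⟩
  have hf : Function.Surjective f := fun y => by
    obtain ⟨x, hx⟩ := ZMod.castHom_surjective h' y.toAdd
    exact ⟨Multiplicative.ofAdd x, by simpa [f] using congrArg Multiplicative.ofAdd hx⟩
  simpa using hf.comp e.symm.surjective

lemma index_Gamma0_le (p : ℕ) [Fact p.Prime] : (Gamma0 p).index ≤ p + 1 := by
  classical
  let f : SL(2, ℤ) → Option (ZMod p) := fun g =>
    if (g 1 0 : ZMod p) = 0 then none else some ((g 0 0 : ZMod p) / (g 1 0 : ZMod p))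
  have key : ∀ g h : SL(2, ℤ), f g = f h → g⁻¹ * h ∈ Gamma0 p := by
    intro g h hgh
    have e1 : (((g⁻¹ * h : SL(2, ℤ)) 1 0 : ℤ) : ZMod p) = - g 1 0 * h 0 0 + g 0 0 * h 1 0 := by
      simp [Matrix.SpecialLinearGroup.coe_inv, Matrix.adjugate_fin_two, Matrix.mul_apply,
        Fin.sum_univ_two]
    rw [Gamma0_mem, e1]
    simp only [f] at hgh
    split_ifs at hgh with h1 h2 h2
    · simp [h1, h2]
    · simp only [Option.some.injEq] at hgh
      rw [div_eq_div_iff h1 h2] at hgh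
      linear_combination hgh
  have h2 : ∃ F : SL(2, ℤ) ⧸ Gamma0 p → Option (ZMod p), Function.Injective F := by
    refine ⟨fun c => f c.out, fun c d hcd => ?_⟩
    have := key _ _ hcd
    rw [← QuotientGroup.eq, QuotientGroup.out_eq', QuotientGroup.out_eq'] at this
    exact this
  obtain ⟨F, hF⟩ := h2
  have := Nat.card_le_card_of_injective F hF
  rw [Subgroup.index]
  simpa [Nat.card_eq_fintype_card, ZMod.card] using this

noncomputable def chi (p q : ℕ) [Fact p.Prime] [Fact q.Prime] (h : q ∣ p - 1) :
    (ZMod p)ˣ →* Multiplicative (ZMod q) := (exists_chi p q h).choose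

lemma chi_surj (p q : ℕ) [Fact p.Prime] [Fact q.Prime] (h : q ∣ p - 1) :
    Function.Surjective (chi p q h) := (exists_chi p q h).choose_spec

section
variable {q a b : ℕ} [Fact q.Prime] (p : Fin a ⊕ Fin b → ℕ) [hp : ∀ i, Fact (p i).Prime]
  (hq : ∀ i, q ∣ p i - 1)

def GG : Subgroup SL(2, ℤ) := ⨅ i, Gamma0 (p i)

noncomputable def Phi (i : Fin a ⊕ Fin b) : GG p →* Multiplicative (ZMod q) :=
  (chi (p i) q (hq i)).comp
    ((MonoidHom.toHomUnits (Gamma0Map (p i))).comp (Subgroup.inclusion (iInf_le _ i)))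

lemma Phi_val (i) (g : GG p) (u : (ZMod (p i))ˣ) (h : ((g.1 1 1 : ℤ) : ZMod (p i)) = u) :
    Phi p hq i g = chi (p i) q (hq i) u := by
  unfold Phi
  simp only [MonoidHom.comp_apply]
  congr 1
  ext
  rw [MonoidHom.coe_toHomUnits, ← h]
  rfl

noncomputable def Psi (F : Fin b → Fin a → ZMod q) : GG p →* (Fin b → Multiplicative (ZMod q)) :=
  MonoidHom.pi fun j => Phi p hq (Sum.inr j) / ∏ i, (Phi p hq (Sum.inl i)) ^ (F j i).val

lemma Psi_apply (F : Fin b → Fin a → ZMod q) (g : GG p) (j : Fin b) :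
    Psi p hq F g j = Phi p hq (Sum.inr j) g / ∏ i, (Phi p hq (Sum.inl i) g) ^ (F j i).val := by
  rw [Psi, MonoidHom.pi_apply, MonoidHom.div_apply, MonoidHom.finsetProd_apply]
  rfl

noncomputable def HF (F : Fin b → Fin a → ZMod q) : Subgroup SL(2, ℤ) :=
  (Psi p hq F).ker.map (GG p).subtype

lemma index_HF (F : Fin b → Fin a → ZMod q) : (HF p hq F).index ≤ (∏ i, (p i + 1)) * q ^ b := by
  rw [HF, Subgroup.index_map_subtype, mul_comm]
  gcongr
  · refine (Subgroup.index_iInf_le _).trans ?_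
    exact Finset.prod_le_prod' fun i _ => index_Gamma0_le _
  · rw [Subgroup.index_ker]
    refine (Nat.card_le_card_of_injective _ Subtype.val_injective).trans ?_
    have : Nat.card (Multiplicative (ZMod q)) = q := Nat.card_zmod q
    simp

lemma HF_cong (F : Fin b → Fin a → ZMod q) : _root_.IsCongruenceSubgroup (HF p hq F) := by
  refine ⟨∏ i, p i, Finset.prod_pos fun i _ => (hp i).out.pos, ?_⟩
  intro g hg
  change g ∈ Gamma _ at hg
  rw [Gamma_mem] at hg
  have hd : ∀ i, ((p i : ℕ)) ∣ ∏ i, p i := fun i => Finset.dvd_prod_of_mem _ (Finset.mem_univ i)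
  have h10 : ∀ i, (g 1 0 : ZMod (p i)) = 0 := fun i => by
    simpa using congrArg (ZMod.castHom (hd i) (ZMod (p i))) hg.2.2.1
  have h11 : ∀ i, (g 1 1 : ZMod (p i)) = 1 := fun i => by
    have := congrArg (ZMod.castHom (hd i) (ZMod (p i))) hg.2.2.2
    rwa [map_intCast, map_one] at this
  have hgG : g ∈ GG p := by
    simp only [GG, Subgroup.mem_iInf]
    exact h10
  have h1 : ∀ i, Phi p hq i ⟨g, hgG⟩ = 1 := fun i => by
    rw [Phi_val p hq i _ 1 (by simpa using h11 i), map_one]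
  refine ⟨⟨g, hgG⟩, ?_, rfl⟩
  rw [SetLike.mem_coe, MonoidHom.mem_ker]
  funext j
  rw [Psi_apply]
  simp [h1]

lemma exists_target (hinj : Function.Injective p) (t : Fin a ⊕ Fin b → Multiplicative (ZMod q)) :
    ∃ g : GG p, ∀ i, Phi p hq i g = t i := by
  choose u hu using fun i => chi_surj (p i) q (hq i) (t i)
  have hcop : Pairwise fun i j => Nat.Coprime (p i) (p j) := fun i j hij =>
    (Nat.coprime_primes (hp i).out (hp j).out).2 fun h => hij (hinj h)
  obtain ⟨k, hk⟩ : ∃ k : ℕ, ∀ i, (k : ZMod (p i)) = u i := by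
    let e := ZMod.prodEquivPi p hcop
    have : NeZero (∏ i, p i) := ⟨Finset.prod_ne_zero_iff.2 fun i _ => (hp i).out.ne_zero⟩
    obtain ⟨z, hz⟩ := e.surjective (fun i => ((u i : (ZMod (p i))ˣ) : ZMod (p i)))
    refine ⟨z.val, fun i => ?_⟩
    have := congrFun hz i
    rw [← this]
    have h2 : e ((z.val : ℕ) : ZMod (∏ i, p i)) i = (z.val : ZMod (p i)) := by
      rw [map_natCast, Pi.natCast_apply]
    rw [← h2, ZMod.natCast_zmod_val]
  have hc : IsCoprime ((∏ i, p i : ℕ) : ℤ) (k : ℤ) := by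
    rw [Nat.isCoprime_iff_coprime]
    refine Nat.Coprime.prod_left fun i _ => ?_
    have h1 : IsUnit (k : ZMod (p i)) := by rw [hk]; exact (u i).isUnit
    exact ((ZMod.isUnit_iff_coprime _ _).1 h1).symm
  obtain ⟨x, y, hxy⟩ := hc
  let g : SL(2, ℤ) := ⟨!![y, -x; ((∏ i, p i : ℕ) : ℤ), (k : ℤ)], by
    rw [Matrix.det_fin_two_of]; linarith⟩
  have hgG : g ∈ GG p := by
    simp only [GG, Subgroup.mem_iInf]
    intro i
    rw [Gamma0_mem]
    have : g 1 0 = ((∏ i, p i : ℕ) : ℤ) := rfl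
    rw [this, Int.cast_natCast, ZMod.natCast_eq_zero_iff]
    exact Finset.dvd_prod_of_mem _ (Finset.mem_univ i)
  refine ⟨⟨g, hgG⟩, fun i => ?_⟩
  rw [Phi_val p hq i _ (u i), hu]
  have : g 1 1 = (k : ℤ) := rfl
  rw [← hk]
  simp only [this]
  simp

lemma HF_inj (hinj : Function.Injective p) : Function.Injective (HF (q := q) p hq) := by
  intro F F' hFF
  funext j i
  let t : Fin a ⊕ Fin b → Multiplicative (ZMod q) := Sum.elim
    (fun i' => if i' = i then Multiplicative.ofAdd 1 else 1) (fun j => Multiplicative.ofAdd (F j i))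
  obtain ⟨g, hg⟩ := exists_target p hq hinj t
  have hpsi : ∀ F : Fin b → Fin a → ZMod q, ∀ j,
      Psi p hq F g j = Multiplicative.ofAdd (t (Sum.inr j)).toAdd / Multiplicative.ofAdd (F j i) := by
    intro F j
    have : ∏ i', Phi p hq (Sum.inl i') g ^ (F j i').val = Multiplicative.ofAdd (F j i) := by
      rw [Finset.prod_eq_single i]
      · rw [hg]
        simp [t, ← ofAdd_nsmul]
      · intro i' _ hne
        rw [hg]; simp [t, hne]
      · simp
    rw [Psi_apply, this, hg]
    rfl
  have h1 : (g : SL(2, ℤ)) ∈ HF p hq F := by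
    refine ⟨g, ?_, rfl⟩
    rw [SetLike.mem_coe, MonoidHom.mem_ker]
    funext j
    rw [hpsi]; simp [t]
  rw [hFF] at h1
  obtain ⟨g', hg', hgg⟩ := h1
  have : g' = g := Subtype.ext hgg
  subst this
  have := congrFun (MonoidHom.mem_ker.1 hg') j
  rw [hpsi, Pi.one_apply, div_eq_one] at this
  simpa [t] using this

end

theorem B_main {q a b : ℕ} (hqp : q.Prime) (p : Fin a ⊕ Fin b → ℕ) (hp : ∀ i, (p i).Prime)
    (hq : ∀ i, q ∣ p i - 1) (hinj : Function.Injective p) {n : ℕ}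
    (hn : (∏ i, (p i + 1)) * q ^ b ≤ n) : q ^ (a * b) ≤ congCount 2 n := by
  have : Fact q.Prime := ⟨hqp⟩
  have : ∀ i, Fact (p i).Prime := fun i => ⟨hp i⟩
  have : Finite {H : Subgroup SL(2, ℤ) // _root_.IsCongruenceSubgroup H ∧ H.index ≤ n} :=
    (cong_finite n).to_subtype
  let f : (Fin b → Fin a → ZMod q) →
    {H : Subgroup SL(2, ℤ) // _root_.IsCongruenceSubgroup H ∧ H.index ≤ n} :=
    fun F => ⟨HF p hq F, HF_cong p hq F, (index_HF p hq F).trans hn⟩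
  have hf : Function.Injective f := fun F F' h => HF_inj p hq hinj (Subtype.ext_iff.1 h)
  have := Nat.card_le_card_of_injective f hf
  have e : Nat.card (Fin b → Fin a → ZMod q) = q ^ (a * b) := by
    simp [pow_mul]
  rw [← e]
  exact this

end CG


open Filter
namespace CG
open Real

def AProp : Prop := ∀ ρ ε : ℝ, 0 < ρ → ρ < 1 / 2 → 0 < ε → ∀ᶠ x : ℝ in atTop,
  ∃ q : ℕ, q.Prime ∧ x ^ (ρ - ε) ≤ q ∧ (q : ℝ) ≤ x ^ ρ ∧
    x ^ (1 - ρ - ε) ≤ (((Finset.Icc 1 ⌊x⌋₊).filter (fun p => p.Prime ∧ q ∣ p - 1)).card : ℝ)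

lemma C_step {q a b n : ℕ} {x : ℝ} (hq : q.Prime) (hn : 0 < n)
    (hcard : a + b ≤ ((Finset.Icc 1 ⌊x⌋₊).filter (fun p => p.Prime ∧ q ∣ p - 1)).card)
    (hx : 1 ≤ x)
    (hsz : (a + b) * log (x + 1) + b * log q ≤ log n) :
    a * b * log q ≤ log (congCount 2 n) := by
  obtain ⟨t, hts, htc⟩ := Finset.exists_subset_card_eq hcard
  have e : Fin a ⊕ Fin b ≃ t := Fintype.equivOfCardEq (by simp [htc])
  let p : Fin a ⊕ Fin b → ℕ := fun i => (e i : ℕ)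
  have hmem : ∀ i, p i ∈ (Finset.Icc 1 ⌊x⌋₊).filter (fun p => p.Prime ∧ q ∣ p - 1) :=
    fun i => hts (e i).2
  have hple : ∀ i, (p i : ℝ) ≤ x := fun i => by
    have := (Finset.mem_Icc.1 (Finset.mem_filter.1 (hmem i)).1).2
    exact (Nat.cast_le.2 this).trans (Nat.floor_le (by linarith))
  have hq0 : (0 : ℝ) < q := by exact_mod_cast hq.pos
  have hbd : (∏ i, (p i + 1)) * q ^ b ≤ n := by
    have h1 : (((∏ i, (p i + 1)) * q ^ b : ℕ) : ℝ) ≤ (x + 1) ^ (a + b) * q ^ b := by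
      push_cast
      gcongr
      calc ∏ i, ((p i : ℝ) + 1) ≤ ∏ _i : Fin a ⊕ Fin b, (x + 1) :=
            Finset.prod_le_prod (fun i _ => by positivity) (fun i _ => by linarith [hple i])
        _ = _ := by simp
    have h2 : (x + 1) ^ (a + b) * (q : ℝ) ^ b ≤ n := by
      rw [← Real.log_le_log_iff (by positivity) (by exact_mod_cast hn),
        Real.log_mul (by positivity) (by positivity), Real.log_pow, Real.log_pow]
      push_cast
      exact hsz
    exact_mod_cast h1.trans h2
  have h := B_main hq p (fun i => (Finset.mem_filter.1 (hmem i)).2.1)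
    (fun i => (Finset.mem_filter.1 (hmem i)).2.2)
    (fun i j hij => e.injective (Subtype.ext hij)) hbd
  have h3 : log ((q ^ (a * b) : ℕ) : ℝ) ≤ log (congCount 2 n) :=
    Real.log_le_log (by exact_mod_cast pow_pos hq.pos _) (by exact_mod_cast h)
  push_cast at h3
  rw [Real.log_pow] at h3
  push_cast at h3
  exact h3

noncomputable def Gfun (r ε : ℝ) : ℝ :=
  (1 - r) * ((1 + r * r + ε)⁻¹ - ε) * (r * ((1 + r * r + ε)⁻¹ - ε) - ε) * (r - ε) * (1 - r - ε)

set_option maxHeartbeats 1000000 in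
lemma C_ev (hA : AProp) (r ε : ℝ) (hr0 : 0 < r) (hr : r < 1 / 2) (hε : 0 < ε) (h1 : ε < r)
    (h2 : 0 < r * ((1 + r * r + ε)⁻¹ - ε) - ε) (h3 : ε < 1 - r) :
    ∀ᶠ n : ℕ in atTop,
      Gfun r ε ≤ Real.log (congCount 2 n) / ((Real.log n) ^ 2 / Real.log (Real.log n)) := by
  have hlog : Tendsto (fun n : ℕ => Real.log n) atTop atTop :=
    Real.tendsto_log_atTop.comp tendsto_natCast_atTop_atTop
  set s := 1 - r - ε with hs
  have hs0 : 0 < s := by rw [hs]; linarith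
  have hx : Tendsto (fun l : ℝ => l ^ s⁻¹) atTop atTop := tendsto_rpow_atTop (by positivity)
  have ev1 := (hx.comp hlog).eventually (hA r ε hr0 hr hε)
  have ev2 : ∀ᶠ l : ℝ in atTop, log l / s ≤ ε * l := by
    have := (Real.isLittleO_log_id_atTop).bound (show (0:ℝ) < ε * s by positivity)
    filter_upwards [this, eventually_ge_atTop (1:ℝ)] with l hl h1
    rw [div_le_iff₀ hs0]
    simp only [id, Real.norm_eq_abs, abs_of_nonneg (show (0:ℝ) ≤ l by linarith)] at hl
    linarith [le_abs_self (log l)]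
  have ev3 : ∀ᶠ x : ℝ in atTop, log (x + 1) ≤ (1 + ε) * log x := by
    filter_upwards [eventually_ge_atTop (1:ℝ), Real.tendsto_log_atTop.eventually_ge_atTop (1/ε)]
      with x hx hl
    have e : log (x + 1) = log x + log (1 + 1 / x) := by
      rw [← Real.log_mul (by positivity) (by positivity)]
      congr 1; field_simp
    have : log (1 + 1 / x) ≤ 1 := by
      have h1 := Real.log_le_sub_one_of_pos (show (0:ℝ) < 1 + 1 / x by positivity)
      have h2 : 1 / x ≤ 1 := by rw [div_le_one (by linarith)]; exact hx
      linarith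
    have h5 : 1 ≤ ε * log x := by rw [div_le_iff₀ hε] at hl; linarith
    rw [e]; linarith
  filter_upwards [ev1, hlog.eventually ev2, (hx.comp hlog).eventually ev3,
    (hx.comp hlog).eventually (Real.tendsto_log_atTop.eventually_ge_atTop 1),
    (hx.comp hlog).eventually (eventually_ge_atTop 1), hlog.eventually (eventually_ge_atTop 1),
    eventually_gt_atTop 0,
    (Real.tendsto_log_atTop.comp hlog).eventually (eventually_gt_atTop 0)]
    with n hA1 hl2 hx3 hx1 hxge hl1 hn hll
  simp only [Function.comp_apply] at hA1 hx3 hx1 hxge hll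
  set l := Real.log n with hl
  set x := l ^ s⁻¹ with hxdef
  have hlx : log x = log l / s := by rw [hxdef, Real.log_rpow (by linarith)]; field_simp
  have hxs : x ^ s = l := by
    rw [hxdef, ← Real.rpow_mul (by linarith), inv_mul_cancel₀ hs0.ne', Real.rpow_one]
  obtain ⟨q, hq, hq1, hq2, hcard⟩ := hA1
  rw [hxs] at hcard
  set D := 1 + r * r + ε with hD
  have hD1 : 1 < D := by rw [hD]; nlinarith
  set L := ⌊l / (D * log x)⌋₊ with hL
  have hDx : 0 < D * log x := by positivity
  have hL1 : (L : ℝ) ≤ l / (D * log x) := Nat.floor_le (by positivity)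
  have hL2 : l / (D * log x) - 1 < L := Nat.sub_one_lt_floor _
  have hL1' : (L : ℝ) * (D * log x) ≤ l := by rwa [le_div_iff₀ hDx] at hL1
  set b := ⌊r * L⌋₊ with hb
  have hb1 : (b : ℝ) ≤ r * L := Nat.floor_le (by positivity)
  have hb2 : r * L - 1 < b := Nat.sub_one_lt_floor _
  have hbL : b ≤ L := by
    have : (b : ℝ) ≤ L := hb1.trans (by nlinarith [Nat.cast_nonneg (α := ℝ) L])
    exact_mod_cast this
  have hqx : log q ≤ r * log x := by
    rw [← Real.log_rpow (by linarith)]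
    exact Real.log_le_log (by exact_mod_cast hq.pos) hq2
  have hqx2 : (r - ε) * log x ≤ log q := by
    rw [← Real.log_rpow (by linarith)]
    exact Real.log_le_log (by positivity) hq1
  have hab : ((L - b : ℕ) : ℝ) = L - b := by push_cast [hbL]; ring
  have key := C_step (q := q) (a := L - b) (b := b) (n := n) (x := x) hq hn (by
    rw [Nat.sub_add_cancel hbL]
    have : (L : ℝ) ≤ l := hL1.trans (by
      rw [div_le_iff₀ hDx]
      have : 1 ≤ D * log x := by nlinarith
      nlinarith)
    exact_mod_cast this.trans hcard) hxge (by
    rw [hab]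
    have e1 : (b : ℝ) * log q ≤ r * L * (r * log x) := by
      gcongr
    have e2 : (L : ℝ) * log (x + 1) ≤ L * ((1 + ε) * log x) := by gcongr
    calc (L - b + b : ℝ) * log (x + 1) + b * log q ≤ L * ((1 + ε) * log x) + r * L * (r * log x) := by
          rw [sub_add_cancel]; linarith
      _ = L * (D * log x) := by rw [hD]; ring
      _ ≤ l := hL1')
  rw [hab] at key
  have hlpos : 0 < l := by linarith
  -- y := L log x / l
  set y := L * log x / l with hy
  have hlxl : log x / l ≤ ε := by rw [hlx, div_le_iff₀ hlpos]; exact hl2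
  have hy1 : D⁻¹ - ε ≤ y := by
    have : D⁻¹ - log x / l ≤ y := by
      rw [hy, show D⁻¹ - log x / l = (l / (D * log x) - 1) * log x / l by field_simp]
      gcongr
    linarith
  have hbx : r * (D⁻¹ - ε) - ε ≤ b * log x / l := by
    have : r * y - log x / l ≤ b * log x / l := by
      rw [hy, show r * (L * log x / l) - log x / l = (r * L - 1) * log x / l by ring]
      gcongr
    have := mul_le_mul_of_nonneg_left hy1 hr0.le
    linarith
  have hax : (1 - r) * (D⁻¹ - ε) ≤ (L - b) * log x / l := by
    have : (1 - r) * y ≤ (L - b) * log x / l := by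
      rw [hy, show (1 - r) * (L * log x / l) = ((1 - r) * L) * log x / l by ring]
      gcongr
      linarith
    have := mul_le_mul_of_nonneg_left hy1 (show 0 ≤ 1 - r by linarith)
    linarith
  rw [le_div_iff₀ (by positivity)]
  refine le_trans ?_ key
  have hDe : 0 < D⁻¹ - ε := by
    have h9 : 0 < r * (D⁻¹ - ε) := by linarith
    exact (mul_pos_iff_of_pos_left hr0).1 h9
  calc Gfun r ε * (l ^ 2 / log l)
      = ((1 - r) * (D⁻¹ - ε)) * (r * (D⁻¹ - ε) - ε) * ((r - ε) * s) * (l ^ 2 / log l) := by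
        rw [Gfun]; ring
    _ ≤ ((L - b) * log x / l) * (b * log x / l) * ((r - ε) * s) * (l ^ 2 / log l) := by
        have : 0 ≤ (L - b) * log x / l := le_trans (by
          have : 0 < 1 - r := by linarith
          positivity) hax
        have h5 : 0 ≤ r - ε := by linarith
        gcongr
    _ = (L - b) * b * ((r - ε) * log x) := by
        rw [show log l = s * log x by rw [hlx]; field_simp]
        field_simp
    _ ≤ _ := by
        have : (0:ℝ) ≤ L - b := by rw [← hab]; positivity
        gcongr

lemma C_final (hA : AProp) : (3 - 2 * Real.sqrt 2) / 4 ≤ liminf (fun n : ℕ =>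
    Real.log (congCount 2 n) / ((Real.log n) ^ 2 / Real.log (Real.log n))) atTop := by
  have hcob : IsCoboundedUnder (· ≥ ·) atTop (fun n : ℕ =>
    Real.log (congCount 2 n) / ((Real.log n) ^ 2 / Real.log (Real.log n))) :=
    IsBoundedUnder.isCoboundedUnder_ge ⟨193, upper_bound⟩
  set r := Real.sqrt 2 - 1 with hr
  have hsq : Real.sqrt 2 * Real.sqrt 2 = 2 := Real.mul_self_sqrt (by norm_num)
  have hs0 : 0 ≤ Real.sqrt 2 := Real.sqrt_nonneg 2
  have hr0 : 0 < r := by rw [hr]; nlinarith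
  have hr1 : r < 1 / 2 := by rw [hr]; nlinarith
  have hD : (1 + r * r) ≠ 0 := by positivity
  have c1 : ContinuousAt (fun ε : ℝ => (1 + r * r + ε)⁻¹) 0 :=
    ContinuousAt.inv₀ (by fun_prop) (by simpa using hD)
  have c2 : ContinuousAt (fun ε : ℝ => r * ((1 + r * r + ε)⁻¹ - ε) - ε) 0 := by fun_prop
  have c3 : ContinuousAt (fun ε : ℝ => Gfun r ε) 0 := by unfold Gfun; fun_prop
  have hG0 : Gfun r 0 = (3 - 2 * Real.sqrt 2) / 4 := by
    have e : Real.sqrt 2 = r + 1 := by rw [hr]; ring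
    have e2 : r * r = 1 - 2 * r := by rw [e] at hsq; linarith
    have e3 : 1 - r ≠ 0 := by linarith
    rw [Gfun, e]
    simp only [sub_zero, add_zero]
    rw [show 1 + r * r = 2 * (1 - r) by rw [e2]; ring]
    field_simp
    nlinarith
  refine le_of_forall_lt fun c hc => ?_
  obtain ⟨c', hc1, hc2⟩ := exists_between hc
  refine hc1.trans_le (le_liminf_of_le hcob ?_)
  have e1 : ∀ᶠ ε in nhds (0:ℝ), c' < Gfun r ε := c3.eventually_const_lt (by simp only [hG0]; exact hc2)
  have e2 : ∀ᶠ ε in nhds (0:ℝ), 0 < r * ((1 + r * r + ε)⁻¹ - ε) - ε :=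
    c2.eventually_const_lt (by simp only [add_zero, sub_zero]; positivity)
  have e3 : ∀ᶠ ε in nhds (0:ℝ), ε < r := eventually_lt_nhds hr0
  obtain ⟨ε, ⟨⟨h1, h2⟩, h3⟩, h4⟩ := ((((e1.and e2).and e3).filter_mono nhdsWithin_le_nhds).and
    (self_mem_nhdsWithin (a := (0:ℝ)) (s := Set.Ioi 0))).exists
  filter_upwards [C_ev hA r ε hr0 hr1 h4 h3 h2 (by linarith)] with n hn
  linarith

end CG

open Filter
namespace CG
open Real Finset

noncomputable def ee (x : ℝ) : ℂ := Complex.exp (2 * π * Complex.I * x)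

lemma ee_add (x y : ℝ) : ee (x + y) = ee x * ee y := by
  rw [ee, ee, ee, ← Complex.exp_add]; congr 1; push_cast; ring

lemma ee_int (k : ℤ) : ee k = 1 := by
  rw [ee, Complex.exp_eq_one_iff]; exact ⟨k, by push_cast; ring⟩

lemma norm_ee (x : ℝ) : ‖ee x‖ = 1 := by
  rw [ee, show (2 * π * Complex.I * x : ℂ) = ((2 * π * x : ℝ) : ℂ) * Complex.I by push_cast; ring]
  exact Complex.norm_exp_ofReal_mul_I _

lemma ee_re (x : ℝ) : (ee x).re = Real.cos (2 * π * x) := by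
  rw [ee, show (2 * π * Complex.I * x : ℂ) = ((2 * π * x : ℝ) : ℂ) * Complex.I by push_cast; ring]
  exact Complex.exp_ofReal_mul_I_re _

lemma std_eq_ee (R : ℕ) [NeZero R] (c n : ℕ) :
    ZMod.stdAddChar ((c : ZMod R) * (n : ZMod R)) = ee (c * n / R) := by
  have := ZMod.stdAddChar_coe (N := R) ((c * n : ℕ) : ℤ)
  rw [ee]
  push_cast at this ⊢
  rw [this]; congr 1; ring

lemma parseval {ι : Type*} (s : Finset ι) (R : ℕ) [NeZero R] (g : ι → ZMod R)
    (hg : Set.InjOn g s) (t : ι → ℂ) :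
    ∑ c : ZMod R, ‖∑ n ∈ s, t n * ZMod.stdAddChar (c * g n)‖ ^ 2 = R * ∑ n ∈ s, ‖t n‖ ^ 2 := by
  classical
  have h : ((∑ c : ZMod R, ‖∑ n ∈ s, t n * ZMod.stdAddChar (c * g n)‖ ^ 2 : ℝ) : ℂ)
      = ((R * ∑ n ∈ s, ‖t n‖ ^ 2 : ℝ) : ℂ) := by
    push_cast
    simp_rw [← Complex.mul_conj', map_sum, map_mul, ← AddChar.map_neg_eq_conj, sum_mul_sum]
    rw [sum_comm, mul_sum]
    refine sum_congr rfl fun n hn => ?_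
    rw [sum_comm, sum_eq_single n]
    · simp_rw [show ∀ c : ZMod R, t n * ZMod.stdAddChar (c * g n) *
        ((starRingEnd ℂ) (t n) * ZMod.stdAddChar (-(c * g n))) = t n * (starRingEnd ℂ) (t n) *
          (ZMod.stdAddChar (c * g n) * ZMod.stdAddChar (-(c * g n))) from fun c => by ring]
      simp_rw [← AddChar.map_add_eq_mul, add_neg_cancel, AddChar.map_zero_eq_one]
      simp [ZMod.card]
    · intro m hm hmn
      simp_rw [show ∀ c : ZMod R, t n * ZMod.stdAddChar (c * g n) *
        ((starRingEnd ℂ) (t m) * ZMod.stdAddChar (-(c * g m))) = t n * (starRingEnd ℂ) (t m) *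
          (ZMod.stdAddChar (c * g n) * ZMod.stdAddChar (-(c * g m))) from fun c => by ring]
      simp_rw [← AddChar.map_add_eq_mul, ← sub_eq_add_neg, ← mul_sub]
      rw [← mul_sum, AddChar.sum_mulShift _ (ZMod.isPrimitive_stdAddChar R), if_neg]
      · simp
      · rw [sub_eq_zero]
        exact fun h => hmn (hg hm hn h.symm)
    · exact fun h => absurd hn h
  exact_mod_cast h

lemma sum_zmod_eq_range {M : Type*} [AddCommMonoid M] (R : ℕ) [NeZero R] (f : ZMod R → M) :
    ∑ c : ZMod R, f c = ∑ c ∈ range R, f (c : ZMod R) := by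
  symm
  refine sum_bij (fun c _ => (c : ZMod R)) (by simp) ?_ ?_ (by simp)
  · intro a ha b hb h
    rw [mem_range] at ha hb
    rw [ZMod.natCast_eq_natCast_iff'] at h
    rwa [Nat.mod_eq_of_lt ha, Nat.mod_eq_of_lt hb] at h
  · intro b _
    exact ⟨b.val, mem_range.2 (ZMod.val_lt b), by simp⟩

lemma parseval' (s : Finset ℕ) (R : ℕ) [NeZero R]
    (hg : Set.InjOn (fun n : ℕ => (n : ZMod R)) s) (t : ℕ → ℂ) :
    ∑ c ∈ range R, ‖∑ n ∈ s, t n * ee (c * n / R)‖ ^ 2 = R * ∑ n ∈ s, ‖t n‖ ^ 2 := by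
  rw [← parseval s R _ hg t, sum_zmod_eq_range]
  simp_rw [std_eq_ee]

lemma LS (P : Finset ℕ) (hP : ∀ q ∈ P, q.Prime) (Q N : ℕ) (hQ : ∀ q ∈ P, q ≤ Q) (hN : 0 < N)
    (a : ℕ → ℂ) :
    ∑ q ∈ P, ∑ c ∈ Ico 1 q, ‖∑ n ∈ Icc 1 N, a n * ee (c * n / q)‖ ^ 2
      ≤ 28 * (N + (Q : ℝ) ^ 2) * ∑ n ∈ Icc 1 N, ‖a n‖ ^ 2 := by
  classical
  set B := ∏ q ∈ P, q with hB
  have hB0 : 0 < B := prod_pos fun q hq => (hP q hq).pos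
  set m := 7 * (N + Q ^ 2) with hm
  have hm0 : 0 < m := by positivity
  set R := m * B with hR
  have hR0 : 0 < R := by positivity
  have : NeZero R := ⟨hR0.ne'⟩
  have hBr : (0:ℝ) < B := by exact_mod_cast hB0
  have hRr : (0:ℝ) < R := by exact_mod_cast hR0
  let w : ℕ → ℂ := fun n => (B : ℂ)⁻¹ * ∑ b ∈ range B, ee (b * n / R)
  have hw : ∀ n ∈ Icc 1 N, 1 / 2 ≤ ‖w n‖ := by
    intro n hn
    have hnN : (n : ℝ) ≤ N := by exact_mod_cast (mem_Icc.1 hn).2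
    refine le_trans ?_ (Complex.re_le_norm _)
    have : (w n).re = (B : ℝ)⁻¹ * ∑ b ∈ range B, Real.cos (2 * π * (b * n / R)) := by
      simp only [w]
      rw [show ((B : ℂ)⁻¹) = (((B : ℝ)⁻¹ : ℝ) : ℂ) by push_cast; rfl, Complex.re_ofReal_mul,
        Complex.re_sum]
      simp_rw [ee_re]
    rw [this, inv_mul_eq_div, le_div_iff₀ hBr]
    have h1 : ∀ b ∈ range B, (1/2 : ℝ) ≤ Real.cos (2 * π * (b * n / R)) := by
      intro b hb
      have hb' : (b : ℝ) ≤ B := by exact_mod_cast (mem_range.1 hb).le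
      have h2 : (b * n / R : ℝ) ≤ 1 / 7 := by
        rw [div_le_iff₀ hRr, hR, hm]
        push_cast
        have : (b : ℝ) * n ≤ B * N := by gcongr
        nlinarith [mul_nonneg hBr.le (sq_nonneg (Q:ℝ))]
      have h3 : (0:ℝ) ≤ b * n / R := by positivity
      have := Real.one_sub_sq_div_two_le_cos (x := 2 * π * (b * n / R))
      have h4 : 2 * π * (b * n / R) ≤ 1 := by
        nlinarith [Real.pi_lt_d2, Real.pi_pos]
      have h5 : 0 ≤ 2 * π * (b * n / R) := by positivity
      nlinarith
    calc 1 / 2 * (B:ℝ) = ∑ b ∈ range B, (1/2 : ℝ) := by simp; ring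
      _ ≤ _ := sum_le_sum h1
  let T : ℕ → ℂ := fun c => ∑ n ∈ Icc 1 N, (a n / w n) * ee (c * n / R)
  have hPars : ∑ c ∈ range R, ‖T c‖ ^ 2 ≤ R * (4 * ∑ n ∈ Icc 1 N, ‖a n‖ ^ 2) := by
    rw [parseval' (Icc 1 N) R]
    · gcongr
      rw [mul_sum]
      refine sum_le_sum fun n hn => ?_
      have := hw n hn
      rw [norm_div, div_pow, div_le_iff₀ (by positivity)]
      have : 1 ≤ 4 * ‖w n‖ ^ 2 := by nlinarith
      nlinarith [sq_nonneg ‖a n‖]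
    · intro x hx y hy h
      simp only [coe_Icc, Set.mem_Icc] at hx hy
      have hNR : N < R := by rw [hR, hm]; nlinarith
      rw [ZMod.natCast_eq_natCast_iff'] at h
      rwa [Nat.mod_eq_of_lt (by omega), Nat.mod_eq_of_lt (by omega)] at h
  have hdvd : ∀ q ∈ P, q * (R / q) = R := fun q hq =>
    Nat.mul_div_cancel' ((dvd_prod_of_mem _ hq).trans (Dvd.intro_left m rfl))
  have hpt : ∀ q ∈ P, ∀ c : ℕ, ‖∑ n ∈ Icc 1 N, a n * ee (c * n / q)‖ ^ 2
      ≤ (B : ℝ)⁻¹ * ∑ b ∈ range B, ‖T (R / q * c + b)‖ ^ 2 := by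
    intro q hq c
    have hq0 : (0:ℝ) < q := by exact_mod_cast (hP q hq).pos
    have hdr : (q : ℝ) * ((R / q : ℕ) : ℝ) = R := by exact_mod_cast hdvd q hq
    have e1 : ∑ n ∈ Icc 1 N, a n * ee (c * n / q) = (B : ℂ)⁻¹ * ∑ b ∈ range B, T (R / q * c + b) := by
      simp only [T]
      rw [sum_comm, mul_sum]
      refine sum_congr rfl fun n hn => ?_
      have hwn : w n ≠ 0 := by
        intro h
        have := hw n hn
        rw [h, norm_zero] at this; norm_num at this
      have e2 : ∀ b ∈ range B, a n / w n * ee (((R / q * c + b : ℕ) : ℝ) * n / R)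
          = a n / w n * ee (c * n / q) * ee (b * n / R) := by
        intro b _
        rw [mul_assoc, ← ee_add]
        congr 2
        push_cast
        rw [← hdr]
        have : ((R / q : ℕ) : ℝ) ≠ 0 := by
          intro h; rw [h, mul_zero] at hdr; exact hRr.ne hdr
        field_simp
      rw [sum_congr rfl e2, ← mul_sum]
      rw [show ∑ b ∈ range B, ee (b * n / R) = B * w n by
        simp only [w]; rw [mul_inv_cancel_left₀]; exact_mod_cast hB0.ne']
      have : (B : ℂ) ≠ 0 := by exact_mod_cast hB0.ne'
      field_simp
    rw [e1, norm_mul, mul_pow]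
    have h1 : ‖∑ b ∈ range B, T (R / q * c + b)‖ ^ 2 ≤ B * ∑ b ∈ range B, ‖T (R / q * c + b)‖ ^ 2 := by
      refine (pow_le_pow_left₀ (norm_nonneg _) (norm_sum_le _ _) 2).trans ?_
      have := sq_sum_le_card_mul_sum_sq (s := range B) (f := fun b => ‖T (R / q * c + b)‖)
      simpa using this
    have h2 : ‖(B : ℂ)⁻¹‖ = (B : ℝ)⁻¹ := by simp
    rw [h2]
    calc ((B : ℝ)⁻¹) ^ 2 * _ ≤ ((B : ℝ)⁻¹) ^ 2 * (B * ∑ b ∈ range B, ‖T (R / q * c + b)‖ ^ 2) := by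
          gcongr
      _ = _ := by field_simp
  -- injectivity
  have hinj : ∑ q ∈ P, ∑ c ∈ Ico 1 q, ∑ b ∈ range B, ‖T (R / q * c + b)‖ ^ 2
      ≤ ∑ c ∈ range R, ‖T c‖ ^ 2 := by
    rw [show ∑ q ∈ P, ∑ c ∈ Ico 1 q, ∑ b ∈ range B, ‖T (R / q * c + b)‖ ^ 2
      = ∑ z ∈ P.sigma (fun q => (Ico 1 q) ×ˢ (range B)), ‖T (R / z.1 * z.2.1 + z.2.2)‖ ^ 2 by
        rw [sum_sigma]
        refine sum_congr rfl fun q _ => ?_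
        rw [sum_product]]
    have hI : Set.InjOn (fun z : (_ : ℕ) × (ℕ × ℕ) => R / z.1 * z.2.1 + z.2.2)
        (P.sigma (fun q => (Ico 1 q) ×ˢ (range B)) : Finset _) := by
      rintro ⟨q, c, b⟩ hz ⟨q', c', b'⟩ hz' h
      simp only [coe_sigma, Set.mem_sigma_iff, mem_coe, mem_product, mem_Ico, mem_range] at hz hz' h
      obtain ⟨hq, ⟨hc1, hc2⟩, hb⟩ := hz
      obtain ⟨hq', ⟨hc1', hc2'⟩, hb'⟩ := hz'
      have key : c * q' = c' * q := by
        by_contra hne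
        have h1 : (1:ℝ) ≤ |(c : ℝ) * q' - c' * q| := by
          have : (1:ℤ) ≤ |(c : ℤ) * q' - c' * q| := Int.one_le_abs (by
            rw [sub_ne_zero]; exact_mod_cast hne)
          exact_mod_cast this
        have hdr : (q : ℝ) * ((R / q : ℕ) : ℝ) = R := by exact_mod_cast hdvd q hq
        have hdr' : (q' : ℝ) * ((R / q' : ℕ) : ℝ) = R := by exact_mod_cast hdvd q' hq'
        have hr : ((R / q : ℕ) : ℝ) * c + b = ((R / q' : ℕ) : ℝ) * c' + b' := by exact_mod_cast h
        have e : (R : ℝ) * (c * q' - c' * q) = (b' - b) * (q * q') := by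
          have : (q : ℝ) * q' * (((R / q : ℕ) : ℝ) * c + b) = q * q' * (((R / q' : ℕ) : ℝ) * c' + b') := by
            rw [hr]
          linear_combination this - (c * q' : ℝ) * hdr + (c' * q : ℝ) * hdr'
        have h2 : |(b' - b : ℝ)| ≤ B := by
          rw [abs_le]
          have : (b : ℝ) ≤ B := by exact_mod_cast hb.le
          have : (b' : ℝ) ≤ B := by exact_mod_cast hb'.le
          constructor <;> linarith [Nat.cast_nonneg (α := ℝ) b, Nat.cast_nonneg (α := ℝ) b']
        have h3 := congrArg abs e
        rw [abs_mul, abs_mul, abs_of_pos hRr, abs_of_nonneg (show (0:ℝ) ≤ q * q' by positivity)] at h3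
        have h4 : (R : ℝ) ≤ B * (Q * Q) := by
          calc (R : ℝ) ≤ R * |(c : ℝ) * q' - c' * q| := by nlinarith
            _ = |(b' - b : ℝ)| * (q * q') := h3
            _ ≤ B * (Q * Q) := by
              gcongr
              · exact hQ q hq
              · exact hQ q' hq'
        rw [hR, hm] at h4
        push_cast at h4
        have hN' : (0:ℝ) < N := by exact_mod_cast hN
        nlinarith [mul_pos hBr hN', mul_nonneg hBr.le (sq_nonneg (Q:ℝ))]
      have hqq : q = q' := by
        by_contra hne
        have hcop : Nat.Coprime q q' := (Nat.coprime_primes (hP q hq) (hP q' hq')).2 hne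
        have : q ∣ c := hcop.dvd_of_dvd_mul_right (Dvd.intro_left c' key.symm)
        exact absurd (Nat.le_of_dvd (by omega) this) (by omega)
      subst hqq
      have hcc : c = c' := Nat.eq_of_mul_eq_mul_right (hP q hq).pos key
      subst hcc
      have : b = b' := by omega
      subst this
      rfl
    rw [← sum_image (f := fun c => ‖T c‖ ^ 2) hI]
    refine sum_le_sum_of_subset_of_nonneg ?_ fun _ _ _ => by positivity
    intro v hv
    rw [mem_image] at hv
    obtain ⟨⟨q, c, b⟩, hz, rfl⟩ := hv
    simp only [mem_sigma, mem_product, mem_Ico, mem_range] at hz ⊢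
    obtain ⟨hq, ⟨hc1, hc2⟩, hb⟩ := hz
    have h1 := hdvd q hq
    have h2 : B ≤ R / q := by
      rw [Nat.le_div_iff_mul_le (hP q hq).pos, hR, mul_comm]
      gcongr
      rw [hm]; nlinarith [hQ q hq]
    have h3 : R / q * c + R / q ≤ R := by
      calc R / q * c + R / q = R / q * (c + 1) := by ring
        _ ≤ R / q * q := by gcongr; omega
        _ = R := by rw [mul_comm]; exact h1
    omega
  calc ∑ q ∈ P, ∑ c ∈ Ico 1 q, ‖∑ n ∈ Icc 1 N, a n * ee (c * n / q)‖ ^ 2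
      ≤ ∑ q ∈ P, ∑ c ∈ Ico 1 q, ((B : ℝ)⁻¹ * ∑ b ∈ range B, ‖T (R / q * c + b)‖ ^ 2) :=
        sum_le_sum fun q hq => sum_le_sum fun c _ => hpt q hq c
    _ = (B : ℝ)⁻¹ * ∑ q ∈ P, ∑ c ∈ Ico 1 q, ∑ b ∈ range B, ‖T (R / q * c + b)‖ ^ 2 := by
        simp_rw [mul_sum]
    _ ≤ (B : ℝ)⁻¹ * (R * (4 * ∑ n ∈ Icc 1 N, ‖a n‖ ^ 2)) := by
        gcongr
        exact hinj.trans hPars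
    _ = _ := by
        rw [hR, hm]; push_cast; field_simp; ring

/-- variance of `a` over residue classes mod `q`. -/
noncomputable def VV (q N : ℕ) (a : ℕ → ℝ) : ℝ :=
  ∑ r ∈ range q, (∑ n ∈ (Icc 1 N).filter (fun n : ℕ => (n : ZMod q) = (r : ZMod q)), a n -
    (∑ n ∈ Icc 1 N, a n) / q) ^ 2

lemma VV_eq (q N : ℕ) (hq : 0 < q) (a : ℕ → ℝ) :
    ∑ c ∈ Ico 1 q, ‖∑ n ∈ Icc 1 N, (a n : ℂ) * ee (c * n / q)‖ ^ 2 = q * VV q N a := by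
  have : NeZero q := ⟨hq.ne'⟩
  have hq' : (q : ℂ) ≠ 0 := by exact_mod_cast hq.ne'
  let t : ZMod q → ℂ := fun h => ((∑ n ∈ (Icc 1 N).filter (fun n : ℕ => (n : ZMod q) = h), a n -
    (∑ n ∈ Icc 1 N, a n) / q : ℝ) : ℂ)
  have hp := parseval (univ : Finset (ZMod q)) q id (Set.injOn_id _) t
  have hV : ∑ h, ‖t h‖ ^ 2 = VV q N a := by
    rw [sum_zmod_eq_range, VV]
    refine sum_congr rfl fun r _ => ?_
    simp only [t]
    rw [Complex.norm_real, Real.norm_eq_abs, sq_abs]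
  rw [hV] at hp
  rw [← hp, sum_zmod_eq_range, range_eq_Ico, sum_eq_sum_Ico_succ_bot hq]
  have hexp : ∀ c : ZMod q, ∑ h, t h * ZMod.stdAddChar (c * id h) =
      ∑ n ∈ Icc 1 N, (a n : ℂ) * ZMod.stdAddChar (c * (n : ZMod q))
        - (∑ n ∈ Icc 1 N, (a n : ℂ)) / q * ∑ h : ZMod q, ZMod.stdAddChar (h * c) := by
    intro c
    simp only [t, id]
    push_cast
    simp_rw [sub_mul, sum_sub_distrib]
    congr 1
    · simp_rw [sum_mul]
      rw [← sum_fiberwise (Icc 1 N) (fun n : ℕ => (n : ZMod q))]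
      refine sum_congr rfl fun h _ => sum_congr rfl fun n hn => ?_
      rw [(mem_filter.1 hn).2]
    · rw [mul_sum]
      simp_rw [mul_comm c]
  have h0 : ‖∑ n, t n * ZMod.stdAddChar (((0 : ℕ) : ZMod q) * id n)‖ ^ 2 = 0 := by
    rw [hexp]
    simp [hq']
  rw [h0, zero_add]
  refine sum_congr rfl fun c hc => ?_
  rw [mem_Ico] at hc
  rw [hexp, AddChar.sum_mulShift _ (ZMod.isPrimitive_stdAddChar q), if_neg]
  · simp_rw [std_eq_ee]; simp
  · rw [ZMod.natCast_eq_zero_iff]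
    intro h
    exact absurd (Nat.le_of_dvd (by omega) h) (by omega)

theorem large_sieve (P : Finset ℕ) (hP : ∀ q ∈ P, q.Prime) (Q N : ℕ) (hQ : ∀ q ∈ P, q ≤ Q)
    (a : ℕ → ℝ) :
    ∑ q ∈ P, q * VV q N a ≤ 28 * (N + (Q : ℝ) ^ 2) * ∑ n ∈ Icc 1 N, a n ^ 2 := by
  rcases Nat.eq_zero_or_pos N with rfl | hN
  · simp [VV]
  have := LS P hP Q N hQ hN (fun n => (a n : ℂ))
  simp only [Complex.norm_real, Real.norm_eq_abs, sq_abs] at this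
  rwa [sum_congr rfl fun q hq => VV_eq q N (hP q hq).pos a] at this

end CG

open Filter
namespace CG
open Real Finset

noncomputable def kz (q : ℕ) (z : ZMod q) : ℝ :=
  if z = 0 then 0 else (if z = 1 then 1 else 0) - 1 / ((q : ℝ) - 1)

noncomputable def kap (q n : ℕ) : ℝ := kz q (n : ZMod q)

section
variable (q : ℕ) [hq : Fact q.Prime]

lemma q_sub_pos : (0 : ℝ) < (q : ℝ) - 1 := by
  have : (1 : ℝ) < q := by exact_mod_cast hq.out.one_lt
  linarith

lemma sum_erase_const : ∑ _z ∈ (univ : Finset (ZMod q)).erase 0, 1 / ((q : ℝ) - 1) = 1 := by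
  have := q_sub_pos q
  rw [sum_const, card_erase_of_mem (mem_univ _), card_univ, ZMod.card, nsmul_eq_mul,
    Nat.cast_sub hq.out.one_lt.le]
  push_cast
  field_simp

lemma kz_sum_eq (B : ZMod q → ℝ) :
    ∑ z : ZMod q, B z * kz q z = B 1 - 1 / ((q : ℝ) - 1) * ∑ z ∈ univ.erase 0, B z := by
  rw [← add_sum_erase univ _ (mem_univ (0 : ZMod q))]
  have : ∀ z ∈ (univ : Finset (ZMod q)).erase 0, B z * kz q z =
      (if z = 1 then B 1 else 0) - 1 / ((q : ℝ) - 1) * B z := by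
    intro z hz
    rw [kz, if_neg (ne_of_mem_erase hz)]
    split_ifs with h
    · rw [h]; ring
    · ring
  rw [sum_congr rfl this, sum_sub_distrib, ← mul_sum, sum_ite_eq', if_pos (by simp)]
  simp [kz]

lemma kz_sum : ∑ z : ZMod q, kz q z = 0 := by
  have := kz_sum_eq q (fun _ => 1)
  simp only [one_mul] at this
  rw [this, mul_sum]
  simp only [mul_one]
  rw [sum_erase_const, sub_self]

lemma kz_abs_sum : ∑ z : ZMod q, |kz q z| ≤ 2 := by
  have h0 := q_sub_pos q
  rw [← add_sum_erase univ _ (mem_univ (0 : ZMod q))]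
  have : ∀ z ∈ (univ : Finset (ZMod q)).erase 0, |kz q z| ≤
      (if z = 1 then 1 else 0) + 1 / ((q : ℝ) - 1) := by
    intro z hz
    rw [kz, if_neg (ne_of_mem_erase hz)]
    refine (abs_sub _ _).trans (le_of_eq ?_)
    rw [abs_of_pos (show 0 < 1 / ((q : ℝ) - 1) by positivity)]
    split_ifs <;> simp
  have h2 := sum_le_sum this
  rw [sum_add_distrib, sum_erase_const, sum_ite_eq', if_pos (by simp)] at h2
  simp only [kz, if_true, abs_zero, zero_add] at h2 ⊢
  linarith

lemma mul_sum_bij (d : ZMod q) (hd : d ≠ 0) (F : ZMod q → ℝ) :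
    ∑ z, F (d * z) = ∑ z, F z :=
  Equiv.sum_comp (Equiv.mulLeft₀ d hd) F

lemma kz_bilin (A B : ZMod q → ℝ) : ∑ h, ∑ h', A h * B h' * kz q (h * h') =
    ∑ h ∈ univ.erase 0, A h * (B h⁻¹ - 1 / ((q : ℝ) - 1) * ∑ z ∈ univ.erase 0, B z) := by
  rw [← add_sum_erase univ _ (mem_univ (0 : ZMod q))]
  have e0 : ∑ h', A 0 * B h' * kz q (0 * h') = 0 := by simp [kz]
  rw [e0, zero_add]
  refine sum_congr rfl fun h hh => ?_
  have hne := ne_of_mem_erase hh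
  simp_rw [mul_assoc]
  rw [← mul_sum]
  congr 1
  have := mul_sum_bij q h hne (fun z => B (h⁻¹ * z) * kz q z)
  simp only [inv_mul_cancel_left₀ hne] at this
  rw [this, kz_sum_eq, mul_one]
  congr 2
  rw [← add_right_inj (B (h⁻¹ * 0)), add_sum_erase univ (fun z => B (h⁻¹ * z)) (mem_univ 0),
    mul_sum_bij q h⁻¹ (inv_ne_zero hne) B, mul_zero, add_sum_erase univ B (mem_univ 0)]

lemma cov_le {ι : Type*} (s : Finset ι) (x y : ι → ℝ) (c : ℝ) (hc : c * #s = 1) (hc0 : 0 ≤ c) :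
    (∑ i ∈ s, x i * (y i - c * ∑ j ∈ s, y j)) ^ 2 ≤ (∑ i ∈ s, x i ^ 2) * ∑ i ∈ s, y i ^ 2 := by
  refine (sum_mul_sq_le_sq_mul_sq s x _).trans ?_
  refine mul_le_mul_of_nonneg_left ?_ (sum_nonneg fun _ _ => sq_nonneg _)
  set Y := ∑ j ∈ s, y j with hY
  have : ∑ i ∈ s, (y i - c * Y) ^ 2 = ∑ i ∈ s, y i ^ 2 - c * Y ^ 2 := by
    simp_rw [sub_sq]
    rw [sum_add_distrib, sum_sub_distrib, sum_const, nsmul_eq_mul]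
    have : ∑ i ∈ s, 2 * y i * (c * Y) = 2 * c * Y ^ 2 := by
      rw [← sum_mul, ← mul_sum, ← hY]; ring
    rw [this]
    linear_combination c * Y ^ 2 * hc
  rw [this]
  nlinarith [sq_nonneg Y]

lemma kz_bilin_le (A B : ZMod q → ℝ) : (∑ h, ∑ h', A h * B h' * kz q (h * h')) ^ 2 ≤
    (∑ h, A h ^ 2) * ∑ h, B h ^ 2 := by
  have h0 := q_sub_pos q
  have e : ∑ z ∈ (univ : Finset (ZMod q)).erase 0, B z = ∑ z ∈ univ.erase 0, B z⁻¹ := by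
    rw [← add_right_inj (B 0), add_sum_erase univ B (mem_univ 0)]
    have := add_sum_erase univ (fun z : ZMod q => B z⁻¹) (mem_univ 0)
    simp only [inv_zero] at this
    rw [this]
    exact (Equiv.sum_comp (Equiv.inv (ZMod q)) B).symm
  rw [kz_bilin, e]
  refine (cov_le _ A (fun z => B z⁻¹) (1 / ((q : ℝ) - 1)) ?_ (by positivity)).trans ?_
  · have := sum_erase_const q
    rw [sum_const, nsmul_eq_mul] at this
    linarith
  · have h1 : ∑ h ∈ univ.erase 0, A h ^ 2 ≤ ∑ h, A h ^ 2 :=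
      sum_le_sum_of_subset_of_nonneg (erase_subset _ _) fun _ _ _ => sq_nonneg _
    have h2 : ∑ h ∈ univ.erase 0, B h⁻¹ ^ 2 ≤ ∑ h, B h ^ 2 := by
      rw [← Equiv.sum_comp (Equiv.inv (ZMod q)) (fun h => B h ^ 2)]
      exact sum_le_sum_of_subset_of_nonneg (erase_subset _ _) fun _ _ _ => sq_nonneg _
    have h3 : 0 ≤ ∑ h ∈ (univ : Finset (ZMod q)).erase 0, B h⁻¹ ^ 2 :=
      sum_nonneg fun _ _ => sq_nonneg _
    exact mul_le_mul h1 h2 h3 (sum_nonneg fun _ _ => sq_nonneg _)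

lemma kz_row (h : ZMod q) : ∑ h', kz q (h * h') = 0 := by
  rcases eq_or_ne h 0 with rfl | hne
  · simp [kz]
  · rw [mul_sum_bij q h hne (kz q), kz_sum]

lemma VV_nonneg (q N : ℕ) (a : ℕ → ℝ) : 0 ≤ VV q N a := sum_nonneg fun _ _ => sq_nonneg _

lemma bilin (M N : ℕ) (a b : ℕ → ℝ) :
    (∑ m ∈ Icc 1 M, ∑ k ∈ Icc 1 N, a m * b k * kap q (m * k)) ^ 2 ≤ VV q M a * VV q N b := by
  have : NeZero q := ⟨hq.out.ne_zero⟩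
  let A : ZMod q → ℝ := fun h => ∑ n ∈ (Icc 1 M).filter (fun n : ℕ => (n : ZMod q) = h), a n
  let B : ZMod q → ℝ := fun h => ∑ n ∈ (Icc 1 N).filter (fun n : ℕ => (n : ZMod q) = h), b n
  have e1 : ∑ m ∈ Icc 1 M, ∑ k ∈ Icc 1 N, a m * b k * kap q (m * k) =
      ∑ h, ∑ h', A h * B h' * kz q (h * h') := by
    rw [← sum_fiberwise (Icc 1 M) (fun n : ℕ => (n : ZMod q))]
    refine sum_congr rfl fun h _ => ?_
    simp_rw [← sum_fiberwise (Icc 1 N) (fun n : ℕ => (n : ZMod q)) (fun k => a _ * b k * kap q (_ * k))]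
    rw [sum_comm]
    refine sum_congr rfl fun h' _ => ?_
    simp only [A, B]
    rw [sum_mul_sum, sum_mul]
    refine sum_congr rfl fun m hm => ?_
    rw [sum_mul]
    refine sum_congr rfl fun k hk => ?_
    rw [kap, Nat.cast_mul, (mem_filter.1 hm).2, (mem_filter.1 hk).2]
  have e2 : ∀ α β : ℝ, ∑ h, ∑ h', A h * B h' * kz q (h * h') =
      ∑ h, ∑ h', (A h - α) * (B h' - β) * kz q (h * h') := by
    intro α β
    have s1 : ∑ h, ∑ h', A h * β * kz q (h * h') = 0 := by
      simp_rw [← mul_sum, kz_row]; simp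
    have s2 : ∑ h, ∑ h', α * β * kz q (h * h') = 0 := by
      simp_rw [← mul_sum, kz_row]; simp
    have s3 : ∑ h, ∑ h', α * B h' * kz q (h * h') = 0 := by
      rw [sum_comm]
      simp_rw [← mul_sum, mul_comm _ (_ : ZMod q)]
      refine sum_eq_zero fun h _ => ?_
      have := kz_row q h
      simp_rw [mul_comm h] at this
      simp_rw [mul_comm h]
      rw [this, mul_zero]
    have : ∀ h h', (A h - α) * (B h' - β) * kz q (h * h') = A h * B h' * kz q (h * h')
      - A h * β * kz q (h * h') - α * B h' * kz q (h * h') + α * β * kz q (h * h') :=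
      fun h h' => by ring
    simp_rw [this, sum_add_distrib, sum_sub_distrib]
    rw [s1, s2, s3]; ring
  rw [e1, e2 ((∑ n ∈ Icc 1 M, a n) / q) ((∑ n ∈ Icc 1 N, b n) / q)]
  refine (kz_bilin_le q _ _).trans (le_of_eq ?_)
  rw [sum_zmod_eq_range, sum_zmod_eq_range]
  rfl

lemma kap_range_bound (d k : ℕ) : |∑ j ∈ range k, kap q (d * j)| ≤ 2 := by
  have : NeZero q := ⟨hq.out.ne_zero⟩
  by_cases hd : (d : ZMod q) = 0
  · have : ∀ j, kap q (d * j) = 0 := fun j => by simp [kap, kz, hd]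
    simp [this]
  have hsum : ∑ j ∈ range q, kap q (d * j) = 0 := by
    have := sum_zmod_eq_range q (fun z => kz q ((d : ZMod q) * z))
    rw [kz_row] at this
    rw [this]
    exact sum_congr rfl fun j _ => by simp [kap]
  have hper : ∀ n j, kap q (d * (q * n + j)) = kap q (d * j) := fun n j => by simp [kap]
  have hred : ∀ n r, ∑ j ∈ range (q * n + r), kap q (d * j) = ∑ j ∈ range r, kap q (d * j) := by
    intro n r
    rw [sum_range_add]
    simp_rw [hper]
    have : ∀ n, ∑ j ∈ range (q * n), kap q (d * j) = 0 := by
      intro n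
      induction n with
      | zero => simp
      | succ n ih => rw [mul_add, mul_one, sum_range_add, ih, zero_add]; simp_rw [hper]; exact hsum
    rw [this, zero_add]
  rw [← Nat.div_add_mod k q, hred]
  refine (abs_sum_le_sum_abs _ _).trans ?_
  calc ∑ j ∈ range (k % q), |kap q (d * j)| ≤ ∑ j ∈ range q, |kap q (d * j)| :=
        sum_le_sum_of_subset_of_nonneg (range_subset_range.2 (Nat.mod_lt _ hq.out.pos).le)
          fun _ _ _ => abs_nonneg _
    _ = ∑ z : ZMod q, |kz q ((d : ZMod q) * z)| := by
        rw [sum_zmod_eq_range]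
        exact sum_congr rfl fun j _ => by simp [kap]
    _ = ∑ z : ZMod q, |kz q z| := mul_sum_bij q d hd (fun z => |kz q z|)
    _ ≤ 2 := kz_abs_sum q

lemma abel_id (f g : ℕ → ℝ) (n : ℕ) (hn : 1 ≤ n) : ∑ k ∈ Icc 1 n, f k * g k =
    f n * ∑ k ∈ Icc 1 n, g k - ∑ k ∈ Ico 1 n, (f (k + 1) - f k) * ∑ j ∈ Icc 1 k, g j := by
  induction n, hn using Nat.le_induction with
  | base => simp
  | succ n hn ih =>
    rw [sum_Icc_succ_top (by omega), ih, sum_Icc_succ_top (by omega), sum_Ico_succ_top hn]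
    ring

lemma typeI (d N : ℕ) (f : ℕ → ℝ) : |∑ k ∈ Icc 1 N, f k * kap q (d * k)| ≤
    2 * (|f N| + ∑ k ∈ Ico 1 N, |f (k + 1) - f k|) := by
  rcases Nat.eq_zero_or_pos N with rfl | hN
  · simp
  have hb : ∀ k, |∑ j ∈ Icc 1 k, kap q (d * j)| ≤ 2 := by
    intro k
    have := kap_range_bound q d (k + 1)
    rw [range_eq_Ico, sum_eq_sum_Ico_succ_bot (by omega)] at this
    have h0 : kap q (d * 0) = 0 := by simp [kap, kz]
    rw [h0, zero_add, zero_add] at this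
    rwa [Ico_add_one_right_eq_Icc] at this
  rw [mul_add, mul_sum, abel_id _ _ N hN]
  refine (abs_sub _ _).trans (add_le_add ?_ ((abs_sum_le_sum_abs _ _).trans (sum_le_sum ?_)))
  · rw [abs_mul, mul_comm]; gcongr; exact hb N
  · intro k _
    rw [abs_mul, mul_comm]; gcongr; exact hb k
end
end CG

open Filter
namespace CG
open Real Finset MeasureTheory

lemma typeII_sum (P : Finset ℕ) (hP : ∀ q ∈ P, q.Prime) (Q : ℕ) (Q0 : ℝ) (hQ : ∀ q ∈ P, q ≤ Q)
    (hQ0 : 0 < Q0) (hQ0' : ∀ q ∈ P, Q0 ≤ q) (M N : ℕ) (a b : ℕ → ℝ) :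
    ∑ q ∈ P, |∑ m ∈ Icc 1 M, ∑ k ∈ Icc 1 N, a m * b k * kap q (m * k)| ≤
      28 / Q0 * √((M + (Q:ℝ) ^ 2) * (N + (Q:ℝ) ^ 2) * ((∑ m ∈ Icc 1 M, a m ^ 2) *
        ∑ k ∈ Icc 1 N, b k ^ 2)) := by
  have h1 : ∀ q ∈ P, |∑ m ∈ Icc 1 M, ∑ k ∈ Icc 1 N, a m * b k * kap q (m * k)| ≤
      1 / Q0 * (√(q * VV q M a) * √(q * VV q N b)) := by
    intro q hq
    have : Fact q.Prime := ⟨hP q hq⟩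
    have hb := bilin q M N a b
    have hq0 : 0 < (q:ℝ) := by exact_mod_cast (hP q hq).pos
    rw [← Real.sqrt_mul (mul_nonneg hq0.le (VV_nonneg _ _ _)),
      show q * VV q M a * (q * VV q N b) = q ^ 2 * (VV q M a * VV q N b) by ring,
      Real.sqrt_mul (by positivity), Real.sqrt_sq hq0.le, ← mul_assoc]
    refine (Real.abs_le_sqrt hb).trans ?_
    refine le_mul_of_one_le_left (Real.sqrt_nonneg _) ?_
    rw [one_div_mul_eq_div, le_div_iff₀ hQ0, one_mul]
    exact hQ0' q hq
  refine (sum_le_sum h1).trans ?_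
  rw [← mul_sum]
  have h2 := Real.sum_sqrt_mul_sqrt_le P (f := fun q : ℕ => (q:ℝ) * VV q M a)
    (g := fun q : ℕ => (q:ℝ) * VV q N b)
    (fun q => mul_nonneg (Nat.cast_nonneg q) (VV_nonneg _ _ _))
    (fun q => mul_nonneg (Nat.cast_nonneg q) (VV_nonneg _ _ _))
  have h3 := large_sieve P hP Q M hQ a
  have h4 := large_sieve P hP Q N hQ b
  have h5 : √(∑ q ∈ P, (q:ℝ) * VV q M a) * √(∑ q ∈ P, (q:ℝ) * VV q N b) ≤
      28 * √((M + (Q:ℝ) ^ 2) * (N + (Q:ℝ) ^ 2) * ((∑ m ∈ Icc 1 M, a m ^ 2) *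
        ∑ k ∈ Icc 1 N, b k ^ 2)) := by
    have hA : 0 ≤ ∑ m ∈ Icc 1 M, a m ^ 2 := sum_nonneg fun _ _ => sq_nonneg _
    have hB : 0 ≤ ∑ m ∈ Icc 1 N, b m ^ 2 := sum_nonneg fun _ _ => sq_nonneg _
    calc _ ≤ √(28 * (M + (Q : ℝ) ^ 2) * ∑ n ∈ Icc 1 M, a n ^ 2) *
          √(28 * (N + (Q : ℝ) ^ 2) * ∑ n ∈ Icc 1 N, b n ^ 2) := by gcongr
      _ = √(28 ^ 2 * ((M + (Q:ℝ) ^ 2) * (N + (Q:ℝ) ^ 2) * ((∑ m ∈ Icc 1 M, a m ^ 2) *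
        ∑ k ∈ Icc 1 N, b k ^ 2))) := by
          rw [← Real.sqrt_mul (by positivity)]; congr 1; ring
      _ = _ := by rw [Real.sqrt_mul (by positivity), Real.sqrt_sq (by norm_num)]
  refine (mul_le_mul_of_nonneg_left (h2.trans h5) (by positivity)).trans (le_of_eq (by ring))

noncomputable def WW (x : ℝ) (n : ℕ) : ℝ := max 0 (4 - |log n - (log x - 4)|)

noncomputable def II (c : ℝ) : ℝ → ℝ := (Set.Ioc (c - 4) c).indicator (fun _ => (1:ℝ))

lemma II_mul (c d : ℝ) : (fun t => II c t * II d t) =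
    (Set.Ioc (max (c - 4) (d - 4)) (min c d)).indicator (fun _ => (1:ℝ)) := by
  funext t
  have : Set.Ioc (max (c - 4) (d - 4)) (min c d) = Set.Ioc (c - 4) c ∩ Set.Ioc (d - 4) d := by
    rw [Set.Ioc_inter_Ioc]
  rw [this]
  simp only [II, Set.indicator_apply, Set.mem_inter_iff]
  split_ifs <;> simp_all

lemma II_integral (c d : ℝ) : ∫ t, II c t * II d t = max 0 (4 - |c - d|) := by
  rw [II_mul, integral_indicator measurableSet_Ioc, setIntegral_const, measureReal_def,
    Real.volume_Ioc, ENNReal.toReal_ofReal', smul_eq_mul, mul_one]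
  rcases le_total c d with h | h
  · rw [max_eq_right (by linarith : c - 4 ≤ d - 4), min_eq_left h, abs_of_nonpos (by linarith), max_comm]
    congr 1; ring
  · rw [max_eq_left (by linarith : d - 4 ≤ c - 4), min_eq_right h, abs_of_nonneg (by linarith), max_comm]
    congr 1; ring

lemma II_integrable (c d : ℝ) : Integrable (fun t => II c t * II d t) := by
  rw [II_mul]
  exact (integrable_indicator_iff measurableSet_Ioc).2 (by simp)

lemma WW_int (x : ℝ) (m k : ℕ) (hm : 1 ≤ m) (hk : 1 ≤ k) :
    WW x (m * k) = ∫ t, II (log m) t * II (log x - 4 - log k) t := by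
  rw [II_integral, WW]
  push_cast
  rw [Real.log_mul (by positivity) (by positivity)]
  congr 3; ring

lemma typeII_t (P : Finset ℕ) (hP : ∀ q ∈ P, q.Prime) (Q : ℕ) (Q0 : ℝ) (hQ : ∀ q ∈ P, q ≤ Q)
    (hQ0 : 0 < Q0) (hQ0' : ∀ q ∈ P, Q0 ≤ q) (x U L : ℝ) (hx : 1 ≤ x) (hU : 1 ≤ U) (hL : 0 ≤ L)
    (a b : ℕ → ℝ) (ha : ∀ m, |a m| ≤ 1) (ha0 : ∀ m : ℕ, (m : ℝ) ≤ U → a m = 0)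
    (hb : ∀ k : ℕ, (k : ℝ) ≤ x → |b k| ≤ L) (hb0 : ∀ k : ℕ, (k : ℝ) ≤ U → b k = 0) (t : ℝ) :
    ∑ q ∈ P, |∑ m ∈ Icc 1 ⌊x⌋₊, ∑ k ∈ Icc 1 ⌊x⌋₊, (a m * II (log m) t) *
      (b k * II (log x - 4 - log k) t) * kap q (m * k)| ≤
      28 / Q0 * (L * √(x ^ 2 + 2 * Q ^ 2 * x ^ 2 / U + Q ^ 4 * x)) := by
  set N := ⌊x⌋₊
  set E := exp (t + 4) with hE
  have hE0 : 0 < E := exp_pos _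
  have hI1 : ∀ m : ℕ, 1 ≤ m → E ≤ m → II (log m) t = 0 := by
    intro m hm h
    rw [II, Set.indicator_of_notMem]
    rintro ⟨h1, _⟩
    have : E > m := by
      rw [hE, gt_iff_lt, ← Real.log_lt_iff_lt_exp (by exact_mod_cast hm)]; linarith
    linarith
  have hI2 : ∀ k : ℕ, 1 ≤ k → x / E < k → II (log x - 4 - log k) t = 0 := by
    intro k hk h
    rw [II, Set.indicator_of_notMem]
    rintro ⟨_, h1⟩
    have hk' : (0:ℝ) < k := by exact_mod_cast hk
    have : log k ≤ log (x / E) := by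
      rw [Real.log_div (by positivity) (by positivity), hE, Real.log_exp]; linarith
    rw [Real.log_le_log_iff hk' (by positivity)] at this
    linarith
  have hII : ∀ c, |II c t| ≤ 1 := by
    intro c; rw [II, Set.indicator_apply]; split_ifs <;> simp
  by_cases c1 : E ≤ U
  · have : ∀ m ∈ Icc 1 N, a m * II (log m) t = 0 := by
      intro m hm
      rcases le_total E m with h | h
      · rw [hI1 m (mem_Icc.1 hm).1 h, mul_zero]
      · rw [ha0 m (h.trans c1), zero_mul]
    rw [sum_eq_zero]
    · positivity
    · intro q _
      rw [sum_eq_zero, abs_zero]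
      intro m hm
      refine sum_eq_zero fun k _ => ?_
      rw [this m hm]; ring
  by_cases c2 : x / E ≤ U
  · have : ∀ k ∈ Icc 1 N, b k * II (log x - 4 - log k) t = 0 := by
      intro m hm
      rcases lt_or_ge (x / E) m with h | h
      · rw [hI2 m (mem_Icc.1 hm).1 h, mul_zero]
      · rw [hb0 m (h.trans c2), zero_mul]
    rw [sum_eq_zero]
    · positivity
    · intro q _
      rw [sum_eq_zero, abs_zero]
      intro m hm
      refine sum_eq_zero fun k hk => ?_
      rw [this k hk]; ring
  push Not at c1 c2
  set M := min N ⌊E⌋₊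
  set K := min N ⌊x / E⌋₊
  have hME : (M:ℝ) ≤ E := (Nat.cast_le.2 (min_le_right _ _)).trans (Nat.floor_le hE0.le)
  have hKE : (K:ℝ) ≤ x / E := (Nat.cast_le.2 (min_le_right _ _)).trans (Nat.floor_le (by positivity))
  have hKx : (K:ℝ) ≤ x := (Nat.cast_le.2 (min_le_left _ _)).trans (Nat.floor_le (by positivity))
  have hred : ∀ q, ∑ m ∈ Icc 1 N, ∑ k ∈ Icc 1 N, (a m * II (log m) t) *
      (b k * II (log x - 4 - log k) t) * kap q (m * k) = ∑ m ∈ Icc 1 M, ∑ k ∈ Icc 1 K,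
      (a m * II (log m) t) * (b k * II (log x - 4 - log k) t) * kap q (m * k) := by
    intro q
    symm
    refine (sum_congr rfl fun m hm => ?_).trans
      (sum_subset (Icc_subset_Icc_right (min_le_left _ _)) ?_)
    · refine sum_subset (Icc_subset_Icc_right (min_le_left _ _)) ?_
      intro k hk hk'
      rw [hI2 k (mem_Icc.1 hk).1]
      · ring
      · rw [mem_Icc] at hk hk'
        have : K < k := by omega
        rcases min_lt_iff.1 this with h | h
        · omega
        · exact (Nat.floor_lt (by positivity)).1 h
    · intro m hm hm'
      refine sum_eq_zero fun k _ => ?_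
      rw [hI1 m (mem_Icc.1 hm).1]
      · ring
      · rw [mem_Icc] at hm hm'
        have : M < m := by omega
        rcases min_lt_iff.1 this with h | h
        · omega
        · exact ((Nat.floor_lt (by positivity)).1 h).le
  simp_rw [hred]
  refine (typeII_sum P hP Q Q0 hQ hQ0 hQ0' M K _ _).trans ?_
  have sA : ∑ m ∈ Icc 1 M, (a m * II (log m) t) ^ 2 ≤ E := by
    calc ∑ m ∈ Icc 1 M, (a m * II (log m) t) ^ 2 ≤ ∑ m ∈ Icc 1 M, (1:ℝ) := by
          refine sum_le_sum fun m _ => ?_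
          rw [← sq_abs, abs_mul]
          have := mul_le_one₀ (ha m) (abs_nonneg _) (hII (log m))
          exact pow_le_one₀ (by positivity) this
      _ = M := by simp
      _ ≤ E := hME
  have sB : ∑ k ∈ Icc 1 K, (b k * II (log x - 4 - log k) t) ^ 2 ≤ L ^ 2 * (x / E) := by
    calc ∑ k ∈ Icc 1 K, (b k * II (log x - 4 - log k) t) ^ 2 ≤ ∑ k ∈ Icc 1 K, L ^ 2 := by
          refine sum_le_sum fun k hk => ?_
          rw [← sq_abs, abs_mul]
          have hkx : (k:ℝ) ≤ x := (Nat.cast_le.2 (mem_Icc.1 hk).2).trans hKx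
          have : |b k| * |II (log x - 4 - log k) t| ≤ L := by
            calc _ ≤ L * 1 := mul_le_mul (hb k hkx) (hII _) (abs_nonneg _) hL
              _ = L := mul_one L
          gcongr
      _ = L ^ 2 * K := by simp; ring
      _ ≤ _ := by gcongr
  have hnB : 0 ≤ ∑ k ∈ Icc 1 K, (b k * II (log x - 4 - log k) t) ^ 2 := sum_nonneg fun _ _ => sq_nonneg _
  gcongr
  rw [← Real.sqrt_sq hL, ← Real.sqrt_mul (by positivity)]
  apply Real.sqrt_le_sqrt
  have hQ2 : (0:ℝ) ≤ (Q:ℝ) ^ 2 := by positivity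
  have hUpos : 0 < U := by linarith
  have hEx : E ≤ x / U := by
    rw [lt_div_iff₀ hE0] at c2
    rw [le_div_iff₀ hUpos]; linarith
  have hxE : x / E ≤ x / U := by gcongr
  calc ((M:ℝ) + (Q:ℝ) ^ 2) * (K + (Q:ℝ) ^ 2) * ((∑ m ∈ Icc 1 M, (a m * II (log m) t) ^ 2) *
        ∑ k ∈ Icc 1 K, (b k * II (log x - 4 - log k) t) ^ 2)
      ≤ (E + (Q:ℝ) ^ 2) * (x / E + (Q:ℝ) ^ 2) * (E * (L ^ 2 * (x / E))) := by gcongr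
    _ = L ^ 2 * (x ^ 2 + Q ^ 2 * x * (E + x / E) + Q ^ 4 * x) := by field_simp; ring
    _ ≤ L ^ 2 * (x ^ 2 + Q ^ 2 * x * (x / U + x / U) + Q ^ 4 * x) := by gcongr
    _ = _ := by ring

lemma typeII (P : Finset ℕ) (hP : ∀ q ∈ P, q.Prime) (Q : ℕ) (Q0 : ℝ) (hQ : ∀ q ∈ P, q ≤ Q)
    (hQ0 : 0 < Q0) (hQ0' : ∀ q ∈ P, Q0 ≤ q) (x U L : ℝ) (hx : 1 ≤ x) (hU : 1 ≤ U) (hL : 0 ≤ L)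
    (a b : ℕ → ℝ) (ha : ∀ m, |a m| ≤ 1) (ha0 : ∀ m : ℕ, (m : ℝ) ≤ U → a m = 0)
    (hb : ∀ k : ℕ, (k : ℝ) ≤ x → |b k| ≤ L) (hb0 : ∀ k : ℕ, (k : ℝ) ≤ U → b k = 0) :
    ∑ q ∈ P, |∑ m ∈ Icc 1 ⌊x⌋₊, ∑ k ∈ Icc 1 ⌊x⌋₊, a m * b k * (WW x (m * k) * kap q (m * k))| ≤
      (log x + 4) * (28 / Q0 * (L * √(x ^ 2 + 2 * Q ^ 2 * x ^ 2 / U + Q ^ 4 * x))) := by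
  set N := ⌊x⌋₊
  set Bd := 28 / Q0 * (L * √(x ^ 2 + 2 * Q ^ 2 * x ^ 2 / U + Q ^ 4 * x)) with hBd
  let g : ℕ → ℝ → ℝ := fun q t => ∑ m ∈ Icc 1 N, ∑ k ∈ Icc 1 N, (a m * II (log m) t) *
      (b k * II (log x - 4 - log k) t) * kap q (m * k)
  have hg : ∀ q, g q = fun t => ∑ m ∈ Icc 1 N, ∑ k ∈ Icc 1 N, (a m * b k * kap q (m * k)) *
      (II (log m) t * II (log x - 4 - log k) t) := by
    intro q; funext t
    exact sum_congr rfl fun m _ => sum_congr rfl fun k _ => by ring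
  have hgint : ∀ q, Integrable (g q) := by
    intro q
    rw [hg]
    exact integrable_finsetSum _ fun m _ => integrable_finsetSum _ fun k _ =>
      (II_integrable _ _).const_mul _
  have hval : ∀ q, ∑ m ∈ Icc 1 N, ∑ k ∈ Icc 1 N, a m * b k * (WW x (m * k) * kap q (m * k)) =
      ∫ t, g q t := by
    intro q
    rw [hg, integral_finsetSum _ fun m _ => integrable_finsetSum _ fun k _ =>
      (II_integrable _ _).const_mul _]
    refine sum_congr rfl fun m hm => ?_
    rw [integral_finsetSum _ fun k _ => (II_integrable _ _).const_mul _]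
    refine sum_congr rfl fun k hk => ?_
    rw [integral_const_mul, ← WW_int x m k (mem_Icc.1 hm).1 (mem_Icc.1 hk).1]
    ring
  simp_rw [hval]
  calc ∑ q ∈ P, |∫ t, g q t| ≤ ∑ q ∈ P, ∫ t, |g q t| :=
        sum_le_sum fun q _ => abs_integral_le_integral_abs
    _ = ∫ t, ∑ q ∈ P, |g q t| := (integral_finsetSum _ fun q _ => (hgint q).abs).symm
    _ ≤ ∫ t, (Set.Ioc (-4) (log x)).indicator (fun _ => Bd) t := by
        refine integral_mono (integrable_finsetSum _ fun q _ => (hgint q).abs)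
          ((integrable_indicator_iff measurableSet_Ioc).2 (by simp)) fun t => ?_
        by_cases ht : t ∈ Set.Ioc (-4) (log x)
        · rw [Set.indicator_of_mem ht]
          exact typeII_t P hP Q Q0 hQ hQ0 hQ0' x U L hx hU hL a b ha ha0 hb hb0 t
        · rw [Set.indicator_of_notMem ht]
          refine (sum_eq_zero fun q _ => ?_).le
          rw [abs_eq_zero]
          refine sum_eq_zero fun m hm => sum_eq_zero fun k _ => ?_
          have : II (log m) t = 0 := by
            rw [II, Set.indicator_of_notMem]
            rintro ⟨h1, h2⟩
            rw [mem_Icc] at hm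
            have hm1 : (1:ℝ) ≤ m := by exact_mod_cast hm.1
            have hmx : (m:ℝ) ≤ x := (Nat.cast_le.2 hm.2).trans (Nat.floor_le (by linarith))
            refine ht ⟨?_, h2.trans (Real.log_le_log (by linarith) hmx)⟩
            linarith [Real.log_nonneg hm1]
          rw [this]; ring
    _ = (log x + 4) * Bd := by
        rw [integral_indicator measurableSet_Ioc, setIntegral_const, measureReal_def,
          Real.volume_Ioc, ENNReal.toReal_ofReal (by linarith [Real.log_nonneg hx]), smul_eq_mul]
        ring
end CG

open Filter
namespace CG
open Real Finset

lemma conv_sum (f g : ArithmeticFunction ℝ) (N : ℕ) (h : ℕ → ℝ) (hh : ∀ n, N < n → h n = 0) :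
    ∑ n ∈ Icc 1 N, (f * g) n * h n =
      ∑ m ∈ Icc 1 N, ∑ k ∈ Icc 1 N, f m * g k * h (m * k) := by
  have hI : Icc 1 N = Ioc 0 N := rfl
  rw [hI]
  simp only [ArithmeticFunction.mul_apply]
  trans ∑ n ∈ Ioc 0 N, ∑ y ∈ Ioc 0 N ×ˢ Ioc 0 N with y.1 * y.2 = n, f y.1 * g y.2 * h (y.1 * y.2)
  · refine sum_congr rfl fun n hn => ?_
    simp only [mem_Ioc] at hn
    rw [Nat.divisorsAntidiagonal_eq_prod_filter_of_le hn.1.ne' hn.2, sum_mul]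
    refine sum_congr rfl fun y hy => ?_
    rw [(mem_filter.1 hy).2]
  · simp_rw [sum_filter]
    rw [sum_comm, sum_product]
    refine sum_congr rfl fun m hm => sum_congr rfl fun k hk => ?_
    rw [sum_ite_eq]
    split_ifs with hc
    · rfl
    · rw [hh, mul_zero]
      simp only [mem_Ioc] at hc hm hk
      have : 0 < m * k := Nat.mul_pos hm.1 hk.1
      omega

noncomputable def cutL (U : ℝ) (f : ArithmeticFunction ℝ) : ArithmeticFunction ℝ :=
  ⟨fun n => if (n : ℝ) ≤ U then f n else 0, by simp⟩
noncomputable def cutG (U : ℝ) (f : ArithmeticFunction ℝ) : ArithmeticFunction ℝ :=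
  ⟨fun n => if (n : ℝ) ≤ U then 0 else f n, by simp⟩

lemma cutL_apply (U f n) : cutL U f n = if (n : ℝ) ≤ U then f n else 0 := rfl
lemma cutG_apply (U f n) : cutG U f n = if (n : ℝ) ≤ U then 0 else f n := rfl

lemma cut_add (U f) : cutL U f + cutG U f = f := by
  ext n
  rw [ArithmeticFunction.add_apply, cutL_apply, cutG_apply]
  split_ifs <;> simp

open ArithmeticFunction in
lemma vaughan_id (U : ℝ) : (vonMangoldt : ArithmeticFunction ℝ) =
    cutL U vonMangoldt + cutL U (moebius : ArithmeticFunction ℝ) * ArithmeticFunction.log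
     - (cutL U (moebius : ArithmeticFunction ℝ) * cutL U vonMangoldt) * (zeta : ArithmeticFunction ℝ)
     + cutG U (moebius : ArithmeticFunction ℝ) * (cutG U vonMangoldt * (zeta : ArithmeticFunction ℝ)) := by
  have h1 := cut_add U vonMangoldt
  have h2 := cut_add U (moebius : ArithmeticFunction ℝ)
  have h3 : (zeta : ArithmeticFunction ℝ) * (moebius : ArithmeticFunction ℝ) = 1 := by
    exact coe_zeta_mul_coe_moebius
  have h4 : vonMangoldt * (zeta : ArithmeticFunction ℝ) = ArithmeticFunction.log :=
    vonMangoldt_mul_zeta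
  rw [← h4]
  set A := cutL U vonMangoldt
  set B := cutG U vonMangoldt
  set C := cutL U (moebius : ArithmeticFunction ℝ)
  set D := cutG U (moebius : ArithmeticFunction ℝ)
  set Z := (zeta : ArithmeticFunction ℝ)
  rw [← h2] at h3
  rw [← h1]
  linear_combination (-B) * h3

open ArithmeticFunction in
lemma mu_abs (n : ℕ) : |((moebius : ArithmeticFunction ℝ)) n| ≤ 1 := by
  rw [intCoe_apply]
  have := ArithmeticFunction.abs_moebius_le_one (n := n)
  exact_mod_cast this

open ArithmeticFunction in
lemma conv_zeta_le (f : ArithmeticFunction ℝ) (hf : ∀ n, |f n| ≤ vonMangoldt n)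
    (g : ArithmeticFunction ℝ) (hg : ∀ n, |g n| ≤ 1) (n : ℕ) :
    |(g * f) n| ≤ Real.log n := by
  have h4 : (zeta : ArithmeticFunction ℝ) * vonMangoldt = ArithmeticFunction.log :=
    zeta_mul_vonMangoldt
  rw [← log_apply, ← h4, mul_apply, mul_apply]
  refine (abs_sum_le_sum_abs _ _).trans (sum_le_sum fun y hy => ?_)
  rw [abs_mul, natCoe_apply, zeta_apply_ne (Nat.ne_zero_of_mem_divisorsAntidiagonal hy).1]
  push_cast
  exact mul_le_mul (hg _) (hf _) (abs_nonneg _) zero_le_one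

open ArithmeticFunction in
lemma cutL_le (U : ℝ) (n : ℕ) : |cutL U vonMangoldt n| ≤ vonMangoldt n := by
  rw [cutL_apply]; split_ifs
  · rw [abs_of_nonneg vonMangoldt_nonneg]
  · simp
open ArithmeticFunction in
lemma cutG_le (U : ℝ) (n : ℕ) : |cutG U vonMangoldt n| ≤ vonMangoldt n := by
  rw [cutG_apply]; split_ifs
  · simp
  · rw [abs_of_nonneg vonMangoldt_nonneg]
open ArithmeticFunction in
lemma cutL_mu (U : ℝ) (n : ℕ) : |cutL U (moebius : ArithmeticFunction ℝ) n| ≤ 1 := by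
  rw [cutL_apply]; split_ifs
  · exact mu_abs n
  · simp
open ArithmeticFunction in
lemma cutG_mu (U : ℝ) (n : ℕ) : |cutG U (moebius : ArithmeticFunction ℝ) n| ≤ 1 := by
  rw [cutG_apply]; split_ifs
  · simp
  · exact mu_abs n

lemma WW_nonneg (x n) : 0 ≤ WW x n := le_max_left _ _
lemma WW_le (x n) : WW x n ≤ 4 := max_le (by norm_num) (by linarith [abs_nonneg (log n - (log x - 4))])
lemma WW_lip (x : ℝ) (m n : ℕ) : |WW x m - WW x n| ≤ |log m - log n| := by
  unfold WW
  rw [max_comm 0, max_comm 0]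
  refine (abs_max_sub_max_le_abs _ _ _).trans ?_
  rw [sub_sub_sub_cancel_left]
  refine (abs_abs_sub_abs_le_abs_sub _ _).trans (le_of_eq ?_)
  rw [abs_sub_comm]
  congr 1; ring
lemma WW_big (x : ℝ) (hx : 0 < x) (n : ℕ) (h : x ≤ n) : WW x n = 0 := by
  rw [WW, max_eq_left]
  have := Real.log_le_log hx h
  have := le_abs_self (log n - (log x - 4))
  linarith
lemma WW_small (x : ℝ) (hx : 0 < x) (n : ℕ) (hn : 1 ≤ n) (h : n ≤ x * exp (-8)) : WW x n = 0 := by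
  rw [WW, max_eq_left]
  have h1 : (0:ℝ) < n := by exact_mod_cast hn
  have := Real.log_le_log h1 h
  rw [Real.log_mul hx.ne' (exp_ne_zero _), Real.log_exp] at this
  have := neg_le_abs (log n - (log x - 4))
  linarith

lemma sum_inv_le (N : ℕ) : ∑ k ∈ Ico 1 N, (1:ℝ) / k ≤ 1 + log N := by
  have := harmonic_le_one_add_log N
  refine le_trans ?_ this
  rw [harmonic_eq_sum_Icc]
  push_cast
  refine (sum_le_sum_of_subset_of_nonneg (t := Icc 1 N) (fun a ha => ?_) fun i _ _ => by positivity).trans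
    (le_of_eq (by simp))
  rw [mem_Ico] at ha; rw [mem_Icc]; omega

lemma log_succ (k : ℕ) (hk : 1 ≤ k) : |log ((k + 1 : ℕ) : ℝ) - log k| ≤ 1 / k := by
  have h1 : (0:ℝ) < k := by exact_mod_cast hk
  push_cast
  rw [abs_of_nonneg (by linarith [Real.log_le_log h1 (by linarith : (k:ℝ) ≤ k + 1)]),
    ← Real.log_div (by positivity) (by positivity)]
  refine (Real.log_le_sub_one_of_pos (by positivity)).trans (le_of_eq ?_)
  field_simp; ring

lemma typeI_one (q : ℕ) [Fact q.Prime] (x L : ℝ) (hx : 1 ≤ x) (hLx : log x = L) (hL : 1 ≤ L) (φ : ℕ → ℝ)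
    (h1 : ∀ k : ℕ, 1 ≤ k → (k:ℝ) ≤ x → |φ k| ≤ L) (h2 : ∀ k : ℕ, 1 ≤ k → |φ (k + 1) - φ k| ≤ 1 / k)
    (m : ℕ) (hm : 1 ≤ m) :
    |∑ k ∈ Icc 1 ⌊x⌋₊, φ k * (WW x (m * k) * kap q (m * k))| ≤ 28 * L ^ 2 := by
  set N := ⌊x⌋₊ with hN
  have hN1 : 1 ≤ N := by rw [hN, Nat.one_le_floor_iff]; exact hx
  have hNx : (N:ℝ) ≤ x := Nat.floor_le (by linarith)
  have := typeI q m N (fun k => φ k * WW x (m * k))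
  have e : ∑ k ∈ Icc 1 N, φ k * (WW x (m * k) * kap q (m * k)) =
    ∑ k ∈ Icc 1 N, φ k * WW x (m * k) * kap q (m * k) := sum_congr rfl fun k _ => by ring
  rw [e]
  refine this.trans ?_
  have a1 : |φ N * WW x (m * N)| ≤ 4 * L := by
    rw [abs_mul, abs_of_nonneg (WW_nonneg _ _)]
    calc _ ≤ L * 4 := mul_le_mul (h1 N hN1 hNx) (WW_le _ _) (WW_nonneg _ _) (by linarith)
      _ = _ := by ring
  have a2 : ∀ k ∈ Ico 1 N, |φ (k+1) * WW x (m * (k+1)) - φ k * WW x (m * k)| ≤ (4 + L) * (1 / k) := by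
    intro k hk
    rw [mem_Ico] at hk
    have hk1 : (1:ℝ) ≤ k := by exact_mod_cast hk.1
    have hkx : (k:ℝ) ≤ x := (Nat.cast_le.2 hk.2.le).trans hNx
    have e : φ (k+1) * WW x (m * (k+1)) - φ k * WW x (m * k) =
      (φ (k+1) - φ k) * WW x (m * (k+1)) + φ k * (WW x (m * (k + 1)) - WW x (m * k)) := by ring
    rw [e]
    refine (abs_add_le _ _).trans ?_
    rw [abs_mul, abs_mul, abs_of_nonneg (WW_nonneg _ _)]
    have b1 : |WW x (m * (k + 1)) - WW x (m * k)| ≤ 1 / k := by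
      refine (WW_lip _ _ _).trans ?_
      have := log_succ k hk.1
      have hm0 : (m:ℝ) ≠ 0 := by positivity
      push_cast at this ⊢
      rw [Real.log_mul hm0 (by positivity), Real.log_mul hm0 (by positivity)]
      simpa using this
    have := mul_le_mul (h2 k hk.1) (WW_le x (m * (k+1))) (WW_nonneg _ _) (by positivity)
    have := mul_le_mul (h1 k hk.1 hkx) b1 (abs_nonneg _) (by linarith)
    linarith
  have a3 := (sum_le_sum a2)
  rw [← mul_sum] at a3
  have a4 := sum_inv_le N
  have a5 : log N ≤ L := by
    rw [← hLx]; exact Real.log_le_log (by exact_mod_cast hN1) hNx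
  have a6 : (4 + L) * ∑ k ∈ Ico 1 N, (1:ℝ) / k ≤ (4 + L) * (1 + L) := by
    gcongr; linarith
  nlinarith

lemma typeI_tot (q : ℕ) [Fact q.Prime] (x L : ℝ) (hx : 1 ≤ x) (hLx : log x = L) (hL : 1 ≤ L) (φ : ℕ → ℝ)
    (h1 : ∀ k : ℕ, 1 ≤ k → (k:ℝ) ≤ x → |φ k| ≤ L) (h2 : ∀ k : ℕ, 1 ≤ k → |φ (k + 1) - φ k| ≤ 1 / k)
    (D G : ℝ) (hD : 0 ≤ D) (hG : 0 ≤ G) (g : ℕ → ℝ) (hg : ∀ m : ℕ, 1 ≤ m → (m:ℝ) ≤ x → |g m| ≤ G)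
    (hg0 : ∀ m : ℕ, D < m → g m = 0) :
    |∑ m ∈ Icc 1 ⌊x⌋₊, ∑ k ∈ Icc 1 ⌊x⌋₊, g m * φ k * (WW x (m * k) * kap q (m * k))| ≤
      D * (G * (28 * L ^ 2)) := by
  set N := ⌊x⌋₊ with hN
  have hNx : (N:ℝ) ≤ x := Nat.floor_le (by linarith)
  calc _ ≤ ∑ m ∈ Icc 1 N, (if m ∈ Icc 1 ⌊D⌋₊ then (G * (28 * L ^ 2)) else 0) := by
        refine (abs_sum_le_sum_abs _ _).trans (sum_le_sum fun m hm => ?_)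
        rw [mem_Icc] at hm
        have e : ∑ k ∈ Icc 1 N, g m * φ k * (WW x (m * k) * kap q (m * k)) =
          g m * ∑ k ∈ Icc 1 N, φ k * (WW x (m * k) * kap q (m * k)) := by
          rw [mul_sum]; exact sum_congr rfl fun k _ => by ring
        rw [e, abs_mul]
        split_ifs with hc
        · exact mul_le_mul (hg m hm.1 ((Nat.cast_le.2 hm.2).trans hNx))
            (typeI_one q x L hx hLx hL φ h1 h2 m hm.1) (abs_nonneg _) hG
        · rw [hg0 m, abs_zero, zero_mul]
          rw [mem_Icc] at hc
          exact (Nat.floor_lt hD).1 (by omega)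
    _ = ∑ m ∈ Icc 1 N ∩ Icc 1 ⌊D⌋₊, (G * (28 * L ^ 2)) := by rw [sum_ite_mem]
    _ ≤ ∑ m ∈ Icc 1 ⌊D⌋₊, (G * (28 * L ^ 2)) :=
        sum_le_sum_of_subset_of_nonneg inter_subset_right fun _ _ _ => by positivity
    _ = ⌊D⌋₊ * (G * (28 * L ^ 2)) := by simp
    _ ≤ _ := by gcongr; exact Nat.floor_le hD

open ArithmeticFunction in
lemma vaughan_bound (P : Finset ℕ) (hP : ∀ q ∈ P, q.Prime) (Q : ℕ) (Q0 : ℝ) (hQ : ∀ q ∈ P, q ≤ Q)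
    (hQ0 : 0 < Q0) (hQ0' : ∀ q ∈ P, Q0 ≤ q) (x U L : ℝ) (hx : 1 ≤ x) (hU : 1 ≤ U)
    (hLx : Real.log x = L) (hL : 1 ≤ L) (hUx : U ≤ x * exp (-8)) :
    ∑ q ∈ P, |∑ n ∈ Icc 1 ⌊x⌋₊, vonMangoldt n * (WW x n * kap q n)| ≤
      P.card * (56 * L ^ 3 * U ^ 2) +
      (L + 4) * (28 / Q0 * (L * √(x ^ 2 + 2 * Q ^ 2 * x ^ 2 / U + Q ^ 4 * x))) := by
  set N := ⌊x⌋₊ with hN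
  have hx0 : 0 < x := by linarith
  set a : ArithmeticFunction ℝ := cutG U (moebius : ArithmeticFunction ℝ)
  set b : ArithmeticFunction ℝ := (cutG U vonMangoldt * (zeta : ArithmeticFunction ℝ))
  set c : ArithmeticFunction ℝ := cutL U (moebius : ArithmeticFunction ℝ)
  set e : ArithmeticFunction ℝ := c * cutL U vonMangoldt
  have hlogx : ∀ k : ℕ, 1 ≤ k → (k:ℝ) ≤ x → Real.log k ≤ L := fun k hk h => by
    rw [← hLx]; exact Real.log_le_log (by exact_mod_cast hk) h
  have hT2 := typeII P hP Q Q0 hQ hQ0 hQ0' x U L hx hU (by linarith) a b (cutG_mu U)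
    (fun m hm => by rw [cutG_apply, if_pos hm])
    (fun k hk => by
      rcases Nat.eq_zero_or_pos k with rfl | h
      · simp; linarith
      · refine le_trans ?_ (hlogx k h hk)
        have := conv_zeta_le (cutG U vonMangoldt) (cutG_le U) (zeta : ArithmeticFunction ℝ)
          (fun n => by rw [natCoe_apply, zeta_apply]; split_ifs <;> simp) k
        rwa [mul_comm] at this)
    (fun k hk => by
      rw [mul_apply]
      refine sum_eq_zero fun y hy => ?_
      have : y.1 ≤ k := Nat.divisor_le (Nat.fst_mem_divisors_of_mem_antidiagonal hy)
      rw [cutG_apply, if_pos ((Nat.cast_le.2 this).trans hk), zero_mul])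
  rw [hLx] at hT2
  refine le_trans ?_ (add_le_add_right hT2 _)
  rw [← nsmul_eq_mul, ← sum_const, ← sum_add_distrib]
  refine sum_le_sum fun q hq => ?_
  have : Fact q.Prime := ⟨hP q hq⟩
  have hh : ∀ n, N < n → WW x n * kap q n = 0 := by
    intro n hn
    rw [WW_big x hx0 n ((Nat.lt_of_floor_lt hn).le), zero_mul]
  have hid : ∀ n, vonMangoldt n = cutL U vonMangoldt n + (c * ArithmeticFunction.log) n
      - (e * (zeta : ArithmeticFunction ℝ)) n + (a * b) n := by
    intro n
    conv_lhs => rw [vaughan_id U]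
    simp [a, b, c, e, sub_eq_add_neg]
  have hS : ∑ n ∈ Icc 1 N, vonMangoldt n * (WW x n * kap q n) =
      ∑ m ∈ Icc 1 N, ∑ k ∈ Icc 1 N, c m * ArithmeticFunction.log k * (WW x (m * k) * kap q (m * k))
      - ∑ m ∈ Icc 1 N, ∑ k ∈ Icc 1 N, e m * (zeta : ArithmeticFunction ℝ) k * (WW x (m * k) * kap q (m * k))
      + ∑ m ∈ Icc 1 N, ∑ k ∈ Icc 1 N, a m * b k * (WW x (m * k) * kap q (m * k)) := by
    rw [← conv_sum c _ N (fun n => WW x n * kap q n) hh,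
      ← conv_sum e _ N (fun n => WW x n * kap q n) hh,
      ← conv_sum a _ N (fun n => WW x n * kap q n) hh, ← sum_sub_distrib, ← sum_add_distrib]
    refine sum_congr rfl fun n hn => ?_
    have h0 : cutL U vonMangoldt n * (WW x n * kap q n) = 0 := by
      rw [cutL_apply]
      split_ifs with h
      · rw [WW_small x hx0 n (mem_Icc.1 hn).1 (h.trans hUx)]; ring
      · ring
    rw [hid n]
    linear_combination h0
  rw [hS]
  have t1 := typeI_tot q x L hx hLx hL (fun k => ArithmeticFunction.log k)
    (fun k hk hkx => by
      rw [log_apply, abs_of_nonneg (Real.log_natCast_nonneg k)]; exact hlogx k hk hkx)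
    (fun k hk => by simpa only [log_apply] using log_succ k hk) U 1 (by linarith) zero_le_one c
    (fun m _ _ => cutL_mu U m) (fun m hm => by rw [cutL_apply, if_neg (not_le.2 hm)])
  have t2 := typeI_tot q x L hx hLx hL (fun k => (zeta : ArithmeticFunction ℝ) k)
    (fun k hk hkx => by
      rw [natCoe_apply, zeta_apply_ne (by omega)]; simpa using hL)
    (fun k hk => by
      rw [natCoe_apply, natCoe_apply, zeta_apply_ne (by omega), zeta_apply_ne (by omega)]; simp)
    (U ^ 2) L (by positivity) (by linarith) e
    (fun m hm hmx => (conv_zeta_le _ (cutL_le U) c (cutL_mu U) m).trans (hlogx m hm hmx))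
    (fun m hm => by
      rw [mul_apply]
      refine sum_eq_zero fun y hy => ?_
      rw [cutL_apply]
      rw [cutL_apply]
      split_ifs with h1 h2
      · exfalso
        have := (Nat.mem_divisorsAntidiagonal.1 hy).1
        have h3 : (m:ℝ) = y.1 * y.2 := by rw [← this]; push_cast; ring
        have := mul_le_mul h1 h2 (Nat.cast_nonneg _) (by linarith)
        nlinarith
      all_goals simp)
  refine (abs_add_le _ _).trans (add_le_add_left ?_ _)
  refine (abs_sub _ _).trans ((add_le_add t1 t2).trans ?_)
  have hUU : U ≤ U ^ 2 := by nlinarith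
  have hLL : L ^ 2 ≤ L ^ 3 := by nlinarith [sq_nonneg L]
  have : U * L ^ 2 ≤ U ^ 2 * L ^ 3 := mul_le_mul hUU hLL (by positivity) (by positivity)
  nlinarith
end CG

open Filter
namespace CG
open Real Finset

lemma pl (C : ℝ) (k : ℕ) (a b : ℝ) (hab : a < b) :
    ∀ᶠ x : ℝ in atTop, C * log x ^ k * x ^ a ≤ x ^ b := by
  have h := isLittleO_log_rpow_rpow_atTop (s := b - a) (k : ℝ) (by linarith)
  have h2 := h.bound (show (0:ℝ) < 1 / (|C| + 1) by positivity)
  filter_upwards [h2, eventually_ge_atTop 1] with x hx hx1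
  have hx0 : 0 < x := by linarith
  have hl := Real.log_nonneg hx1
  rw [Real.rpow_natCast, Real.norm_of_nonneg (by positivity), Real.norm_of_nonneg (by positivity)] at hx
  have h3 : (|C| + 1) * log x ^ k ≤ x ^ (b - a) := by
    calc _ ≤ (|C| + 1) * (1 / (|C| + 1) * x ^ (b - a)) := by gcongr
      _ = _ := by field_simp
  calc C * log x ^ k * x ^ a ≤ (|C| + 1) * log x ^ k * x ^ a := by
        gcongr; linarith [le_abs_self C]
    _ ≤ x ^ (b - a) * x ^ a := by gcongr
    _ = x ^ b := by rw [← Real.rpow_add hx0]; congr 1; ring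

lemma log_add_two (y : ℝ) (hy : 1 ≤ y) : log (y + 2) ≤ 2 + log y := by
  calc log (y + 2) ≤ log (3 * y) := Real.log_le_log (by linarith) (by linarith)
    _ = log 3 + log y := Real.log_mul (by norm_num) (by linarith)
    _ ≤ _ := by linarith [Real.log_le_sub_one_of_pos (show (0:ℝ) < 3 by norm_num)]

lemma theta_win : ∀ᶠ X : ℝ in atTop, X / 2 ≤ Chebyshev.theta X - Chebyshev.theta (X * exp (-3)) := by
  filter_upwards [pl 100 1 (1/2) 1 (by norm_num), eventually_ge_atTop 100] with X h hX
  have h1 := Chebyshev.theta_ge' (x := X) (by linarith)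
  have h2 := Chebyshev.theta_le_log4_mul_x (x := X * exp (-3)) (by positivity)
  have h3 := log_add_two X (by linarith)
  rw [pow_one, Real.rpow_one, ← Real.sqrt_eq_rpow] at h
  have h4 : log 4 = 2 * log 2 := by
    rw [show (4:ℝ) = 2 ^ 2 by norm_num, Real.log_pow]; norm_num
  have h5 : exp (-3) ≤ 1 / 16 := by
    rw [Real.exp_neg, inv_eq_one_div]
    apply one_div_le_one_div_of_le (by norm_num)
    have := Real.exp_one_gt_d9
    calc (16:ℝ) ≤ 2.7 ^ 3 := by norm_num
      _ ≤ exp 1 ^ 3 := by gcongr; linarith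
      _ = exp 3 := by rw [← Real.exp_nat_mul]; norm_num
  have l2 := Real.log_two_gt_d9
  have l2' := Real.log_two_lt_d9
  have hs : 1 ≤ √X := by rw [Real.one_le_sqrt]; linarith
  have hl : 0 ≤ log X := Real.log_nonneg (by linarith)
  have h6 : log X ≤ log X * √X := le_mul_of_one_le_right hl hs
  have h7 : log 4 * (X * exp (-3)) ≤ (2 * log 2) * (X * (1 / 16)) := by
    rw [h4]; gcongr
  have h8 : X * 0.69 ≤ X * log 2 := by gcongr; linarith
  nlinarith

lemma T_lower (q : ℕ) (hq : q.Prime) (x : ℝ) (hx : 1 ≤ x) (hqx : (q:ℝ) ≤ x * exp (-7)) :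
    Chebyshev.theta (x * exp (-4)) - Chebyshev.theta (x * exp (-7)) ≤
      ∑ n ∈ Icc 1 ⌊x⌋₊ with ¬ q ∣ n, ArithmeticFunction.vonMangoldt n * WW x n := by
  have hx0 : 0 < x := by linarith
  have h74 : x * exp (-7) ≤ x * exp (-4) := by gcongr; norm_num
  have h4 : x * exp (-4) ≤ x := mul_le_of_le_one_right hx0.le (by rw [Real.exp_le_one_iff]; norm_num)
  rw [Chebyshev.theta, Chebyshev.theta, sub_le_iff_le_add]
  have hsub : (Ioc 0 ⌊x * exp (-4)⌋₊).filter Nat.Prime ⊆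
     (Ioc ⌊x * exp (-7)⌋₊ ⌊x * exp (-4)⌋₊).filter Nat.Prime ∪ (Ioc 0 ⌊x * exp (-7)⌋₊).filter Nat.Prime := by
    intro p hp
    simp only [mem_union, mem_filter, mem_Ioc] at hp ⊢
    by_cases h : p ≤ ⌊x * exp (-7)⌋₊
    · right; exact ⟨⟨hp.1.1, h⟩, hp.2⟩
    · left; exact ⟨⟨by omega, hp.1.2⟩, hp.2⟩
  refine (sum_le_sum_of_subset_of_nonneg hsub fun p _ _ => Real.log_natCast_nonneg p).trans ?_
  rw [sum_union]
  · gcongr ?_ + _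
    calc _ ≤ ∑ p ∈ Ioc ⌊x * exp (-7)⌋₊ ⌊x * exp (-4)⌋₊ with p.Prime,
          ArithmeticFunction.vonMangoldt p * WW x p := by
          refine sum_le_sum fun p hp => ?_
          rw [mem_filter, mem_Ioc] at hp
          have hp0 : (0:ℝ) < p := by exact_mod_cast hp.2.pos
          rw [ArithmeticFunction.vonMangoldt_apply_prime hp.2]
          refine le_mul_of_one_le_right (Real.log_natCast_nonneg p) ?_
          have a1 : x * exp (-7) ≤ p := (Nat.lt_of_floor_lt hp.1.1).le
          have a2 : p ≤ x * exp (-4) := (Nat.le_floor_iff (by positivity)).1 hp.1.2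
          have b1 := Real.log_le_log (by positivity) a1
          have b2 := Real.log_le_log hp0 a2
          rw [Real.log_mul hx0.ne' (exp_ne_zero _), Real.log_exp] at b1 b2
          rw [WW]
          refine le_max_of_le_right ?_
          have : |log p - (log x - 4)| ≤ 3 := by rw [abs_le]; constructor <;> linarith
          linarith
      _ ≤ _ := by
          refine sum_le_sum_of_subset_of_nonneg ?_ fun p _ _ =>
            mul_nonneg ArithmeticFunction.vonMangoldt_nonneg (WW_nonneg _ _)
          intro p hp
          rw [mem_filter, mem_Ioc] at hp
          rw [mem_filter, mem_Icc]
          refine ⟨⟨hp.2.one_le, hp.1.2.trans (Nat.floor_le_floor h4)⟩, ?_⟩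
          intro hd
          rw [Nat.prime_dvd_prime_iff_eq hq hp.2] at hd
          subst hd
          have := Nat.le_floor hqx
          omega
  · rw [disjoint_left]
    intro p hp hp'
    simp only [mem_filter, mem_Ioc] at hp hp'
    omega

noncomputable def cnt (q : ℕ) (x : ℝ) : ℕ :=
  ((Icc 1 ⌊x⌋₊).filter (fun p => p.Prime ∧ q ∣ p - 1)).card

lemma S_upper (q : ℕ) [Fact q.Prime] (x : ℝ) (hx : 1 ≤ x) :
    ∑ n ∈ Icc 1 ⌊x⌋₊ with ((n : ℕ) : ZMod q) = 1, ArithmeticFunction.vonMangoldt n * WW x n ≤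
      4 * (cnt q x * log x + 2 * √x * log x) := by
  have hx0 : 0 < x := by linarith
  have h1 := Chebyshev.psi_sub_theta_le hx
  rw [Chebyshev.psi_sub_theta_eq_sum_not_prime] at h1
  calc _ ≤ ∑ n ∈ Icc 1 ⌊x⌋₊ with ((n : ℕ) : ZMod q) = 1, 4 * ArithmeticFunction.vonMangoldt n := by
        refine sum_le_sum fun n _ => ?_
        rw [mul_comm]
        gcongr
        exact WW_le _ _
    _ = 4 * ∑ n ∈ Icc 1 ⌊x⌋₊ with ((n : ℕ) : ZMod q) = 1, ArithmeticFunction.vonMangoldt n := by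
        rw [mul_sum]
    _ ≤ _ := by
        gcongr
        refine (sum_le_sum_of_subset_of_nonneg (t := (Icc 1 ⌊x⌋₊).filter (fun p => p.Prime ∧ q ∣ p - 1) ∪
          (Ioc 0 ⌊x⌋₊).filter (fun n => ¬ n.Prime)) ?_ fun _ _ _ =>
            ArithmeticFunction.vonMangoldt_nonneg).trans ?_
        · intro n hn
          rw [mem_filter, mem_Icc] at hn
          rw [mem_union, mem_filter, mem_filter, mem_Icc, mem_Ioc]
          by_cases hp : n.Prime
          · left
            refine ⟨hn.1, hp, ?_⟩
            rw [← ZMod.natCast_eq_zero_iff, Nat.cast_sub hn.1.1, hn.2]; simp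
          · right; exact ⟨⟨by omega, hn.1.2⟩, hp⟩
        rw [sum_union]
        · refine add_le_add ?_ h1
          rw [cnt, ← nsmul_eq_mul]
          refine sum_le_card_nsmul _ _ _ fun n hn => ?_
          rw [mem_filter, mem_Icc] at hn
          refine ArithmeticFunction.vonMangoldt_le_log.trans (Real.log_le_log ?_ ?_)
          · exact_mod_cast hn.1.1
          · exact (Nat.le_floor_iff hx0.le).1 hn.1.2
        · rw [disjoint_left]
          intro p hp hp'
          rw [mem_filter] at hp hp'
          exact hp'.2 hp.2.1

lemma S_eq (q : ℕ) [hq : Fact q.Prime] (x : ℝ) :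
    ∑ n ∈ Icc 1 ⌊x⌋₊, ArithmeticFunction.vonMangoldt n * (WW x n * kap q n) =
    ∑ n ∈ Icc 1 ⌊x⌋₊ with ((n : ℕ) : ZMod q) = 1, ArithmeticFunction.vonMangoldt n * WW x n -
    1 / ((q:ℝ) - 1) * ∑ n ∈ Icc 1 ⌊x⌋₊ with ¬ q ∣ n, ArithmeticFunction.vonMangoldt n * WW x n := by
  rw [mul_sum, sum_filter, sum_filter, ← sum_sub_distrib]
  refine sum_congr rfl fun n _ => ?_
  rw [kap, kz]
  by_cases h0 : ((n:ℕ) : ZMod q) = 0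
  · rw [if_pos h0, h0, if_neg zero_ne_one, if_neg (not_not.2 ((ZMod.natCast_eq_zero_iff _ _).1 h0))]
    ring
  · rw [if_neg h0, if_pos (mt (ZMod.natCast_eq_zero_iff _ _).2 h0)]
    split_ifs <;> ring

lemma cnt_lower (q : ℕ) (hq : q.Prime) (x c Y : ℝ) (hx : 1 ≤ x) (hqx : (q:ℝ) ≤ x * exp (-7))
    (hc : 0 < c)
    (hT : c * x ≤ Chebyshev.theta (x * exp (-4)) - Chebyshev.theta (x * exp (-7)))
    (hqY : (q:ℝ) * Y ≤ x)
    (hS : |∑ n ∈ Icc 1 ⌊x⌋₊, ArithmeticFunction.vonMangoldt n * (WW x n * kap q n)| ≤ c / 2 * Y) :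
    c / 2 * Y ≤ 4 * (cnt q x * log x + 2 * √x * log x) := by
  have : Fact q.Prime := ⟨hq⟩
  have h1 := S_eq q x
  have h2 := S_upper q x hx
  have h3 := hT.trans (T_lower q hq x hx hqx)
  have h4 := q_sub_pos q
  have h5 : c * Y ≤ 1 / ((q:ℝ) - 1) * ∑ n ∈ Icc 1 ⌊x⌋₊ with ¬ q ∣ n,
      ArithmeticFunction.vonMangoldt n * WW x n := by
    rw [one_div_mul_eq_div, le_div_iff₀ h4]
    refine le_trans ?_ h3
    rcases le_total 0 Y with hY | hY
    · nlinarith [mul_nonneg hc.le hY]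
    · have : c * Y * ((q:ℝ) - 1) ≤ 0 :=
        mul_nonpos_of_nonpos_of_nonneg (mul_nonpos_of_nonneg_of_nonpos hc.le hY) h4.le
      have : 0 ≤ c * x := by positivity
      linarith
  have h6 := (abs_le.1 hS).1
  linarith

lemma pi_big (s : ℝ) (hs : s < 1) : ∀ᶠ y : ℝ in atTop, 2 * y ^ s ≤ (Nat.primeCounting ⌊y⌋₊ : ℝ) := by
  filter_upwards [pl 4 1 s 1 hs, pl 100 1 0 1 (by norm_num), eventually_ge_atTop 100] with y h1 h2 hy
  have h3 := Chebyshev.pi_ge' (x := y) (by linarith)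
  refine le_trans ?_ h3
  have hl : 0 < log y := Real.log_pos (by linarith)
  rw [le_div_iff₀ hl]
  rw [Real.rpow_one, pow_one] at h1 h2
  rw [Real.rpow_zero, mul_one] at h2
  have h4 := log_add_two y (by linarith)
  have l2 := Real.log_two_gt_d9
  have l2' := Real.log_two_lt_d9
  have h8 : y * 0.69 ≤ y * log 2 := by gcongr; linarith
  nlinarith

noncomputable def PP (y z : ℝ) : Finset ℕ := (Nat.primesLE ⌊z⌋₊).filter (fun q : ℕ => y ≤ q)

lemma PP_card (y z : ℝ) (hy : 0 ≤ y) (h : 2 * y ≤ (Nat.primeCounting ⌊z⌋₊ : ℝ)) : y ≤ (PP y z).card := by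
  have h1 : Nat.primesLE ⌊z⌋₊ ⊆ PP y z ∪ Icc 1 ⌊y⌋₊ := by
    intro p hp
    rw [mem_union, PP, mem_filter, mem_Icc]
    rcases le_total y p with h | h
    · exact Or.inl ⟨hp, h⟩
    · exact Or.inr ⟨(Nat.prime_of_mem_primesLE hp).one_le, Nat.le_floor h⟩
  have h2 := (card_le_card h1).trans (card_union_le _ _)
  rw [Nat.primesLE_card_eq_primeCounting, Nat.card_Icc, Nat.add_sub_cancel] at h2
  have h3 : (Nat.primeCounting ⌊z⌋₊ : ℝ) ≤ (PP y z).card + ⌊y⌋₊ := by exact_mod_cast h2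
  have := Nat.floor_le hy
  linarith

set_option maxHeartbeats 1600000 in
lemma A_main : AProp := by
  intro ρ ε hρ hρ2 hε
  obtain ⟨e, he0, he1, he2, he3, he4⟩ : ∃ e : ℝ, 0 < e ∧ e ≤ ε ∧ 2 * e < ρ ∧ 2 * e < 1 / 16 ∧
      2 * e < 1 / 2 - ρ := by
    refine ⟨min (min ε (ρ / 4)) (min (1 / 64) ((1 / 2 - ρ) / 4)), ?_, ?_, ?_, ?_, ?_⟩
    · have : 0 < (1 / 2 - ρ) / 4 := by linarith
      positivity
    · exact (min_le_left _ _).trans (min_le_left _ _)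
    · linarith [(min_le_left (min ε (ρ / 4)) (min (1 / 64) ((1 / 2 - ρ) / 4))).trans (min_le_right _ _)]
    · linarith [(min_le_right (min ε (ρ / 4)) (min (1 / 64) ((1 / 2 - ρ) / 4))).trans (min_le_left _ _)]
    · linarith [(min_le_right (min ε (ρ / 4)) (min (1 / 64) ((1 / 2 - ρ) / 4))).trans (min_le_right _ _)]
  obtain ⟨c, hc⟩ : ∃ c : ℝ, c = exp (-4) / 2 := ⟨_, rfl⟩
  have hc0 : 0 < c := by rw [hc]; positivity
  have t1 : Tendsto (fun x : ℝ => x * exp (-4)) atTop atTop :=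
    tendsto_id.atTop_mul_const (exp_pos _)
  have t2 : Tendsto (fun x : ℝ => x ^ ρ) atTop atTop := tendsto_rpow_atTop hρ
  filter_upwards [t1.eventually theta_win, t2.eventually (pi_big (1 - e / ρ) (by
      have : 0 < e / ρ := by positivity
      linarith)),
    eventually_ge_atTop (exp 1),
    pl (exp 8) 0 (1/8) 1 (by norm_num), pl (exp 7) 0 ρ 1 (by linarith),
    pl (56 * 8 / c) 3 (1/4) (1 - ρ) (by linarith),
    pl (140 * 8 / c) 2 (1 - 2 * ρ + 2 * e) (1 - ρ) (by linarith),
    pl (280 * 8 / c) 2 (1 - ρ - 1 / 16 + 2 * e) (1 - ρ) (by linarith),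
    pl (140 * 8 / c) 2 (1 / 2 + 2 * e) (1 - ρ) (by linarith),
    pl (16 / c) 1 (1 - ρ - ε) (1 - ρ) (by linarith),
    pl (32 / c) 1 (1 / 2) (1 - ρ) (by linarith)] with x hth hpi hxe h1 h2 h3 h4 h5 h6 h7 h8
  have hx0 : 0 < x := (exp_pos _).trans_le hxe
  have hL : 1 ≤ log x := (Real.le_log_iff_exp_le hx0).2 hxe
  have hx1 : 1 ≤ x := (by rw [Real.one_le_exp_iff]; norm_num : (1:ℝ) ≤ exp 1).trans hxe
  obtain ⟨L, hLx⟩ : ∃ L, log x = L := ⟨_, rfl⟩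
  rw [hLx] at h1 h2 h3 h4 h5 h6 h7 h8 hL
  rw [pow_zero, mul_one, Real.rpow_one] at h1 h2
  have hT : c * x ≤ Chebyshev.theta (x * exp (-4)) - Chebyshev.theta (x * exp (-7)) := by
    rw [mul_assoc, ← Real.exp_add, show (-4:ℝ) + -3 = -7 by norm_num] at hth
    rw [hc]; linarith
  have hcard := PP_card (x ^ (ρ - e)) (x ^ ρ) (by positivity) (by
    rw [← Real.rpow_mul hx0.le, show ρ * (1 - e / ρ) = ρ - e by field_simp] at hpi
    exact hpi)
  set P := PP (x ^ (ρ - e)) (x ^ ρ)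
  have hPp : ∀ q ∈ P, q.Prime := fun q hq => Nat.prime_of_mem_primesLE (mem_filter.1 hq).1
  have hPQ : ∀ q ∈ P, q ≤ ⌊x ^ ρ⌋₊ := fun q hq => Nat.le_of_mem_primesLE (mem_filter.1 hq).1
  have hP0 : ∀ q ∈ P, x ^ (ρ - e) ≤ q := fun q hq => (mem_filter.1 hq).2
  have hPx : ∀ q ∈ P, (q:ℝ) ≤ x ^ ρ := fun q hq => (Nat.le_floor_iff (by positivity)).1 (hPQ q hq)
  have hV := vaughan_bound P hPp ⌊x ^ ρ⌋₊ (x ^ (ρ - e)) hPQ (by positivity) hP0 x (x ^ (1/8:ℝ)) L hx1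
    (Real.one_le_rpow hx1 (by norm_num)) hLx hL (by
      rw [Real.exp_neg, ← div_eq_mul_inv, le_div_iff₀ (exp_pos _)]; linarith)
  have hcpos : (0:ℝ) < P.card := lt_of_lt_of_le (by positivity) hcard
  have hne : P.Nonempty := by
    rw [← card_pos]; exact_mod_cast hcpos
  have hsq : √(x ^ 2 + 2 * (⌊x ^ ρ⌋₊:ℝ) ^ 2 * x ^ 2 / x ^ (1/8:ℝ) + (⌊x ^ ρ⌋₊:ℝ) ^ 4 * x) ≤
      x + 2 * x ^ (1 + ρ - 1 / 16) + x ^ (2 * ρ + 1 / 2) := by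
    have hfl : (⌊x ^ ρ⌋₊:ℝ) ≤ x ^ ρ := Nat.floor_le (by positivity)
    rw [Real.sqrt_le_iff]
    refine ⟨by positivity, ?_⟩
    have b1 : (x ^ ρ) ^ 2 * x ^ 2 / x ^ (1/8:ℝ) = (x ^ (1 + ρ - 1 / 16)) ^ 2 := by
      rw [← Real.rpow_natCast, ← Real.rpow_natCast, ← Real.rpow_natCast, ← Real.rpow_mul hx0.le,
        ← Real.rpow_mul hx0.le, ← Real.rpow_add hx0, ← Real.rpow_sub hx0]
      congr 1; push_cast; ring
    have b2 : (x ^ ρ) ^ 4 * x = (x ^ (2 * ρ + 1 / 2)) ^ 2 := by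
      nth_rewrite 2 [← Real.rpow_one x]
      rw [← Real.rpow_natCast, ← Real.rpow_natCast, ← Real.rpow_mul hx0.le,
        ← Real.rpow_mul hx0.le, ← Real.rpow_add hx0]
      congr 1; push_cast; ring
    have b3 : 2 * (⌊x ^ ρ⌋₊:ℝ) ^ 2 * x ^ 2 / x ^ (1/8:ℝ) ≤ 2 * (x ^ (1 + ρ - 1 / 16)) ^ 2 := by
      rw [← b1]
      calc _ ≤ 2 * (x ^ ρ) ^ 2 * x ^ 2 / x ^ (1/8:ℝ) := by gcongr
        _ = _ := by ring
    have b4 : (⌊x ^ ρ⌋₊:ℝ) ^ 4 * x ≤ (x ^ (2 * ρ + 1 / 2)) ^ 2 := by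
      rw [← b2]; gcongr
    have p1 : 0 < x ^ (1 + ρ - 1 / 16) := by positivity
    have p2 : 0 < x ^ (2 * ρ + 1 / 2) := by positivity
    nlinarith [mul_pos hx0 p1, mul_pos hx0 p2, mul_pos p1 p2]
  have hE : P.card * (56 * L ^ 3 * (x ^ (1/8:ℝ)) ^ 2) +
      (L + 4) * (28 / x ^ (ρ - e) * (L * √(x ^ 2 + 2 * (⌊x ^ ρ⌋₊:ℝ) ^ 2 * x ^ 2 / x ^ (1/8:ℝ) +
        (⌊x ^ ρ⌋₊:ℝ) ^ 4 * x))) ≤ ∑ q ∈ P, c / 2 * x ^ (1 - ρ) := by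
    rw [sum_const, nsmul_eq_mul]
    set n : ℝ := (P.card : ℝ)
    set W := √(x ^ 2 + 2 * (⌊x ^ ρ⌋₊:ℝ) ^ 2 * x ^ 2 / x ^ (1/8:ℝ) + (⌊x ^ ρ⌋₊:ℝ) ^ 4 * x)
    have hL0 : 0 < L := by linarith
    have k3 : 56 * L ^ 3 * (x ^ (1/8:ℝ)) ^ 2 ≤ c / 8 * x ^ (1 - ρ) := by
      rw [← Real.rpow_natCast (x ^ (1/8:ℝ)), ← Real.rpow_mul hx0.le]
      norm_num only at h3 ⊢
      calc _ = c / 8 * (448 / c * L ^ 3 * x ^ (1 / 4 : ℝ)) := by field_simp; norm_num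
        _ ≤ _ := by gcongr
    have k4 : 140 * L ^ 2 * x ^ (1 - 2 * ρ + 2 * e) ≤ c / 8 * x ^ (1 - ρ) := by
      calc _ = c / 8 * (140 * 8 / c * L ^ 2 * x ^ (1 - 2 * ρ + 2 * e)) := by field_simp
        _ ≤ _ := by gcongr
    have k5 : 280 * L ^ 2 * x ^ (1 - ρ - 1 / 16 + 2 * e) ≤ c / 8 * x ^ (1 - ρ) := by
      calc _ = c / 8 * (280 * 8 / c * L ^ 2 * x ^ (1 - ρ - 1 / 16 + 2 * e)) := by field_simp
        _ ≤ _ := by gcongr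
    have k6 : 140 * L ^ 2 * x ^ (1 / 2 + 2 * e) ≤ c / 8 * x ^ (1 - ρ) := by
      calc _ = c / 8 * (140 * 8 / c * L ^ 2 * x ^ (1 / 2 + 2 * e)) := by field_simp
        _ ≤ _ := by gcongr
    have hz : 28 / x ^ (ρ - e) ≤ 28 * (n * x ^ (-2 * ρ + 2 * e)) := by
      rw [div_eq_mul_inv]
      gcongr
      calc (x ^ (ρ - e))⁻¹ = x ^ (ρ - e) * x ^ (-2 * ρ + 2 * e) := by
            rw [← Real.rpow_neg hx0.le, ← Real.rpow_add hx0]; congr 1; ring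
        _ ≤ _ := by gcongr
    have hR : (x + 2 * x ^ (1 + ρ - 1 / 16) + x ^ (2 * ρ + 1 / 2)) * x ^ (-2 * ρ + 2 * e) =
        x ^ (1 - 2 * ρ + 2 * e) + 2 * x ^ (1 - ρ - 1 / 16 + 2 * e) + x ^ (1 / 2 + 2 * e) := by
      have r1 : x * x ^ (-2 * ρ + 2 * e) = x ^ (1 - 2 * ρ + 2 * e) := by
        nth_rewrite 1 [← Real.rpow_one x]
        rw [← Real.rpow_add hx0]; congr 1; ring
      have r2 : x ^ (1 + ρ - 1 / 16) * x ^ (-2 * ρ + 2 * e) = x ^ (1 - ρ - 1 / 16 + 2 * e) := by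
        rw [← Real.rpow_add hx0]; congr 1; ring
      have r3 : x ^ (2 * ρ + 1 / 2) * x ^ (-2 * ρ + 2 * e) = x ^ (1 / 2 + 2 * e) := by
        rw [← Real.rpow_add hx0]; congr 1; ring
      rw [← r1, ← r2, ← r3]; ring
    have hsec : (L + 4) * (28 / x ^ (ρ - e) * (L * W)) ≤ n * (3 * (c / 8 * x ^ (1 - ρ))) := by
      calc (L + 4) * (28 / x ^ (ρ - e) * (L * W)) ≤
            (5 * L) * (28 * (n * x ^ (-2 * ρ + 2 * e)) * (L * (x + 2 * x ^ (1 + ρ - 1 / 16) +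
              x ^ (2 * ρ + 1 / 2)))) := by
            gcongr
            linarith
        _ = n * (140 * L ^ 2 * ((x + 2 * x ^ (1 + ρ - 1 / 16) + x ^ (2 * ρ + 1 / 2)) *
              x ^ (-2 * ρ + 2 * e))) := by ring
        _ ≤ _ := by
            rw [hR]
            refine mul_le_mul_of_nonneg_left ?_ hcpos.le
            linarith
    have hfst := mul_le_mul_of_nonneg_left k3 hcpos.le
    calc _ ≤ n * (c / 8 * x ^ (1 - ρ)) + n * (3 * (c / 8 * x ^ (1 - ρ))) := add_le_add hfst hsec
      _ = _ := by ring
  obtain ⟨q, hq, hqS⟩ := exists_le_of_sum_le hne (hV.trans hE)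
  refine ⟨q, hPp q hq, ?_, hPx q hq, ?_⟩
  · refine le_trans ?_ (hP0 q hq)
    exact Real.rpow_le_rpow_of_exponent_le hx1 (by linarith)
  have hfin := cnt_lower q (hPp q hq) x c (x ^ (1 - ρ)) hx1 (by
      rw [Real.exp_neg, ← div_eq_mul_inv, le_div_iff₀ (exp_pos _)]
      have := mul_le_mul_of_nonneg_right (hPx q hq) (exp_pos 7).le
      linarith) hc0 hT (by
      calc (q:ℝ) * x ^ (1 - ρ) ≤ x ^ ρ * x ^ (1 - ρ) := by gcongr; exact hPx q hq
        _ = x := by rw [← Real.rpow_add hx0]; simp) hqS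
  rw [hLx] at hfin
  change _ ≤ (cnt q x : ℝ)
  have g7 : 16 * L * x ^ (1 - ρ - ε) ≤ c * x ^ (1 - ρ) := by
    calc _ = c * (16 / c * L ^ 1 * x ^ (1 - ρ - ε)) := by field_simp
      _ ≤ _ := by gcongr
  have g8 : 32 * L * √x ≤ c * x ^ (1 - ρ) := by
    rw [Real.sqrt_eq_rpow]
    calc _ = c * (32 / c * L ^ 1 * x ^ (1 / 2 : ℝ)) := by field_simp
      _ ≤ _ := by gcongr
  have : L * x ^ (1 - ρ - ε) ≤ L * cnt q x := by nlinarith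
  exact le_of_mul_le_mul_left this (by linarith)
end CG

theorem congruence_growth_SL2_lower :
    (3 - 2 * Real.sqrt 2) / 4 ≤
      liminf
        (fun n : ℕ => Real.log (congCount 2 n) / ((Real.log n) ^ 2 / Real.log (Real.log n)))
        atTop := CG.C_final CG.A_main
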